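/- arXiv:2301.13040 — 4 statements merged into one kernel-verified Lean document; each statement's English description precedes it below -/
import Mathlib

section
/- Let k be a field, let d ≥ 4 be an integer not divisible by char(k), let μ ∈ k^*, and let f = x^{d−1} y + z^d and g = x^{d−1} y + z^d + μ x^{d−2} z^2 in k[x, y, z]. Then for each r ≥ 0, the hypersurfaces V(f) and V(g) in P^{r+2} are not isomorphic as varieties. -/
/-!
Common set-up: projective `n`-space over a field `k` as the scheme
`Proj k[x_0, …, x_n]`, complements of hypersurfaces as open subschemes,
hypersurfaces as reduced closed subschemes, and isomorphisms of varieties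
over `k` as scheme isomorphisms commuting with the structure morphisms
to `Spec k`.
-/

open AlgebraicGeometry CategoryTheory MvPolynomial

attribute [local instance] MvPolynomial.gradedAlgebra

noncomputable section

/-- The standard grading on the polynomial ring `k[x_0, …, x_n]`. -/
abbrev grading (k : Type) [Field k] (n : ℕ) := homogeneousSubmodule (Fin (n + 1)) k

/-- Projective `n`-space over `k`, as a scheme. -/
abbrev ProjSpace (k : Type) [Field k] (n : ℕ) : Scheme := Proj (grading k n)

/-- The base scheme `Spec k`. -/
abbrev SpecK (k : Type) [Field k] : Scheme := Spec (CommRingCat.of k)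

/-- The structure morphism `ℙⁿ_k ⟶ Spec k`. -/
abbrev projStruct (k : Type) [Field k] (n : ℕ) : ProjSpace k n ⟶ SpecK k :=
  Proj.toSpecZero (grading k n) ≫
    Spec.map (CommRingCat.ofHom (algebraMap k ((grading k n) 0)))

/-- The open complement `ℙⁿ_f = ℙⁿ ∖ V(f)` of the hypersurface `V(f)`, as a scheme. -/
abbrev PnF (k : Type) [Field k] (n : ℕ) (f : MvPolynomial (Fin (n + 1)) k) : Scheme :=
  (Proj.basicOpen (grading k n) f).toScheme

/-- The structure morphism `ℙⁿ_f ⟶ Spec k`. -/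
abbrev PnFStruct (k : Type) [Field k] (n : ℕ) (f : MvPolynomial (Fin (n + 1)) k) :
    PnF k n f ⟶ SpecK k :=
  (Proj.basicOpen (grading k n) f).ι ≫ projStruct k n

/-- Two schemes equipped with structure morphisms to a common base are isomorphic over
that base.  For varieties over `k` (with base `Spec k`) this is the usual notion of
isomorphism of varieties over `k`. -/
def IsoOver {X Y B : Scheme} (sX : X ⟶ B) (sY : Y ⟶ B) : Prop :=
  ∃ e : X ≅ Y, e.hom ≫ sY = sX

/-- The set of points of `ℙⁿ` where `f` vanishes. -/
def zeroLocusSet (k : Type) [Field k] (n : ℕ) (f : MvPolynomial (Fin (n + 1)) k) :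
    Set (ProjSpace k n) :=
  {x | f ∈ (x : ProjectiveSpectrum (grading k n)).asHomogeneousIdeal}

/-- `ι : H ⟶ ℙⁿ` realizes the scheme `H` as the hypersurface `V(f) ⊆ ℙⁿ`, i.e. as the
reduced closed subscheme of `ℙⁿ` whose underlying set is the zero locus of `f`. -/
structure IsHypersurface {k : Type} [Field k] {n : ℕ} (f : MvPolynomial (Fin (n + 1)) k)
    (H : Scheme) (ι : H ⟶ ProjSpace k n) : Prop where
  isClosedImmersion : IsClosedImmersion ι
  reduced : IsReduced H
  range_eq : Set.range ι.base = zeroLocusSet k n f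

namespace ConeHypersurface

open scoped WithZero

section Coordinates

variable {A : Type*} {r : ℕ}

/-- The coordinate vector `(a, b, c, u₁, …, u_r)`. -/
def coords (a b c : A) (u : Fin r → A) : Fin (r + 2 + 1) → A :=
  Fin.cons a (Fin.cons b (Fin.cons c u))

@[simp] lemma coords_zero (a b c : A) (u : Fin r → A) : coords a b c u 0 = a := rfl

@[simp] lemma coords_one (a b c : A) (u : Fin r → A) : coords a b c u 1 = b := rfl

@[simp] lemma coords_two (a b c : A) (u : Fin r → A) : coords a b c u 2 = c := rfl

@[simp] lemma coords_succ (a b c : A) (u : Fin r → A) (i : Fin r) :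
    coords a b c u i.succ.succ.succ = u i := rfl

lemma forall_coord {P : Fin (r + 2 + 1) → Prop} (h0 : P 0) (h1 : P 1) (h2 : P 2)
    (h : ∀ i : Fin r, P i.succ.succ.succ) : ∀ i, P i :=
  Fin.cases h0 (Fin.cases h1 (Fin.cases h2 h))

end Coordinates

lemma eval₂_smul_of_isHomogeneous {σ R A : Type*} [CommSemiring R] [CommSemiring A]
    {p : MvPolynomial σ R} {n : ℕ} (hp : p.IsHomogeneous n) (f : R →+* A) (c : A) (v : σ → A) :
    eval₂ f (fun i => c * v i) p = c ^ n * eval₂ f v p := by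
  rw [eval₂_eq, eval₂_eq, Finset.mul_sum]
  refine Finset.sum_congr rfl fun m hm => ?_
  have : ∑ i ∈ m.support, m i = n := by
    have := hp (mem_support_iff.mp hm)
    simpa [Finsupp.weight_apply, Finsupp.sum] using this
  simp only [mul_pow, Finset.prod_mul_distrib, Finset.prod_pow_eq_pow_sum, this]
  ring

section Model

variable (k : Type) [Field k] (r : ℕ)

/-- The field `k(w₁, …, w_r)`. -/
abbrev BaseField := FractionRing (MvPolynomial (Fin r) k)

/-- The field `k(w₁, …, w_r)(t)`. -/
abbrev FnField := RatFunc (BaseField k r)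

/-- The inclusion of `k[w₁, …, w_r][t]` in its field of fractions. -/
def polyToFn : Polynomial (MvPolynomial (Fin r) k) →+* FnField k r :=
  (algebraMap (Polynomial (BaseField k r)) (FnField k r)).comp
    (Polynomial.mapRingHom (algebraMap _ (BaseField k r)))

lemma polyToFn_injective : Function.Injective (polyToFn k r) := by
  refine (RatFunc.algebraMap_injective (BaseField k r)).comp
    (Polynomial.map_injective _ (IsFractionRing.injective _ (BaseField k r)))

variable {k r} (d : ℕ) (μ : k)

/-- The polynomial `-(t ^ d + μ t ^ 2)`, the value of `y / x` on the curve. -/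
def yPoly : Polynomial (MvPolynomial (Fin r) k) :=
  -(Polynomial.X ^ d + Polynomial.C (C μ) * Polynomial.X ^ 2)

/-- The endomorphism of `k[w][t]` given by `wᵢ ↦ y wᵢ`, where `y = -(t ^ d + μ t ^ 2)`. -/
def rescale : Polynomial (MvPolynomial (Fin r) k) →+* Polynomial (MvPolynomial (Fin r) k) :=
  Polynomial.eval₂RingHom
    (eval₂Hom (Polynomial.C.comp C) fun i => yPoly d μ * Polynomial.C (X i)) Polynomial.X

/-- The evaluation `k[x, y, z, u] → k[u][t]` at the point `(1, y(t), t, u)`. -/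
def dehom : MvPolynomial (Fin (r + 2 + 1)) k →+* Polynomial (MvPolynomial (Fin r) k) :=
  eval₂Hom (Polynomial.C.comp C)
    (coords 1 (yPoly d μ) Polynomial.X fun i => Polynomial.C (X i))

variable (k r) in
/-- The inclusion of `k` in the function field. -/
def constHom : k →+* FnField k r :=
  RatFunc.C.comp ((algebraMap (MvPolynomial (Fin r) k) (BaseField k r)).comp C)

/-- The value of `y / x` in the function field. -/
def yFn : FnField k r := -(RatFunc.X ^ d + constHom k r μ * RatFunc.X ^ 2)

/-- The element `wᵢ = uᵢ / y` of the function field. -/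
def wFn (i : Fin r) : FnField k r :=
  RatFunc.C (algebraMap (MvPolynomial (Fin r) k) (BaseField k r) (X i))

/-- The evaluation of polynomials at the generic point of the hypersurface. -/
def evalGen : MvPolynomial (Fin (r + 2 + 1)) k →+* FnField k r :=
  (polyToFn k r).comp ((rescale d μ).comp (dehom d μ))

lemma polyToFn_yPoly : polyToFn k r (yPoly d μ) = yFn d μ := by
  simp [polyToFn, yPoly, yFn, constHom]

lemma polyToFn_X : polyToFn k r Polynomial.X = RatFunc.X := by
  simp [polyToFn]

lemma polyToFn_C (p : MvPolynomial (Fin r) k) :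
    polyToFn k r (Polynomial.C p) = RatFunc.C (algebraMap _ (BaseField k r) p) := by
  simp [polyToFn]

lemma rescale_X : rescale (r := r) d μ Polynomial.X = Polynomial.X := by simp [rescale]

lemma rescale_C_C (a : k) :
    rescale (r := r) d μ (Polynomial.C (C a)) = Polynomial.C (C a) := by simp [rescale]

lemma rescale_C_X (i : Fin r) :
    rescale d μ (Polynomial.C (X i) : Polynomial (MvPolynomial (Fin r) k)) =
      yPoly d μ * Polynomial.C (X i) := by simp [rescale]

lemma rescale_yPoly : rescale (r := r) d μ (yPoly d μ) = yPoly d μ := by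
  rw [yPoly, map_neg, map_add, map_mul, map_pow, map_pow, rescale_X, rescale_C_C]

lemma evalGen_eq (p : MvPolynomial (Fin (r + 2 + 1)) k) :
    evalGen d μ p = eval₂ (constHom k r)
      (coords 1 (yFn d μ) RatFunc.X fun i => yFn d μ * wFn i) p := by
  have : evalGen (r := r) d μ = eval₂Hom (constHom k r)
      (coords 1 (yFn d μ) RatFunc.X fun i => yFn d μ * wFn i) := by
    refine ringHom_ext (fun a => ?_) (forall_coord ?_ ?_ ?_ fun i => ?_)
    · simp [evalGen, dehom, rescale_C_C, polyToFn_C, constHom]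
    · simp [evalGen, dehom]
    · simp [evalGen, dehom, rescale_yPoly, polyToFn_yPoly]
    · simp [evalGen, dehom, rescale_X, polyToFn_X]
    · simp [evalGen, dehom, rescale_C_X, polyToFn_yPoly, polyToFn_C, wFn]
  rw [this, coe_eval₂Hom]

/-- The value of a homogeneous polynomial at infinity on the generic line. -/
def leadHom : MvPolynomial (Fin (r + 2 + 1)) k →+* MvPolynomial (Fin r) k :=
  eval₂Hom C (coords 0 1 0 X)

/-- Substitution of `0` for `x` and `z`. -/
def substZero : MvPolynomial (Fin (r + 2 + 1)) k →+* MvPolynomial (Fin (r + 2 + 1)) k :=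
  eval₂Hom C (coords 0 (X 1) 0 fun i => X i.succ.succ.succ)

lemma substZero_eq_zero_of_leadHom {p : MvPolynomial (Fin (r + 2 + 1)) k} {n : ℕ}
    (hp : p.IsHomogeneous n) (h : leadHom p = 0) : substZero p = 0 := by
  let L := FractionRing (MvPolynomial (Fin (r + 2 + 1)) k)
  let j : MvPolynomial (Fin (r + 2 + 1)) k →+* L := algebraMap _ _
  have hj : Function.Injective j := IsFractionRing.injective _ _
  have h1 : j (X 1) ≠ 0 := fun h => X_ne_zero (R := k) (1 : Fin (r + 2 + 1)) (hj (by simpa using h))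
  apply hj
  let τ : MvPolynomial (Fin r) k →+* L :=
    eval₂Hom (j.comp C) fun i => j (X i.succ.succ.succ) / j (X 1)
  have e1 : τ.comp leadHom = eval₂Hom (j.comp C)
      (coords 0 1 0 fun i => j (X i.succ.succ.succ) / j (X 1)) := by
    refine ringHom_ext (fun a => ?_) (forall_coord ?_ ?_ ?_ fun i => ?_) <;> simp [τ, leadHom]
  have e2 : j.comp substZero = eval₂Hom (j.comp C) (fun i => j (X 1) *
      coords 0 1 0 (fun i => j (X i.succ.succ.succ) / j (X 1)) i) := by
    refine ringHom_ext (fun a => ?_) (forall_coord ?_ ?_ ?_ fun i => ?_) <;>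
      simp [substZero, mul_div_cancel₀, h1]
  have e3 := congrArg τ h
  have e1' := RingHom.congr_fun e1 p
  have e2' := RingHom.congr_fun e2 p
  simp only [RingHom.comp_apply, coe_eval₂Hom] at e1' e2'
  rw [eval₂_smul_of_isHomogeneous hp, ← e1', e3, map_zero, mul_zero] at e2'
  rw [e2', map_zero]

lemma leadHom_eq_zero_of_substZero {p : MvPolynomial (Fin (r + 2 + 1)) k}
    (h : substZero p = 0) : leadHom p = 0 := by
  have e : leadHom.comp substZero = leadHom (k := k) (r := r) := by
    refine ringHom_ext (fun a => ?_) (forall_coord ?_ ?_ ?_ fun i => ?_) <;>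
      simp [substZero, leadHom]
  rw [← e, RingHom.comp_apply, h, map_zero]

lemma rescale_injective (hd : 4 ≤ d) : Function.Injective (rescale (r := r) d μ) := by
  let L := FractionRing (Polynomial (MvPolynomial (Fin r) k))
  let j : Polynomial (MvPolynomial (Fin r) k) →+* L := algebraMap _ _
  have hj : Function.Injective j := IsFractionRing.injective _ _
  have hy : j (yPoly d μ) ≠ 0 := by
    rw [Ne, map_eq_zero_iff j hj, yPoly, neg_eq_zero]
    intro h
    have := congrArg (fun p => Polynomial.coeff p d) h
    simp [Polynomial.coeff_X_pow, Polynomial.coeff_C_mul, show d ≠ 2 by lia] at this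
  let τ : Polynomial (MvPolynomial (Fin r) k) →+* L :=
    Polynomial.eval₂RingHom (eval₂Hom (j.comp (Polynomial.C.comp C))
      fun i => j (Polynomial.C (X i)) / j (yPoly d μ)) (j Polynomial.X)
  have hτy : τ (yPoly d μ) = j (yPoly d μ) := by simp [τ, yPoly]
  have : τ.comp (rescale d μ) = j := by
    refine Polynomial.ringHom_ext' (ringHom_ext (fun a => ?_) fun i => ?_) ?_
    · simp [rescale_C_C, τ]
    · simp only [RingHom.comp_apply, rescale_C_X, map_mul, hτy]
      simp [τ, mul_div_cancel₀, hy]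
    · simp [rescale_X, τ]
  refine Function.Injective.of_comp (f := τ) ?_
  rw [← RingHom.coe_comp, this]
  exact hj

end Model

section Infinity

variable {k : Type} [Field k] {r : ℕ} (d : ℕ) (μ : k)

open Classical in
variable (k r) in
/-- The valuation `-deg_t` on the function field. -/
def infVal : Valuation (FnField k r) ℤᵐ⁰ := RatFunc.inftyValuation (BaseField k r)

lemma infVal_X : infVal k r RatFunc.X = WithZero.exp 1 := by
  classical exact RatFunc.inftyValuation.X _

lemma infVal_C {e : BaseField k r} (he : e ≠ 0) : infVal k r (RatFunc.C e) = 1 := by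
  classical exact RatFunc.inftyValuation.C _ he

lemma infVal_C_le (e : BaseField k r) : infVal k r (RatFunc.C e) ≤ 1 := by
  rcases eq_or_ne e 0 with rfl | he
  · simp
  · exact (infVal_C he).le

lemma infVal_algebraMap {p : Polynomial (BaseField k r)} (hp : p ≠ 0) :
    infVal k r (algebraMap _ _ p) = WithZero.exp (p.natDegree : ℤ) := by
  classical exact RatFunc.inftyValuation.polynomial _ hp

lemma coeff_eq_zero_of_infVal_le {p : Polynomial (BaseField k r)} {n m : ℕ}
    (h : infVal k r (algebraMap _ _ p) ≤ WithZero.exp (n : ℤ)) (hm : n < m) : p.coeff m = 0 := by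
  rcases eq_or_ne p 0 with rfl | hp
  · simp
  · rw [infVal_algebraMap hp, WithZero.exp_le_exp] at h
    exact Polynomial.coeff_eq_zero_of_natDegree_lt (by lia)

variable {d} in
lemma infVal_yFn (hd : 4 ≤ d) : infVal k r (yFn d μ) = WithZero.exp (d : ℤ) := by
  have e : yFn d μ = algebraMap (Polynomial (BaseField k r)) (FnField k r)
      (-(Polynomial.X ^ d + Polynomial.C (algebraMap (MvPolynomial (Fin r) k) (BaseField k r) (C μ))
        * Polynomial.X ^ 2)) := by
    simp [yFn, constHom]
  have hdeg : (-(Polynomial.X ^ d + Polynomial.C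
      (algebraMap (MvPolynomial (Fin r) k) (BaseField k r) (C μ)) * Polynomial.X ^ 2)).natDegree
        = d := by
    rw [Polynomial.natDegree_neg]
    compute_degree
    · simp [show d ≠ 2 by lia]
    · lia
    · lia
  have h0 : -(Polynomial.X ^ d + Polynomial.C
      (algebraMap (MvPolynomial (Fin r) k) (BaseField k r) (C μ)) * Polynomial.X ^ 2) ≠ 0 := by
    intro h
    rw [h, Polynomial.natDegree_zero] at hdeg
    lia
  rw [e, infVal_algebraMap h0, hdeg]

lemma yFn_ne_zero (hd : 4 ≤ d) : yFn (r := r) d μ ≠ 0 := by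
  intro h
  have := infVal_yFn (r := r) μ hd
  rw [h, map_zero] at this
  exact WithZero.exp_ne_zero this.symm

/-- `x = e + e' (z / y) + e'' (x / y)` up to terms of order at least `2 (d - 1)` at infinity. -/
def Expands (x : FnField k r) (e : BaseField k r) : Prop :=
  ∃ e' e'' : BaseField k r, infVal k r (x - RatFunc.C e -
    (RatFunc.C e' * (RatFunc.X / yFn d μ) + RatFunc.C e'' * (1 / yFn d μ))) ≤
      WithZero.exp (-(d - 1) : ℤ) * WithZero.exp (-(d - 1) : ℤ)

variable {d} {μ}

lemma infVal_linear_le (hd : 4 ≤ d) (e' e'' : BaseField k r) :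
    infVal k r (RatFunc.C e' * (RatFunc.X / yFn d μ) + RatFunc.C e'' * (1 / yFn d μ)) ≤
      WithZero.exp (-(d - 1) : ℤ) := by
  refine (infVal k r).map_add_le ?_ ?_
  · rw [map_mul, map_div₀, infVal_X, infVal_yFn μ hd, ← WithZero.exp_sub]
    refine (mul_le_of_le_one_left' (infVal_C_le _)).trans ?_
    rw [WithZero.exp_le_exp]
    lia
  · rw [map_mul, map_div₀, map_one, infVal_yFn μ hd, one_div, ← WithZero.exp_neg]
    refine (mul_le_of_le_one_left' (infVal_C_le _)).trans ?_
    rw [WithZero.exp_le_exp]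
    lia

lemma exp_sub_one_lt_one (hd : 4 ≤ d) : WithZero.exp (-(d - 1) : ℤ) < (1 : ℤᵐ⁰) := by
  rw [← WithZero.exp_zero, WithZero.exp_lt_exp]
  lia

lemma Expands.sub_le (hd : 4 ≤ d) {x : FnField k r} {e : BaseField k r} (h : Expands d μ x e) :
    infVal k r (x - RatFunc.C e) ≤ WithZero.exp (-(d - 1) : ℤ) := by
  obtain ⟨e', e'', h⟩ := h
  have := (infVal k r).map_add_le (h.trans (mul_le_of_le_one_left' (exp_sub_one_lt_one hd).le))
    (infVal_linear_le (μ := μ) hd e' e'')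
  rwa [sub_add_cancel] at this

lemma Expands.infVal_le (hd : 4 ≤ d) {x : FnField k r} {e : BaseField k r}
    (h : Expands d μ x e) : infVal k r x ≤ 1 := by
  have := (infVal k r).map_add_le ((h.sub_le hd).trans (exp_sub_one_lt_one hd).le) (infVal_C_le e)
  rwa [sub_add_cancel] at this

lemma Expands.infVal_eq (hd : 4 ≤ d) {x : FnField k r} {e : BaseField k r}
    (h : Expands d μ x e) (he : e ≠ 0) : infVal k r x = 1 := by
  have := (infVal k r).map_add_eq_of_lt_left
    (((h.sub_le hd).trans_lt (exp_sub_one_lt_one hd)).trans_eq (infVal_C he).symm)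
  rwa [add_sub_cancel, infVal_C he] at this

lemma Expands.infVal_lt (hd : 4 ≤ d) {x : FnField k r}
    (h : Expands d μ x 0) : infVal k r x ≤ WithZero.exp (-(d - 1) : ℤ) := by
  simpa using h.sub_le hd

lemma expands_C (e : BaseField k r) : Expands d μ (RatFunc.C e) e := ⟨0, 0, by simp⟩

lemma expands_X_div : Expands (r := r) d μ (RatFunc.X / yFn d μ) 0 := ⟨1, 0, by simp⟩

lemma expands_one_div : Expands (r := r) d μ (1 / yFn d μ) 0 := ⟨0, 1, by simp⟩

lemma Expands.add {x y : FnField k r} {a b : BaseField k r} (hx : Expands d μ x a)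
    (hy : Expands d μ y b) : Expands d μ (x + y) (a + b) := by
  obtain ⟨a', a'', hx⟩ := hx
  obtain ⟨b', b'', hy⟩ := hy
  refine ⟨a' + b', a'' + b'', ?_⟩
  convert (infVal k r).map_add_le hx hy using 2
  simp only [map_add]
  ring

lemma Expands.mul (hd : 4 ≤ d) {x y : FnField k r} {a b : BaseField k r} (hx : Expands d μ x a)
    (hy : Expands d μ y b) : Expands d μ (x * y) (a * b) := by
  have hy1 := hy.infVal_le hd
  obtain ⟨a', a'', hx⟩ := hx
  obtain ⟨b', b'', hy⟩ := hy
  have ha := infVal_linear_le (μ := μ) hd a' a''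
  have hb := infVal_linear_le (μ := μ) hd b' b''
  refine ⟨a * b' + b * a', a * b'' + b * a'', ?_⟩
  set La := RatFunc.C a' * (RatFunc.X / yFn d μ) + RatFunc.C a'' * (1 / yFn d μ) with hLa
  set Lb := RatFunc.C b' * (RatFunc.X / yFn d μ) + RatFunc.C b'' * (1 / yFn d μ) with hLb
  have key : x * y - RatFunc.C (a * b) - (RatFunc.C (a * b' + b * a') * (RatFunc.X / yFn d μ) +
      RatFunc.C (a * b'' + b * a'') * (1 / yFn d μ)) =
      (x - RatFunc.C a - La) * y + RatFunc.C a * (y - RatFunc.C b - Lb) +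
        (La * (y - RatFunc.C b - Lb) + La * Lb) := by
    simp only [map_add, map_mul, hLa, hLb]
    ring
  rw [key]
  refine (infVal k r).map_add_le ((infVal k r).map_add_le ?_ ?_)
    ((infVal k r).map_add_le ?_ ?_) <;> rw [map_mul]
  · exact (mul_le_of_le_one_right' hy1).trans hx
  · exact (mul_le_of_le_one_left' (infVal_C_le a)).trans hy
  · exact (mul_le_of_le_one_left' (ha.trans (exp_sub_one_lt_one hd).le)).trans hy
  · exact mul_le_mul' ha hb

lemma Expands.inv (hd : 4 ≤ d) {x : FnField k r} {a : BaseField k r} (hx : Expands d μ x a)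
    (ha : a ≠ 0) : Expands d μ x⁻¹ a⁻¹ := by
  have hx1 := hx.infVal_eq hd ha
  have hx0 : x ≠ 0 := by rintro rfl; simp at hx1
  have hC : RatFunc.C a ≠ 0 := by simpa using ha
  obtain ⟨a', a'', hx⟩ := hx
  have hL := infVal_linear_le (μ := μ) hd a' a''
  refine ⟨-(a' * a⁻¹ * a⁻¹), -(a'' * a⁻¹ * a⁻¹), ?_⟩
  set L := RatFunc.C a' * (RatFunc.X / yFn d μ) + RatFunc.C a'' * (1 / yFn d μ) with hLa
  have key : x⁻¹ - RatFunc.C a⁻¹ - (RatFunc.C (-(a' * a⁻¹ * a⁻¹)) * (RatFunc.X / yFn d μ) +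
      RatFunc.C (-(a'' * a⁻¹ * a⁻¹)) * (1 / yFn d μ)) =
      x⁻¹ * (RatFunc.C a⁻¹ * (RatFunc.C a⁻¹ * L * (x - RatFunc.C a - L) + RatFunc.C a⁻¹ * (L * L)
        - (x - RatFunc.C a - L))) := by
    have : RatFunc.C (-(a' * a⁻¹ * a⁻¹)) * (RatFunc.X / yFn d μ) +
      RatFunc.C (-(a'' * a⁻¹ * a⁻¹)) * (1 / yFn d μ) = - (RatFunc.C a⁻¹ * RatFunc.C a⁻¹ * L) := by
      simp only [map_mul, map_neg, hLa]
      ring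
    rw [this, map_inv₀]
    field_simp
    ring
  rw [key, map_mul, map_inv₀, hx1, inv_one, one_mul, map_mul]
  refine (mul_le_of_le_one_left' (infVal_C_le _)).trans ((infVal k r).map_sub_le
    ((infVal k r).map_add_le ?_ ?_) hx)
  · rw [map_mul, map_mul]
    exact (mul_le_of_le_one_left' (mul_le_one' (infVal_C_le _)
      (hL.trans (exp_sub_one_lt_one hd).le))).trans hx
  · rw [map_mul, map_mul]
    exact (mul_le_of_le_one_left' (infVal_C_le _)).trans (mul_le_mul' hL hL)

lemma evalGen_of_isHomogeneous (hd : 4 ≤ d) {p : MvPolynomial (Fin (r + 2 + 1)) k} {n : ℕ}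
    (hp : p.IsHomogeneous n) : evalGen d μ p = yFn d μ ^ n *
      eval₂ (constHom k r) (coords (1 / yFn d μ) 1 (RatFunc.X / yFn d μ) wFn) p := by
  rw [← eval₂_smul_of_isHomogeneous hp, evalGen_eq]
  congr 1
  have := yFn_ne_zero (r := r) d μ hd
  refine funext (forall_coord ?_ ?_ ?_ fun i => ?_) <;> simp <;> field_simp

lemma expands_eval₂ (hd : 4 ≤ d) (p : MvPolynomial (Fin (r + 2 + 1)) k) :
    Expands d μ (eval₂ (constHom k r) (coords (1 / yFn d μ) 1 (RatFunc.X / yFn d μ) wFn) p)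
      (algebraMap _ _ (leadHom p)) := by
  induction p using MvPolynomial.induction_on with
  | C a =>
    simpa [leadHom, constHom] using expands_C (d := d) (μ := μ)
      (algebraMap (MvPolynomial (Fin r) k) (BaseField k r) (C a))
  | add p q hp hq => simpa using hp.add hq
  | mul_X p i hp =>
    rw [eval₂_mul, eval₂_X, map_mul, map_mul]
    refine hp.mul hd ?_
    refine forall_coord (P := fun i => Expands d μ
      (coords (1 / yFn d μ) 1 (RatFunc.X / yFn d μ) wFn i)
      (algebraMap _ _ (leadHom (X i)))) ?_ ?_ ?_ (fun i => ?_) i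
    · simpa [leadHom] using expands_one_div (k := k) (r := r) (d := d) (μ := μ)
    · simpa [leadHom] using expands_C (k := k) (r := r) (d := d) (μ := μ) (1 : BaseField k r)
    · simpa [leadHom] using expands_X_div (k := k) (r := r) (d := d) (μ := μ)
    · simpa [leadHom, wFn] using expands_C (k := k) (d := d) (μ := μ) (r := r)
        (algebraMap (MvPolynomial (Fin r) k) (BaseField k r) (X i))

lemma leadHom_eq_zero_of_evalGen (hd : 4 ≤ d) {p : MvPolynomial (Fin (r + 2 + 1)) k} {n : ℕ}
    (hp : p.IsHomogeneous n) (h : evalGen d μ p = 0) : leadHom p = 0 := by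
  rw [evalGen_of_isHomogeneous hd hp, mul_eq_zero] at h
  have h := h.resolve_left (pow_ne_zero _ (yFn_ne_zero d μ hd))
  by_contra h0
  have := (expands_eval₂ (μ := μ) hd p).infVal_eq hd
    (by simpa using h0)
  rw [h, map_zero] at this
  exact zero_ne_one this

variable (d μ r) in
/-- The local ring of the hypersurface at the generic point of `x = z = 0`, as a subset of the
function field. -/
def vertexSet : Set (FnField k r) :=
  {x | ∃ (n : ℕ) (p q : MvPolynomial (Fin (r + 2 + 1)) k), p.IsHomogeneous n ∧
    q.IsHomogeneous n ∧ substZero q ≠ 0 ∧ x = evalGen d μ p / evalGen d μ q}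

lemma evalGen_ne_zero (hd : 4 ≤ d) {q : MvPolynomial (Fin (r + 2 + 1)) k} {n : ℕ}
    (hq : q.IsHomogeneous n) (h : substZero q ≠ 0) : evalGen d μ q ≠ 0 := fun h0 =>
  h (substZero_eq_zero_of_leadHom hq (leadHom_eq_zero_of_evalGen hd hq h0))

lemma exists_expands (hd : 4 ≤ d) {x : FnField k r} (hx : x ∈ vertexSet r d μ) :
    ∃ e, Expands d μ x e := by
  obtain ⟨n, p, q, hp, hq, hq0, rfl⟩ := hx
  rw [evalGen_of_isHomogeneous hd hp, evalGen_of_isHomogeneous hd hq,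
    mul_div_mul_left _ _ (pow_ne_zero _ (yFn_ne_zero d μ hd)), div_eq_mul_inv]
  refine ⟨_, (expands_eval₂ hd p).mul hd ((expands_eval₂ hd q).inv hd ?_)⟩
  simpa using fun h => hq0 (substZero_eq_zero_of_leadHom hq h)

lemma infVal_le_one_of_mem (hd : 4 ≤ d) {x : FnField k r} (hx : x ∈ vertexSet r d μ) :
    infVal k r x ≤ 1 :=
  let ⟨_, he⟩ := exists_expands hd hx
  he.infVal_le hd

/-- Elements of negative order are expanded with vanishing constant term. -/
lemma expands_zero_of_mem (hd : 4 ≤ d) {x : FnField k r} (hx : x ∈ vertexSet r d μ)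
    (h : infVal k r x < 1) : Expands d μ x 0 := by
  obtain ⟨e, he⟩ := exists_expands hd hx
  rcases eq_or_ne e 0 with rfl | h0
  · exact he
  · exact absurd (he.infVal_eq hd h0) h.ne

lemma one_div_yFn_mem : (1 / yFn d μ : FnField k r) ∈ vertexSet r d μ :=
  ⟨1, X 0, X 1, isHomogeneous_X _ _, isHomogeneous_X _ _, by simp [substZero],
    by simp [evalGen_eq]⟩

lemma X_div_yFn_mem : (RatFunc.X / yFn d μ : FnField k r) ∈ vertexSet r d μ :=
  ⟨1, X 2, X 1, isHomogeneous_X _ _, isHomogeneous_X _ _, by simp [substZero],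
    by simp [evalGen_eq]⟩

lemma constHom_mem (a : k) : constHom k r a ∈ vertexSet r d μ :=
  ⟨0, C a, 1, isHomogeneous_C _ _, isHomogeneous_one _ _, by simp,
    by simp [evalGen_eq]⟩

lemma wFn_mem (hd : 4 ≤ d) (i : Fin r) : (wFn i : FnField k r) ∈ vertexSet r d μ :=
  ⟨1, X i.succ.succ.succ, X 1, isHomogeneous_X _ _, isHomogeneous_X _ _, by simp [substZero],
    by simp [evalGen_eq, yFn_ne_zero d μ hd]⟩

lemma inv_mem_vertexSet (hd : 4 ≤ d) {x : FnField k r} (hx : x ∈ vertexSet r d μ)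
    (h : infVal k r x = 1) : x⁻¹ ∈ vertexSet r d μ := by
  obtain ⟨n, p, q, hp, hq, hq0, rfl⟩ := hx
  refine ⟨n, q, p, hq, hp, fun h0 => ?_, by rw [inv_div]⟩
  rw [evalGen_of_isHomogeneous hd hp, evalGen_of_isHomogeneous hd hq,
    mul_div_mul_left _ _ (pow_ne_zero _ (yFn_ne_zero d μ hd)), map_div₀,
    (expands_eval₂ hd q).infVal_eq hd
      (by simpa using fun h => hq0 (substZero_eq_zero_of_leadHom hq h)), div_one] at h
  have := expands_eval₂ (μ := μ) hd p
  rw [leadHom_eq_zero_of_substZero h0, map_zero] at this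
  exact ((this.infVal_lt hd).trans_lt (exp_sub_one_lt_one hd)).ne h

lemma add_mem_vertexSet (hd : 4 ≤ d) {x y : FnField k r} (hx : x ∈ vertexSet r d μ)
    (hy : y ∈ vertexSet r d μ) : x + y ∈ vertexSet r d μ := by
  obtain ⟨n, p, q, hp, hq, hq0, rfl⟩ := hx
  obtain ⟨n', p', q', hp', hq', hq0', rfl⟩ := hy
  refine ⟨n + n', p * q' + q * p', q * q', (hp.mul hq').add (hq.mul hp'), hq.mul hq', ?_, ?_⟩
  · rw [map_mul]
    exact mul_ne_zero hq0 hq0'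
  · rw [div_add_div _ _ (evalGen_ne_zero hd hq hq0) (evalGen_ne_zero hd hq' hq0')]
    simp

lemma mul_mem_vertexSet {x y : FnField k r} (hx : x ∈ vertexSet r d μ)
    (hy : y ∈ vertexSet r d μ) : x * y ∈ vertexSet r d μ := by
  obtain ⟨n, p, q, hp, hq, hq0, rfl⟩ := hx
  obtain ⟨n', p', q', hp', hq', hq0', rfl⟩ := hy
  refine ⟨n + n', p * p', q * q', hp.mul hp', hq.mul hq', ?_, ?_⟩
  · rw [map_mul]
    exact mul_ne_zero hq0 hq0'
  · simp [div_mul_div_comm]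

lemma C_algebraMap_mem (hd : 4 ≤ d) (p : MvPolynomial (Fin r) k) :
    RatFunc.C (algebraMap _ (BaseField k r) p) ∈ vertexSet r d μ := by
  induction p using MvPolynomial.induction_on with
  | C a => exact constHom_mem a
  | add p q hp hq => simpa using add_mem_vertexSet hd hp hq
  | mul_X p i hp => simpa [wFn] using mul_mem_vertexSet hp (wFn_mem hd i)

lemma inv_X_notMem (hd : 4 ≤ d) : (RatFunc.X⁻¹ : FnField k r) ∉ vertexSet r d μ := by
  intro h
  have hv : infVal k r RatFunc.X⁻¹ = WithZero.exp (-1 : ℤ) := by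
    rw [map_inv₀, infVal_X, WithZero.exp_neg]
  have := (expands_zero_of_mem hd h
    (by rw [hv, ← WithZero.exp_zero, WithZero.exp_lt_exp]; lia)).infVal_lt hd
  rw [hv, WithZero.exp_le_exp] at this
  lia

end Infinity

section Transfer

variable {k : Type} [Field k] {r : ℕ} {d : ℕ} {μ : k}

lemma valuation_polynomial_le {R K Γ : Type*} [CommRing R] [Field K]
    [LinearOrderedCommGroupWithZero Γ] (v : Valuation K Γ) (ψ : Polynomial R →+* K)
    (hC : ∀ a, v (ψ (Polynomial.C a)) ≤ 1) (hX : 1 ≤ v (ψ Polynomial.X)) (F : Polynomial R) :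
    v (ψ F) ≤ v (ψ Polynomial.X) ^ F.natDegree := by
  rw [F.as_sum_range_C_mul_X_pow, map_sum, ← F.as_sum_range_C_mul_X_pow]
  refine v.map_sum_le fun i hi => ?_
  rw [map_mul, map_mul, map_pow, map_pow]
  exact (mul_le_of_le_one_left' (hC _)).trans
    (pow_le_pow_right₀ hX (Nat.lt_succ_iff.mp (Finset.mem_range.mp hi)))

lemma valuation_polynomial_eq {R K Γ : Type*} [CommRing R] [Field K]
    [LinearOrderedCommGroupWithZero Γ] (v : Valuation K Γ) (ψ : Polynomial R →+* K)
    (hC : ∀ a, a ≠ 0 → v (ψ (Polynomial.C a)) = 1) (hX : 1 < v (ψ Polynomial.X))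
    {F : Polynomial R} (hF : F ≠ 0) :
    v (ψ F) = v (ψ Polynomial.X) ^ F.natDegree := by
  have hC' : ∀ a, v (ψ (Polynomial.C a)) ≤ 1 := fun a => by
    rcases eq_or_ne a 0 with rfl | ha
    · simp
    · exact (hC a ha).le
  have hlead : v (ψ (Polynomial.C F.leadingCoeff * Polynomial.X ^ F.natDegree)) =
      v (ψ Polynomial.X) ^ F.natDegree := by
    rw [map_mul, map_mul, hC _ (by simpa using hF), one_mul, map_pow, map_pow]
  have hlt : v (ψ F.eraseLead) < v (ψ Polynomial.X) ^ F.natDegree := by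
    rcases F.eraseLead_natDegree_lt_or_eraseLead_eq_zero with h | h
    · exact (valuation_polynomial_le v ψ hC' hX.le _).trans_lt (pow_lt_pow_right₀ hX h)
    · rw [h, map_zero, map_zero]
      exact pow_pos (zero_lt_one.trans hX) _
  rw [← hlead] at hlt
  have := v.map_add_eq_of_lt_left hlt
  rwa [← map_add, add_comm, F.eraseLead_add_C_mul_X_pow, hlead] at this

lemma eq_zero_of_coeff_eq_zero {E : Type*} [Field E] {d : ℕ} (hd : 4 ≤ d) (hd' : (d : E) ≠ 0)
    (m α β c : E)
    (h : ∀ i, 2 < i → (Polynomial.X ^ d + Polynomial.C m * Polynomial.X ^ 2 -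
      (Polynomial.C α * ((Polynomial.X + Polynomial.C c) ^ d * Polynomial.X) +
        Polynomial.C β * (Polynomial.X + Polynomial.C c) ^ d)).coeff i = 0) : c = 0 := by
  obtain ⟨n, rfl⟩ : ∃ n, d = n + 2 := ⟨d - 2, by lia⟩
  have h1 := h (n + 2 + 1) (by lia)
  have h2 := h (n + 1 + 1) (by lia)
  have h3 := h (n + 1) (by lia)
  simp only [Polynomial.coeff_sub, Polynomial.coeff_add, Polynomial.coeff_C_mul,
    Polynomial.coeff_mul_X, Polynomial.coeff_X_add_C_pow, Polynomial.coeff_X_pow] at h1 h2 h3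
  have hα : α = 0 := by simpa [show n + 2 + 1 ≠ 2 by lia] using h1
  subst hα
  have hβ : β = 1 := by
    have : (1 : E) - β = 0 := by simpa [show n ≠ 0 by lia] using h2
    exact (sub_eq_zero.mp this).symm
  subst hβ
  have hn : ((n + 2 : ℕ) : E) ≠ 0 := hd'
  have : (n + 2).choose (n + 1) = n + 2 := Nat.choose_succ_self_right (n + 1)
  rw [this] at h3
  simp only [show ¬ n + 1 = n + 2 by lia, show ¬ n + 1 = 2 by lia, show n + 2 - (n + 1) = 1 by lia,
    if_false] at h3
  simpa [-Nat.cast_add, -Nat.cast_ofNat, hn] using h3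

variable (r d μ) in
/-- The coordinate ring of the chart `x ≠ 0` of the hypersurface, as a subring of the function
field. -/
def chartRing : Subring (FnField k r) := ((polyToFn k r).comp (rescale d μ)).range

lemma X_mem_chartRing : (RatFunc.X : FnField k r) ∈ chartRing r d μ :=
  ⟨Polynomial.X, by simp [rescale_X, polyToFn_X]⟩

/-- A ring isomorphism matching the local rings at the vertex and the coordinate rings of the
charts maps `t` to a linear polynomial in `t`. -/
lemma exists_linear (hd : 4 ≤ d) (φ : FnField k r ≃+* FnField k r)
    (hO : ∀ x ∈ vertexSet r d (0 : k), φ x ∈ vertexSet r d μ)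
    (hB : ∀ x, x ∈ chartRing r d (0 : k) ↔ φ x ∈ chartRing r d μ) :
    ∃ a c : BaseField k r, a ≠ 0 ∧
      φ RatFunc.X = RatFunc.C a * (RatFunc.X + RatFunc.C c) := by
  have hC : ∀ p : MvPolynomial (Fin r) k, p ≠ 0 →
      infVal k r (φ (polyToFn k r (Polynomial.C p))) = 1 := by
    intro p hp
    have hmem := C_algebraMap_mem (μ := (0 : k)) hd p
    have hp' : algebraMap _ (BaseField k r) p ≠ 0 := by simpa using hp
    have h1 := infVal_le_one_of_mem hd (hO _ hmem)
    have h2 := infVal_le_one_of_mem hd (hO _ (inv_mem_vertexSet hd hmem (infVal_C hp')))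
    rw [polyToFn_C]
    refine le_antisymm h1 ?_
    rw [map_inv₀, map_inv₀] at h2
    refine (inv_le_one₀ ?_).mp h2
    rw [zero_lt_iff]
    simpa using hp
  have hX : 1 ≤ infVal k r (φ RatFunc.X) := by
    have h := infVal_le_one_of_mem hd (hO _ (one_div_yFn_mem (r := r) (d := d) (μ := 0)))
    have h0 : 0 < infVal k r (φ RatFunc.X) := by
      rw [zero_lt_iff]
      simp [RatFunc.X_ne_zero]
    simp only [yFn, map_zero, zero_mul, add_zero, one_div, map_inv₀, map_neg, map_pow,
      Valuation.map_neg] at h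
    rw [inv_le_one₀ (pow_pos h0 _)] at h
    exact (one_le_pow_iff_of_nonneg zero_le (by lia)).mp h
  let ψ : Polynomial (MvPolynomial (Fin r) k) →+* FnField k r :=
    (φ : FnField k r →+* FnField k r).comp (polyToFn k r)
  have hψX : ψ Polynomial.X = φ RatFunc.X := by simp [ψ, polyToFn_X]
  obtain ⟨G, hG⟩ := (hB (φ.symm RatFunc.X)).mpr (by simpa using X_mem_chartRing)
  have hF : ψ (rescale d 0 G) = RatFunc.X := by
    have := congrArg φ hG
    simpa [ψ] using this
  set F := rescale d 0 G
  have hvF : infVal k r (ψ F) = WithZero.exp 1 := by rw [hF, infVal_X]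
  have hv : infVal k r (φ RatFunc.X) = WithZero.exp 1 := by
    rcases hX.eq_or_lt with h | h
    · have h1 := valuation_polynomial_le (infVal k r) ψ (fun a => by
        rcases eq_or_ne a 0 with rfl | ha
        · simp
        · exact (hC a ha).le) (by rw [hψX]; exact hX) F
      rw [hvF, hψX, ← h, one_pow, ← WithZero.exp_zero, WithZero.exp_le_exp] at h1
      lia
    · have h1 := valuation_polynomial_eq (infVal k r) ψ hC (by rw [hψX]; exact h)
        (F := F) (by rintro h0; rw [h0] at hF; simp [RatFunc.X_ne_zero.symm] at hF)
      rw [hvF, hψX] at h1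
      obtain ⟨g, hg⟩ : ∃ g : ℤ, infVal k r (φ RatFunc.X) = WithZero.exp g :=
        ⟨_, (WithZero.exp_log (by simp [RatFunc.X_ne_zero])).symm⟩
      rw [hg] at h h1 ⊢
      rw [← WithZero.exp_nsmul, WithZero.exp_inj] at h1
      rw [← WithZero.exp_zero, WithZero.exp_lt_exp] at h
      have : g ∣ 1 := ⟨F.natDegree, by rw [h1]; simp [mul_comm]⟩
      rw [Int.eq_one_of_dvd_one h.le this]
  obtain ⟨P, hP⟩ := (hB RatFunc.X).mp X_mem_chartRing
  set Q : Polynomial (BaseField k r) := (rescale d μ P).map (algebraMap _ _) with hQ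
  have hPQ : φ RatFunc.X = algebraMap _ _ Q := by
    rw [← hP]
    simp [polyToFn, hQ]
  have hQ0 : Q ≠ 0 := by
    rintro h
    rw [h, map_zero] at hPQ
    simp [RatFunc.X_ne_zero] at hPQ
  rw [hPQ, infVal_algebraMap hQ0, WithZero.exp_inj] at hv
  have hdeg : Q.natDegree = 1 := by exact_mod_cast hv
  have ha : Q.coeff 1 ≠ 0 := by
    rw [← hdeg]
    simpa using hQ0
  refine ⟨Q.coeff 1, Q.coeff 0 / Q.coeff 1, ha, ?_⟩
  rw [hPQ]
  conv_lhs => rw [Polynomial.eq_X_add_C_of_natDegree_le_one hdeg.le]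
  have : RatFunc.C (Q.coeff 1) ≠ 0 := by simpa using ha
  simp only [map_add, map_mul, RatFunc.algebraMap_X, RatFunc.algebraMap_C, map_div₀]
  field_simp

lemma expansion_mul_eq {L : Type*} [Field L] {T x y a e₁ e₂ : L} (hx : x ≠ 0) (hy : y ≠ 0)
    (ha : a ≠ 0) (hT : T = a * x) (n : ℕ) :
    (T / -T ^ (n + 1) - 0 - (e₁ * (x / y) + e₂ * (1 / y))) * (T ^ (n + 1) / x * y) =
      -a * y - (e₁ * a ^ (n + 1) * x ^ (n + 1) + e₂ * a ^ (n + 1) * x ^ n) := by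
  subst hT
  field_simp
  ring

lemma linear_const_eq_zero (hd : 4 ≤ d) (hchar : (d : k) ≠ 0)
    (φ : FnField k r ≃+* FnField k r)
    (hO : ∀ x ∈ vertexSet r d (0 : k), φ x ∈ vertexSet r d μ) {a c : BaseField k r} (ha : a ≠ 0)
    (hT : φ RatFunc.X = RatFunc.C a * (RatFunc.X + RatFunc.C c)) : c = 0 := by
  have hy := yFn_ne_zero (r := r) d μ hd
  have hvy := infVal_yFn (r := r) μ hd
  have hY0 : φ (yFn d 0) = -(φ RatFunc.X) ^ d := by simp [yFn]
  have hvT : infVal k r (φ RatFunc.X) = WithZero.exp 1 := by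
    rw [hT, map_mul, infVal_C ha, one_mul,
      (infVal k r).map_add_eq_of_lt_left, infVal_X]
    rw [infVal_X]
    refine (infVal_C_le _).trans_lt ?_
    rw [← WithZero.exp_zero, WithZero.exp_lt_exp]
    lia
  have hT0 : φ RatFunc.X ≠ 0 := by simp [RatFunc.X_ne_zero]
  have hmem := hO _ (one_div_yFn_mem (r := r) (d := d) (μ := 0))
  rw [map_div₀, map_one, hY0] at hmem
  obtain ⟨e', e'', h⟩ := expands_zero_of_mem hd hmem (by
    rw [map_div₀, map_one, Valuation.map_neg, map_pow, hvT, ← WithZero.exp_nsmul, one_div,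
      ← WithZero.exp_neg, ← WithZero.exp_zero, WithZero.exp_lt_exp]
    simp
    lia)
  let Q : Polynomial (BaseField k r) := Polynomial.X ^ d +
    Polynomial.C (algebraMap (MvPolynomial (Fin r) k) _ (C μ)) * Polynomial.X ^ 2 -
    (Polynomial.C (e' * a ^ d) * ((Polynomial.X + Polynomial.C c) ^ d * Polynomial.X) +
      Polynomial.C (e'' * a ^ d) * (Polynomial.X + Polynomial.C c) ^ d)
  have hQ : infVal k r (algebraMap _ _ Q) ≤ WithZero.exp ((2 : ℕ) : ℤ) := by
    have key : algebraMap _ (FnField k r) Q = (1 / -(φ RatFunc.X) ^ d - RatFunc.C 0 -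
        (RatFunc.C e' * (RatFunc.X / yFn d μ) + RatFunc.C e'' * (1 / yFn d μ))) *
        (φ RatFunc.X ^ d * yFn d μ) := by
      have : algebraMap _ (FnField k r) Q = - yFn d μ -
          (RatFunc.C e' * RatFunc.X + RatFunc.C e'') * φ RatFunc.X ^ d := by
        rw [hT, mul_pow]
        simp [Q, yFn, constHom]
        ring
      rw [this]
      field_simp
      simp
    rw [key, map_mul, map_mul, map_pow, hvT, hvy]
    refine (mul_le_mul_left h _).trans ?_
    rw [← WithZero.exp_nsmul, ← WithZero.exp_add, ← WithZero.exp_add, ← WithZero.exp_add,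
      WithZero.exp_le_exp]
    simp
    lia
  refine eq_zero_of_coeff_eq_zero hd ?_ _ _ _ c fun i hi => coeff_eq_zero_of_infVal_le hQ hi
  have := (map_ne_zero_iff _ (IsFractionRing.injective (MvPolynomial (Fin r) k)
    (BaseField k r))).mpr ((map_ne_zero_iff _ (C_injective (Fin r) k)).mpr hchar)
  simpa using this

lemma coeff_two_eq {E : Type*} [Field E] {d : ℕ} (hd : 4 ≤ d) (a m α β : E) :
    (Polynomial.C a * (Polynomial.X ^ d + Polynomial.C m * Polynomial.X ^ 2) -
      (Polynomial.C α * Polynomial.X ^ d + Polynomial.C β * Polynomial.X ^ (d - 1))).coeff 2 =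
        a * m := by
  simp [Polynomial.coeff_X_pow, Polynomial.coeff_C_mul, show 2 ≠ d by lia, show 2 ≠ d - 1 by lia]

lemma false_of_map_X_eq_smul (hd : 4 ≤ d) (hμ : μ ≠ 0)
    (φ : FnField k r ≃+* FnField k r)
    (hO : ∀ x ∈ vertexSet r d (0 : k), φ x ∈ vertexSet r d μ) {a : BaseField k r} (ha : a ≠ 0)
    (hT : φ RatFunc.X = RatFunc.C a * RatFunc.X) : False := by
  have hCa : (RatFunc.C a : FnField k r) ≠ 0 := by simpa using ha
  have hy := yFn_ne_zero (r := r) d μ hd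
  have hvy := infVal_yFn (r := r) μ hd
  have hY0 : φ (yFn d 0) = -(φ RatFunc.X) ^ d := by simp [yFn]
  have hvT : infVal k r (φ RatFunc.X) = WithZero.exp 1 := by
    rw [hT, map_mul, infVal_C ha, one_mul, infVal_X]
  have hT0 : φ RatFunc.X ≠ 0 := by simp [RatFunc.X_ne_zero]
  have hmem := hO _ (X_div_yFn_mem (r := r) (d := d) (μ := 0))
  rw [map_div₀, hY0] at hmem
  obtain ⟨e', e'', h⟩ := expands_zero_of_mem hd hmem (by
    rw [map_div₀, Valuation.map_neg, map_pow, hvT, ← WithZero.exp_nsmul,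
      ← WithZero.exp_sub, ← WithZero.exp_zero, WithZero.exp_lt_exp]
    simp
    lia)
  let Q : Polynomial (BaseField k r) := Polynomial.C a * (Polynomial.X ^ d +
    Polynomial.C (algebraMap (MvPolynomial (Fin r) k) _ (C μ)) * Polynomial.X ^ 2) -
    (Polynomial.C (e' * a ^ d) * Polynomial.X ^ d +
      Polynomial.C (e'' * a ^ d) * Polynomial.X ^ (d - 1))
  have hQ : infVal k r (algebraMap _ _ Q) ≤ WithZero.exp ((1 : ℕ) : ℤ) := by
    have key : algebraMap _ (FnField k r) Q = (φ RatFunc.X / -(φ RatFunc.X) ^ d - RatFunc.C 0 -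
        (RatFunc.C e' * (RatFunc.X / yFn d μ) + RatFunc.C e'' * (1 / yFn d μ))) *
        (φ RatFunc.X ^ d / RatFunc.X * yFn d μ) := by
      obtain ⟨n, rfl⟩ : ∃ n, d = n + 1 := ⟨d - 1, by lia⟩
      rw [map_zero, expansion_mul_eq RatFunc.X_ne_zero hy hCa
        hT n]
      simp only [Q, yFn, constHom, map_sub, map_add, map_mul, map_pow, RatFunc.algebraMap_C,
        RatFunc.algebraMap_X, Nat.add_sub_cancel, RingHom.comp_apply]
      ring
    rw [key, map_mul, map_mul, map_div₀, map_pow, hvT, hvy, infVal_X]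
    refine (mul_le_mul_left h _).trans ?_
    rw [← WithZero.exp_nsmul, ← WithZero.exp_sub, ← WithZero.exp_add, ← WithZero.exp_add,
      ← WithZero.exp_add, WithZero.exp_le_exp]
    simp
    lia
  have h2 := coeff_eq_zero_of_infVal_le hQ (show 1 < 2 by lia)
  rw [coeff_two_eq hd, mul_eq_zero, or_iff_right ha] at h2
  exact hμ (C_injective (Fin r) k (IsFractionRing.injective _ (BaseField k r) (by simpa using h2)))

theorem not_exists_ringEquiv (hd : 4 ≤ d) (hchar : (d : k) ≠ 0) (hμ : μ ≠ 0)
    (φ : FnField k r ≃+* FnField k r)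
    (hO : ∀ x ∈ vertexSet r d (0 : k), φ x ∈ vertexSet r d μ)
    (hB : ∀ x, x ∈ chartRing r d (0 : k) ↔ φ x ∈ chartRing r d μ) : False := by
  obtain ⟨a, c, ha, hT⟩ := exists_linear hd φ hO hB
  obtain rfl := linear_const_eq_zero hd hchar φ hO ha hT
  exact false_of_map_X_eq_smul hd hμ φ hO ha (by rw [hT, map_zero, add_zero])

/-- The element `1 / t` is integral over the local ring at the vertex. -/
lemma isIntegralElem_inv_X {A : Type*} [CommRing A] (hd : 4 ≤ d) (j : A →+* FnField k r)
    (hj : Set.range j = vertexSet r d μ) : j.IsIntegralElem RatFunc.X⁻¹ := by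
  obtain ⟨a, ha⟩ : 1 / yFn d μ ∈ Set.range j := hj ▸ one_div_yFn_mem
  obtain ⟨b, hb⟩ : constHom k r μ ∈ Set.range j := hj ▸ constHom_mem μ
  refine ⟨Polynomial.X ^ d + (Polynomial.C (a * b) * Polynomial.X ^ (d - 2) + Polynomial.C a),
    ?_, ?_⟩
  · refine Polynomial.monic_X_pow_add ?_
    refine lt_of_le_of_lt (b := ((d - 2 : ℕ) : WithBot ℕ)) ?_ (by exact_mod_cast (by lia))
    refine Polynomial.degree_add_le_of_degree_le (Polynomial.degree_C_mul_X_pow_le _ _)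
      (Polynomial.degree_C_le.trans (by exact_mod_cast Nat.zero_le _))
  · have h0 := RatFunc.X_ne_zero (K := BaseField k r)
    have hy := yFn_ne_zero (r := r) d μ hd
    have hy' : yFn d μ = -(RatFunc.X ^ d + constHom k r μ * RatFunc.X ^ 2) := rfl
    obtain ⟨n, rfl⟩ : ∃ n, d = n + 2 := ⟨d - 2, by lia⟩
    simp only [Polynomial.eval₂_add, Polynomial.eval₂_mul, Polynomial.eval₂_C,
      Polynomial.eval₂_X_pow, map_mul, ha, hb, Nat.add_sub_cancel]
    generalize yFn (n + 2) μ = y at hy hy' ⊢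
    generalize constHom k r μ = m at hy' ⊢
    generalize (RatFunc.X : FnField k r) = x at h0 hy' ⊢
    simp only [inv_pow]
    field_simp
    rw [hy']
    ring

end Transfer

section ProjStalk

open AlgebraicGeometry.ProjectiveSpectrum HomogeneousLocalization

variable {A : Type} {σ : Type*} [CommRing A] [SetLike σ A] [AddSubgroupClass σ A]
  {𝒜 : ℕ → σ} [GradedRing 𝒜]

/-- The section of the structure sheaf given by a homogeneous fraction. -/
def fracSection {n : ℕ} (p q : 𝒜 n) : Γ(Proj 𝒜, Proj.basicOpen 𝒜 (q : A)) :=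
  (⟨fun y => mk ⟨n, p, q, y.2⟩, fun y =>
    ⟨ProjectiveSpectrum.basicOpen 𝒜 q, y.2,
      ⟨𝟙 _, ⟨n, ⟨p, q, _, fun _ => rfl⟩⟩⟩⟩⟩ : (Proj.structureSheaf 𝒜).1.obj
        (Opposite.op (ProjectiveSpectrum.basicOpen 𝒜 (q : A))))

lemma exists_eq_germ_fracSection (x : Proj 𝒜) (a : (Proj 𝒜).presheaf.stalk x) :
    ∃ (n : ℕ) (p q : 𝒜 n) (hq : x ∈ Proj.basicOpen 𝒜 (q : A)),
      a = (Proj 𝒜).presheaf.germ _ x hq (fracSection p q) := by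
  obtain ⟨c, hc⟩ := mk_surjective (Proj.stalkIso' 𝒜 x a)
  refine ⟨c.deg, c.num, c.den, c.den_mem, ?_⟩
  apply (Proj.stalkIso' 𝒜 x).injective
  rw [← hc]
  exact (Proj.stalkIso'_germ 𝒜 (ProjectiveSpectrum.basicOpen 𝒜 c.den) x c.den_mem
    (fracSection c.num c.den)).symm

variable [IsDomain A] {L : Type*} [Field L]

/-- Evaluation of homogeneous fractions with denominator outside a prime ideal at a ring
homomorphism to a field which does not kill the homogeneous elements outside the ideal. -/
def evalFrac (x : ProjectiveSpectrum 𝒜) (ψ : A →+* L)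
    (h : ∀ n, ∀ p ∈ 𝒜 n, p ∉ x.asHomogeneousIdeal → ψ p ≠ 0) :
    HomogeneousLocalization.AtPrime 𝒜 x.asHomogeneousIdeal.toIdeal →+* L where
  toFun z := Quotient.liftOn' z (fun c => ψ c.num / ψ c.den) (by
    intro a b hab
    have h1 := h _ _ a.den.2 a.den_mem
    have h2 := h _ _ b.den.2 b.den_mem
    change a.embedding = b.embedding at hab
    simp only [NumDenSameDeg.embedding, Localization.mk_eq_mk_iff, Localization.r_iff_exists] at hab
    obtain ⟨⟨c, hc⟩, hab⟩ := hab
    have hc0 : c ≠ 0 := by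
      rintro rfl
      exact hc (zero_mem _)
    have := mul_left_cancel₀ hc0 hab
    rw [div_eq_div_iff h1 h2, mul_comm, ← map_mul, this, map_mul, mul_comm])
  map_one' := by
    change ψ 1 / ψ 1 = 1
    simp
  map_zero' := by
    change ψ 0 / ψ 1 = 0
    simp
  map_mul' a b := by
    induction a using Quotient.inductionOn'
    induction b using Quotient.inductionOn'
    change ψ (_ * _) / ψ (_ * _) = _ / _ * (_ / _)
    rw [map_mul, map_mul, div_mul_div_comm]
  map_add' a b := by
    induction a using Quotient.inductionOn' with | h a
    induction b using Quotient.inductionOn' with | h b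
    have h1 := h _ _ a.den.2 a.den_mem
    have h2 := h _ _ b.den.2 b.den_mem
    change ψ ((a + b).num) / ψ ((a + b).den) = _ / _ + _ / _
    simp
    field_simp
    ring

/-- Evaluation of germs of functions at a ring homomorphism to a field. -/
def evalStalk (x : Proj 𝒜) (ψ : A →+* L)
    (h : ∀ n, ∀ p ∈ 𝒜 n, p ∉ (x : ProjectiveSpectrum 𝒜).asHomogeneousIdeal → ψ p ≠ 0) :
    (Proj 𝒜).presheaf.stalk x →+* L :=
  (evalFrac x ψ h).comp (Proj.stalkIso' 𝒜 x).toRingHom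

lemma evalStalk_germ_fracSection (x : Proj 𝒜) (ψ : A →+* L)
    (h : ∀ n, ∀ p ∈ 𝒜 n, p ∉ (x : ProjectiveSpectrum 𝒜).asHomogeneousIdeal → ψ p ≠ 0)
    {n : ℕ} (p q : 𝒜 n) (hq : x ∈ Proj.basicOpen 𝒜 (q : A)) :
    evalStalk x ψ h ((Proj 𝒜).presheaf.germ _ x hq (fracSection p q)) = ψ p / ψ q :=
  congrArg (evalFrac x ψ h) (Proj.stalkIso'_germ 𝒜 (ProjectiveSpectrum.basicOpen 𝒜 (q : A)) x hq
    (fracSection p q))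

lemma evalStalk_germ_awayToSection (x : Proj 𝒜) (ψ : A →+* L)
    (h : ∀ n, ∀ p ∈ 𝒜 n, p ∉ (x : ProjectiveSpectrum 𝒜).asHomogeneousIdeal → ψ p ≠ 0)
    {f : A} (hf : x ∈ Proj.basicOpen 𝒜 f) (c : NumDenSameDeg 𝒜 (Submonoid.powers f)) :
    evalStalk x ψ h ((Proj 𝒜).presheaf.germ _ x hf
      (AlgebraicGeometry.Proj.awayToSection 𝒜 f (mk c))) = ψ c.num / ψ c.den :=
  congrArg (evalFrac x ψ h) (Proj.stalkIso'_germ 𝒜 (ProjectiveSpectrum.basicOpen 𝒜 f) x hf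
    (ProjectiveSpectrum.Proj.awayToSection 𝒜 f (mk c)))

end ProjStalk

section Points

variable {k : Type} [Field k]

lemma le_of_forall_isHomogeneous {n : ℕ} {I J : HomogeneousIdeal (grading k n)}
    (h : ∀ m (p : MvPolynomial (Fin (n + 1)) k), p.IsHomogeneous m → p ∈ I → p ∈ J) : I ≤ J := by
  classical
  intro p hp
  rw [← DirectSum.sum_support_decompose (grading k n) p]
  exact sum_mem fun m _ => h m _ (DirectSum.decompose (grading k n) p m).2 (I.isHomogeneous m hp)

/-- The point of projective space with coordinates given by a ring homomorphism to a domain. -/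
def pointOf {n : ℕ} {R : Type*} [CommRing R] [IsDomain R] (ψ : MvPolynomial (Fin (n + 1)) k →+* R)
    (i : Fin (n + 1)) (hi : ψ (X i) ≠ 0) : ProjSpace k n :=
  (⟨(RingHom.ker ψ).homogeneousCore (grading k n),
    (RingHom.ker_isPrime ψ).homogeneousCore, fun h => hi <|
      Ideal.toIdeal_homogeneousCore_le (grading k n) (RingHom.ker ψ) <| h <|
        HomogeneousIdeal.mem_irrelevant_of_mem (grading k n) one_pos (isHomogeneous_X k i)⟩ :
    ProjectiveSpectrum (grading k n))

lemma mem_pointOf {n : ℕ} {R : Type*} [CommRing R] [IsDomain R]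
    {ψ : MvPolynomial (Fin (n + 1)) k →+* R} {i : Fin (n + 1)} {hi : ψ (X i) ≠ 0}
    {p : MvPolynomial (Fin (n + 1)) k} {m : ℕ} (hp : p.IsHomogeneous m) :
    p ∈ (pointOf ψ i hi : ProjectiveSpectrum (grading k n)).asHomogeneousIdeal ↔ ψ p = 0 :=
  ⟨fun h => Ideal.toIdeal_homogeneousCore_le (grading k n) (RingHom.ker ψ) h,
    fun h => Ideal.mem_homogeneousCore_of_homogeneous_of_mem ⟨m, hp⟩ h⟩

lemma specializes_iff_le {n : ℕ} {x y : ProjSpace k n} : x ⤳ y ↔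
    (x : ProjectiveSpectrum (grading k n)).asHomogeneousIdeal ≤
      (y : ProjectiveSpectrum (grading k n)).asHomogeneousIdeal := by
  rw [specializes_iff_mem_closure]
  exact (ProjectiveSpectrum.le_iff_mem_closure (𝒜 := grading k n) x y).symm

lemma pointOf_specializes {n : ℕ} {R : Type*} [CommRing R] [IsDomain R]
    {ψ : MvPolynomial (Fin (n + 1)) k →+* R} {i : Fin (n + 1)} {hi : ψ (X i) ≠ 0}
    {y : ProjSpace k n}
    (h : ∀ m (p : MvPolynomial (Fin (n + 1)) k), p.IsHomogeneous m → ψ p = 0 →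
      p ∈ (y : ProjectiveSpectrum (grading k n)).asHomogeneousIdeal) : pointOf ψ i hi ⤳ y :=
  specializes_iff_le.mpr (le_of_forall_isHomogeneous fun m p hp hpψ =>
    h m p hp ((mem_pointOf hp).mp hpψ))

variable {r : ℕ} (d : ℕ) (μ : k)

variable (r) in
/-- The equation `x ^ (d - 1) y + z ^ d + μ x ^ (d - 2) z ^ 2`. -/
def coneEq : MvPolynomial (Fin (r + 2 + 1)) k :=
  X 0 ^ (d - 1) * X 1 + X 2 ^ d + C μ * X 0 ^ (d - 2) * X 2 ^ 2

variable {d}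

lemma isHomogeneous_coneEq (hd : 4 ≤ d) : (coneEq r d μ).IsHomogeneous d := by
  refine IsHomogeneous.add (IsHomogeneous.add ?_ ?_) ?_
  · convert ((isHomogeneous_X k (0 : Fin (r + 2 + 1))).pow (d - 1)).mul
      (isHomogeneous_X k 1) using 1
    lia
  · simpa using (isHomogeneous_X k (2 : Fin (r + 2 + 1))).pow d
  · convert ((isHomogeneous_C _ μ).mul ((isHomogeneous_X k (0 : Fin (r + 2 + 1))).pow (d - 2))).mul
      ((isHomogeneous_X k 2).pow 2) using 1
    lia

lemma evalGen_coneEq : evalGen d μ (coneEq r d μ) = 0 := by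
  rw [evalGen_eq]
  simp [coneEq, yFn]

lemma substZero_coneEq (hd : 4 ≤ d) : substZero (coneEq r d μ) = 0 := by
  simp [coneEq, substZero, show d - 1 ≠ 0 by lia, show d ≠ 0 by lia]

lemma evalGen_X_zero : evalGen d μ (X 0 : MvPolynomial (Fin (r + 2 + 1)) k) ≠ 0 := by
  simp [evalGen_eq]

variable (d) in
/-- The generic point of the hypersurface. -/
def genPoint : ProjSpace k (r + 2) := pointOf (evalGen d μ) 0 (evalGen_X_zero μ)

variable (k r) in
/-- The generic point of the linear subspace `x = z = 0`. -/
def vertexPoint : ProjSpace k (r + 2) := pointOf substZero 1 (by simp [substZero])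

lemma mem_genPoint {p : MvPolynomial (Fin (r + 2 + 1)) k} {m : ℕ} (hp : p.IsHomogeneous m) :
    p ∈ (genPoint d μ : ProjectiveSpectrum (grading k (r + 2))).asHomogeneousIdeal ↔
      evalGen d μ p = 0 := mem_pointOf hp

lemma mem_vertexPoint {p : MvPolynomial (Fin (r + 2 + 1)) k} {m : ℕ} (hp : p.IsHomogeneous m) :
    p ∈ (vertexPoint k r : ProjectiveSpectrum (grading k (r + 2))).asHomogeneousIdeal ↔
      substZero p = 0 := mem_pointOf hp

lemma genPoint_mem (hd : 4 ≤ d) : genPoint d μ ∈ zeroLocusSet k (r + 2) (coneEq r d μ) :=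
  (mem_genPoint μ (isHomogeneous_coneEq μ hd)).mpr (evalGen_coneEq μ)

lemma vertexPoint_mem (hd : 4 ≤ d) : vertexPoint k r ∈ zeroLocusSet k (r + 2) (coneEq r d μ) :=
  (mem_vertexPoint (isHomogeneous_coneEq μ hd)).mpr (substZero_coneEq μ hd)

variable {μ}

lemma X_two_mem (hd : 4 ≤ d) {y : ProjSpace k (r + 2)}
    (hy : y ∈ zeroLocusSet k (r + 2) (coneEq r d μ))
    (h0 : X 0 ∈ (y : ProjectiveSpectrum (grading k (r + 2))).asHomogeneousIdeal) :
    X 2 ∈ (y : ProjectiveSpectrum (grading k (r + 2))).asHomogeneousIdeal := by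
  let Q := (y : ProjectiveSpectrum (grading k (r + 2))).asHomogeneousIdeal.toIdeal
  have hQ : Q.IsPrime := (y : ProjectiveSpectrum (grading k (r + 2))).isPrime
  change coneEq r d μ ∈ Q at hy
  change X 0 ∈ Q at h0
  change X 2 ∈ Q
  refine hQ.mem_of_pow_mem d ?_
  rw [coneEq, Q.add_mem_iff_left, Q.add_mem_iff_right] at hy
  · exact hy
  · exact Q.mul_mem_right _ (Q.pow_mem_of_mem h0 _ (by lia))
  · exact Q.mul_mem_right _ (Q.mul_mem_left _ (Q.pow_mem_of_mem h0 _ (by lia)))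

/-- A polynomial vanishing on the subspace `x = z = 0` vanishes at every point of it. -/
lemma mem_of_substZero {Q : Ideal (MvPolynomial (Fin (r + 2 + 1)) k)} (h0 : X 0 ∈ Q)
    (h2 : X 2 ∈ Q) {p : MvPolynomial (Fin (r + 2 + 1)) k} (hp : substZero p = 0) : p ∈ Q := by
  have e : (Ideal.Quotient.mk Q).comp substZero = Ideal.Quotient.mk Q := by
    refine ringHom_ext (fun a => ?_) (forall_coord ?_ ?_ ?_ fun i => ?_)
    · simp [substZero]
    · simp [substZero, Ideal.Quotient.eq_zero_iff_mem.mpr h0]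
    · simp [substZero]
    · simp [substZero, Ideal.Quotient.eq_zero_iff_mem.mpr h2]
    · simp [substZero]
  rw [← Ideal.Quotient.eq_zero_iff_mem, ← e, RingHom.comp_apply, hp, map_zero]

lemma vertexPoint_specializes (hd : 4 ≤ d) {y : ProjSpace k (r + 2)}
    (hy : y ∈ zeroLocusSet k (r + 2) (coneEq r d μ)) : vertexPoint k r ⤳ y ↔
    X 0 ∈ (y : ProjectiveSpectrum (grading k (r + 2))).asHomogeneousIdeal := by
  refine ⟨fun h => specializes_iff_le.mp h ?_, fun h => ?_⟩
  · exact (mem_vertexPoint (isHomogeneous_X k _)).mpr (by simp [substZero])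
  · exact pointOf_specializes fun m p _ hp => mem_of_substZero h (X_two_mem hd hy h) hp

lemma eq_zero_of_dehom {L : Type*} [Field L] (π : MvPolynomial (Fin (r + 2 + 1)) k →+* L)
    (hd : 4 ≤ d) (h0 : π (X 0) ≠ 0) (hF : π (coneEq r d μ) = 0)
    {p : MvPolynomial (Fin (r + 2 + 1)) k} {m : ℕ} (hp : p.IsHomogeneous m)
    (h : dehom d μ p = 0) : π p = 0 := by
  let τ : Polynomial (MvPolynomial (Fin r) k) →+* L := Polynomial.eval₂RingHom
    (eval₂Hom (π.comp C) fun i => π (X i.succ.succ.succ) / π (X 0)) (π (X 2) / π (X 0))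
  have hy : τ (yPoly d μ) = π (X 1) / π (X 0) := by
    obtain ⟨n, rfl⟩ : ∃ n, d = n + 2 := ⟨d - 2, by lia⟩
    simp only [coneEq, map_add, map_mul, map_pow, Nat.add_sub_cancel,
      show n + 2 - 1 = n + 1 by lia] at hF
    simp only [yPoly, map_neg, map_add, map_mul, map_pow, τ, Polynomial.coe_eval₂RingHom,
      Polynomial.eval₂_X, Polynomial.eval₂_C, coe_eval₂Hom, eval₂_C, RingHom.comp_apply,
      div_pow]
    field_simp
    linear_combination -(π (X 0)) ^ 2 * hF
  have e1 : τ.comp (dehom d μ) = eval₂Hom (π.comp C) (fun i => π (X i) / π (X 0)) := by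
    refine ringHom_ext (fun a => ?_) (forall_coord ?_ ?_ ?_ fun i => ?_)
    · simp [τ, dehom]
    · simp [dehom, h0]
    · simpa [dehom] using hy
    · simp [τ, dehom]
    · simp [τ, dehom]
  have e2 : π = eval₂Hom (π.comp C) (fun i => π (X 0) * (π (X i) / π (X 0))) := by
    refine ringHom_ext (fun a => ?_) fun i => ?_ <;> simp [mul_div_cancel₀, h0]
  have e1' := RingHom.congr_fun e1 p
  rw [RingHom.comp_apply, h, map_zero, coe_eval₂Hom] at e1'
  rw [e2, coe_eval₂Hom, eval₂_smul_of_isHomogeneous hp, ← e1', mul_zero]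

lemma genPoint_specializes (hd : 4 ≤ d) {y : ProjSpace k (r + 2)}
    (hy : y ∈ zeroLocusSet k (r + 2) (coneEq r d μ)) : genPoint d μ ⤳ y := by
  refine pointOf_specializes fun m p hp hp0 => ?_
  let Q := (y : ProjectiveSpectrum (grading k (r + 2))).asHomogeneousIdeal.toIdeal
  have hQ : Q.IsPrime := (y : ProjectiveSpectrum (grading k (r + 2))).isPrime
  by_cases h : X 0 ∈ Q
  · exact mem_of_substZero h (X_two_mem hd hy h)
      (substZero_eq_zero_of_leadHom hp (leadHom_eq_zero_of_evalGen hd hp hp0))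
  · let j := algebraMap (MvPolynomial (Fin (r + 2 + 1)) k ⧸ Q)
      (FractionRing (MvPolynomial (Fin (r + 2 + 1)) k ⧸ Q))
    have hj : Function.Injective j := IsFractionRing.injective _ _
    have key : ∀ q, j.comp (Ideal.Quotient.mk Q) q = 0 ↔ q ∈ Q := fun q => by
      rw [RingHom.comp_apply, map_eq_zero_iff j hj, Ideal.Quotient.eq_zero_iff_mem]
    exact (key p).mp (eq_zero_of_dehom _ hd (mt (key _).mp h) ((key _).mpr hy) hp
      (rescale_injective d μ hd (polyToFn_injective k r (by simpa [evalGen] using hp0))))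

end Points

lemma exists_ringEquiv_of_surjective {R K₁ K₂ : Type*} [CommRing R] [IsLocalRing R] [Field K₁]
    [Field K₂] (α : R →+* K₁) (β : R →+* K₂) (hα : Function.Surjective α)
    (hβ : Function.Surjective β) : ∃ θ : K₁ ≃+* K₂, ∀ a, θ (α a) = β a := by
  have e : RingHom.ker α = RingHom.ker β :=
    (IsLocalRing.eq_maximalIdeal (RingHom.ker_isMaximal_of_surjective α hα)).trans
      (IsLocalRing.eq_maximalIdeal (RingHom.ker_isMaximal_of_surjective β hβ)).symm
  refine ⟨(RingHom.quotientKerEquivOfSurjective hα).symm.trans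
    ((Ideal.quotEquivOfEq e).trans (RingHom.quotientKerEquivOfSurjective hβ)), fun a => ?_⟩
  have : (RingHom.quotientKerEquivOfSurjective hα).symm (α a) = Ideal.Quotient.mk _ a := by
    rw [RingEquiv.symm_apply_eq]
    rfl
  rw [RingEquiv.trans_apply, this]
  rfl

section Chart

variable {k : Type} [Field k] {r d : ℕ} {μ : k}

lemma exists_dehom_eq (a : Polynomial (MvPolynomial (Fin r) k)) :
    ∃ (n : ℕ) (p : MvPolynomial (Fin (r + 2 + 1)) k), p.IsHomogeneous n ∧ dehom d μ p = a := by
  have hX : dehom d μ (X 0 : MvPolynomial (Fin (r + 2 + 1)) k) = 1 := by simp [dehom]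
  have hadd : ∀ {a b : Polynomial (MvPolynomial (Fin r) k)},
      (∃ (n : ℕ) (p : MvPolynomial (Fin (r + 2 + 1)) k), p.IsHomogeneous n ∧ dehom d μ p = a) →
      (∃ (n : ℕ) (p : MvPolynomial (Fin (r + 2 + 1)) k), p.IsHomogeneous n ∧ dehom d μ p = b) →
      ∃ (n : ℕ) (p : MvPolynomial (Fin (r + 2 + 1)) k),
        p.IsHomogeneous n ∧ dehom d μ p = a + b := by
    rintro _ _ ⟨n, p, hp, rfl⟩ ⟨m, q, hq, rfl⟩
    refine ⟨n + m, p * X 0 ^ m + X 0 ^ n * q, ?_, by simp [hX]⟩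
    have h := fun j => isHomogeneous_X_pow (R := k) (0 : Fin (r + 2 + 1)) j
    exact (hp.mul (h m)).add ((h n).mul hq)
  have hmul : ∀ {a b : Polynomial (MvPolynomial (Fin r) k)},
      (∃ (n : ℕ) (p : MvPolynomial (Fin (r + 2 + 1)) k), p.IsHomogeneous n ∧ dehom d μ p = a) →
      (∃ (n : ℕ) (p : MvPolynomial (Fin (r + 2 + 1)) k), p.IsHomogeneous n ∧ dehom d μ p = b) →
      ∃ (n : ℕ) (p : MvPolynomial (Fin (r + 2 + 1)) k),
        p.IsHomogeneous n ∧ dehom d μ p = a * b := by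
    rintro _ _ ⟨n, p, hp, rfl⟩ ⟨m, q, hq, rfl⟩
    exact ⟨n + m, p * q, hp.mul hq, map_mul _ _ _⟩
  induction a using Polynomial.induction_on' with
  | add a b ha hb => exact hadd ha hb
  | monomial n c =>
    rw [← Polynomial.C_mul_X_pow_eq_monomial]
    refine hmul ?_ ⟨n, X 2 ^ n, isHomogeneous_X_pow _ _, by simp [dehom]⟩
    induction c using MvPolynomial.induction_on with
    | C c => exact ⟨0, C c, isHomogeneous_C _ c, by simp [dehom]⟩
    | add p q hp hq => rw [map_add]; exact hadd hp hq
    | mul_X p i hp =>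
      rw [map_mul]
      exact hmul hp ⟨1, X i.succ.succ.succ, isHomogeneous_X k _, by simp [dehom]⟩

lemma evalGen_mem_chartRing (p : MvPolynomial (Fin (r + 2 + 1)) k) :
    evalGen d μ p ∈ chartRing r d μ := ⟨dehom d μ p, rfl⟩

lemma mem_chartRing {x : FnField k r} : x ∈ chartRing r d μ ↔
    ∃ (n : ℕ) (p : MvPolynomial (Fin (r + 2 + 1)) k), p.IsHomogeneous n ∧ x = evalGen d μ p := by
  constructor
  · rintro ⟨a, rfl⟩
    obtain ⟨n, p, hp, rfl⟩ := exists_dehom_eq (d := d) (μ := μ) a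
    exact ⟨n, p, hp, rfl⟩
  · rintro ⟨n, p, -, rfl⟩
    exact evalGen_mem_chartRing p

lemma closure_chartRing (hd : 4 ≤ d) :
    Subfield.closure (chartRing r d μ : Set (FnField k r)) = ⊤ := by
  set S := Subfield.closure (chartRing r d μ : Set (FnField k r)) with hS
  have hev : ∀ p, evalGen d μ p ∈ S := fun p => Subfield.subset_closure (evalGen_mem_chartRing p)
  have hC : ∀ p : MvPolynomial (Fin r) k, RatFunc.C (algebraMap _ (BaseField k r) p) ∈ S := by
    intro p
    induction p using MvPolynomial.induction_on with
    | C c => simpa [evalGen_eq, constHom] using hev (C c)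
    | add p q hp hq => simpa using add_mem hp hq
    | mul_X p i hp =>
      rw [map_mul, map_mul]
      refine mul_mem hp ?_
      have h := div_mem (hev (X i.succ.succ.succ)) (hev (X 1))
      rw [evalGen_eq, evalGen_eq, eval₂_X, eval₂_X, coords_succ, coords_one,
        mul_div_cancel_left₀ _ (yFn_ne_zero _ μ hd)] at h
      exact h
  have hB : ∀ e : BaseField k r, RatFunc.C e ∈ S := by
    intro e
    obtain ⟨a, b, -, rfl⟩ := IsFractionRing.div_surjective (A := MvPolynomial (Fin r) k) e
    rw [map_div₀]
    exact div_mem (hC a) (hC b)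
  have hP : ∀ p : Polynomial (BaseField k r), algebraMap _ (FnField k r) p ∈ S := by
    intro p
    induction p using Polynomial.induction_on' with
    | add p q hp hq => rw [map_add]; exact add_mem hp hq
    | monomial n e =>
      rw [← Polynomial.C_mul_X_pow_eq_monomial, map_mul, map_pow, RatFunc.algebraMap_C,
        RatFunc.algebraMap_X]
      exact mul_mem (hB e) (pow_mem (by simpa [evalGen_eq] using hev (X 2)) n)
  rw [eq_top_iff]
  intro x _
  rw [← RatFunc.num_div_denom x]
  exact div_mem (hP _) (hP _)

lemma exists_eq_div (hd : 4 ≤ d) (x : FnField k r) :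
    ∃ (n : ℕ) (p q : MvPolynomial (Fin (r + 2 + 1)) k), p.IsHomogeneous n ∧ q.IsHomogeneous n ∧
      evalGen d μ q ≠ 0 ∧ x = evalGen d μ p / evalGen d μ q := by
  have hx : x ∈ Subfield.closure (chartRing r d μ : Set (FnField k r)) := by
    rw [closure_chartRing hd]; trivial
  have hX : evalGen d μ (X 0 : MvPolynomial (Fin (r + 2 + 1)) k) = 1 := by simp [evalGen_eq]
  obtain ⟨y, hy, z, hz, rfl⟩ := Subfield.mem_closure_iff.mp hx
  rw [Subring.closure_eq] at hy hz
  obtain ⟨n, p, hp, rfl⟩ := mem_chartRing.mp hy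
  obtain ⟨m, q, hq, rfl⟩ := mem_chartRing.mp hz
  by_cases h : evalGen d μ q = 0
  · exact ⟨0, 0, 1, isHomogeneous_zero _ _ _, isHomogeneous_one _ _, by simp, by simp [h]⟩
  · have hh := fun j => isHomogeneous_X_pow (R := k) (0 : Fin (r + 2 + 1)) j
    exact ⟨n + m, p * X 0 ^ m, X 0 ^ n * q, hp.mul (hh m), (hh n).mul hq,
      by simpa [hX] using h, by simp [hX]⟩

lemma isIntegrallyClosed_chartRing (hd : 4 ≤ d) : IsIntegrallyClosed (chartRing r d μ) := by
  let f := (polyToFn k r).comp (rescale d μ)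
  have hf : Function.Injective f := (polyToFn_injective k r).comp (rescale_injective d μ hd)
  exact IsIntegrallyClosed.of_equiv (RingEquiv.ofBijective f.rangeRestrict
    ⟨fun a b h => hf (congrArg Subtype.val h), f.rangeRestrict_surjective⟩)

end Chart

section Scheme

variable {k : Type} [Field k] {r d : ℕ} {μ : k} {H : Scheme} {ι : H ⟶ ProjSpace k (r + 2)}

lemma specializes_iff_of_isClosedImmersion {X Y : Scheme} (f : X ⟶ Y) [IsClosedImmersion f]
    {x y : X} : f x ⤳ f y ↔ x ⤳ y :=
  f.isClosedEmbedding.isInducing.specializes_iff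

lemma mem_zeroLocusSet (hι : IsHypersurface (coneEq r d μ) H ι) (y : H) :
    ι y ∈ zeroLocusSet k (r + 2) (coneEq r d μ) := by
  rw [← hι.range_eq]
  exact Set.mem_range_self y

lemma exists_map_eq_genPoint (hd : 4 ≤ d) (hι : IsHypersurface (coneEq r d μ) H ι) :
    ∃ ξ : H, ι ξ = genPoint d μ ∧ ∀ y, ξ ⤳ y := by
  have := hι.isClosedImmersion
  have h := genPoint_mem (r := r) μ hd
  rw [← hι.range_eq] at h
  obtain ⟨ξ, hξ⟩ := h
  refine ⟨ξ, hξ, fun y => (specializes_iff_of_isClosedImmersion ι).mp ?_⟩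
  exact hξ ▸ genPoint_specializes hd (mem_zeroLocusSet hι y)

lemma exists_map_eq_vertexPoint (hd : 4 ≤ d) (hι : IsHypersurface (coneEq r d μ) H ι) :
    ∃ v : H, ι v = vertexPoint k r ∧
      ∀ y, v ⤳ y ↔ y ∉ ι ⁻¹ᵁ Proj.basicOpen (grading k (r + 2)) (X 0) := by
  have := hι.isClosedImmersion
  have h := vertexPoint_mem (r := r) μ hd
  rw [← hι.range_eq] at h
  obtain ⟨v, hv⟩ := h
  refine ⟨v, hv, fun y => (specializes_iff_of_isClosedImmersion ι).symm.trans ?_⟩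
  refine Iff.trans ?_ ((vertexPoint_specializes hd (mem_zeroLocusSet hι y)).trans ?_)
  · exact iff_of_eq (congrArg (· ⤳ ι y) hv)
  · exact not_not.symm

lemma isIntegral_of_isHypersurface (hd : 4 ≤ d) (hι : IsHypersurface (coneEq r d μ) H ι) :
    AlgebraicGeometry.IsIntegral H := by
  obtain ⟨ξ, -, hξ⟩ := exists_map_eq_genPoint hd hι
  have := hι.reduced
  have : IrreducibleSpace H :=
    { toNonempty := ⟨ξ⟩
      isPreirreducible_univ := by
        have h : closure {ξ} = Set.univ := Set.eq_univ_of_forall fun y => (hξ y).mem_closure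
        rw [← h]
        exact isIrreducible_singleton.closure.isPreirreducible }
  exact isIntegral_of_irreducibleSpace_of_isReduced H

variable [AlgebraicGeometry.IsIntegral H]

lemma map_genericPoint (hd : 4 ≤ d) (hι : IsHypersurface (coneEq r d μ) H ι) :
    ι (genericPoint H) = genPoint d μ := by
  obtain ⟨ξ, hξ, hξ'⟩ := exists_map_eq_genPoint hd hι
  have : genericPoint H = ξ := (genericPoint_spec H).eq
    (Set.eq_univ_of_forall fun y => (hξ' y).mem_closure)
  rw [this, hξ]

lemma exists_functionField_equiv (hd : 4 ≤ d) (hι : IsHypersurface (coneEq r d μ) H ι) :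
    ∃ (h : ∀ n, ∀ p ∈ grading k (r + 2) n,
        p ∉ (ι (genericPoint H) : ProjectiveSpectrum (grading k (r + 2))).asHomogeneousIdeal →
          evalGen d μ p ≠ 0)
      (θ : H.functionField ≃+* FnField k r),
        ∀ a, θ (ι.stalkMap (genericPoint H) a) =
          evalStalk (ι (genericPoint H)) (evalGen d μ) h a := by
  have := hι.isClosedImmersion
  have hg : ∀ {n : ℕ} {p : MvPolynomial (Fin (r + 2 + 1)) k}, p.IsHomogeneous n → (p ∈
      (ι (genericPoint H) : ProjectiveSpectrum (grading k (r + 2))).asHomogeneousIdeal ↔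
        evalGen d μ p = 0) := fun hp => by
    rw [map_genericPoint hd hι]
    exact mem_genPoint μ hp
  have h : ∀ n, ∀ p ∈ grading k (r + 2) n,
      p ∉ (ι (genericPoint H) : ProjectiveSpectrum (grading k (r + 2))).asHomogeneousIdeal →
        evalGen d μ p ≠ 0 := fun n p hp => mt (hg hp).mpr
  refine ⟨h, exists_ringEquiv_of_surjective (ι.stalkMap (genericPoint H)).hom
    (evalStalk (ι (genericPoint H)) (evalGen d μ) h) (ι.stalkMap_surjective _) fun x => ?_⟩
  obtain ⟨n, p, q, hp, hq, hq0, rfl⟩ := exists_eq_div (μ := μ) hd x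
  exact ⟨_, evalStalk_germ_fracSection (ι (genericPoint H)) (evalGen d μ) h ⟨p, hp⟩ ⟨q, hq⟩
    (mt (hg hq).mp hq0)⟩

lemma exists_affineOpen_and_equiv (hd : 4 ≤ d) (hι : IsHypersurface (coneEq r d μ) H ι) :
    ∃ (v : H) (U : H.Opens) (_ : Nonempty U) (θ : H.functionField ≃+* FnField k r),
      IsAffineOpen U ∧ (∀ y, v ⤳ y ↔ y ∉ U) ∧
      (∀ x, x ∈ vertexSet r d μ ↔
        ∃ a, x = θ (algebraMap (H.presheaf.stalk v) H.functionField a)) ∧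
      ∀ x, x ∈ chartRing r d μ ↔ ∃ a, x = θ (H.germToFunctionField U a) := by
  have := hι.isClosedImmersion
  have hX0 : (X 0 : MvPolynomial (Fin (r + 2 + 1)) k) ∈ grading k (r + 2) 1 := isHomogeneous_X k 0
  have haff := Proj.isAffineOpen_basicOpen (grading k (r + 2)) (X 0) hX0 one_pos
  obtain ⟨v, hv, hv'⟩ := exists_map_eq_vertexPoint hd hι
  obtain ⟨h, θ, hθ⟩ := exists_functionField_equiv hd hι
  have hξ : genericPoint H ∈ ι ⁻¹ᵁ Proj.basicOpen (grading k (r + 2)) (X 0) := by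
    change ι (genericPoint H) ∈ Proj.basicOpen (grading k (r + 2)) (X 0)
    rw [map_genericPoint hd hι]
    exact mt (mem_genPoint μ hX0).mp (evalGen_X_zero μ)
  have hspec : genericPoint H ⤳ v := (genericPoint_spec H).specializes trivial
  have hV : ∀ (n : ℕ) (p q : grading k (r + 2) n)
      (hq : ι v ∈ Proj.basicOpen (grading k (r + 2)) (q : MvPolynomial (Fin (r + 2 + 1)) k)),
      θ (algebraMap (H.presheaf.stalk v) H.functionField
        (ι.stalkMap v ((ProjSpace k (r + 2)).presheaf.germ _ _ hq (fracSection p q)))) =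
        evalGen d μ p / evalGen d μ q := by
    intro n p q hq
    rw [RingHom.algebraMap_toAlgebra]
    have e := Scheme.Hom.stalkSpecializes_stalkMap_apply ι (genericPoint H) v hspec
      ((ProjSpace k (r + 2)).presheaf.germ _ _ hq (fracSection p q))
    refine (congrArg θ e.symm).trans ?_
    rw [hθ, ← CommRingCat.comp_apply, TopCat.Presheaf.germ_stalkSpecializes]
    exact evalStalk_germ_fracSection ..
  have : Nonempty (ι ⁻¹ᵁ Proj.basicOpen (grading k (r + 2)) (X 0)) := ⟨⟨_, hξ⟩⟩
  have hU : ∀ c : HomogeneousLocalization.NumDenSameDeg (grading k (r + 2))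
      (Submonoid.powers (X 0)), θ (H.germToFunctionField (ι ⁻¹ᵁ Proj.basicOpen _ (X 0))
        (ι.app _ (AlgebraicGeometry.Proj.awayToSection _ (X 0)
          (HomogeneousLocalization.mk c)))) = evalGen d μ c.num := by
    intro c
    have hden : evalGen d μ (c.den : MvPolynomial (Fin (r + 2 + 1)) k) = 1 := by
      obtain ⟨j, hj⟩ := c.den_mem
      rw [← hj]
      simp [evalGen_eq]
    have e := Scheme.Hom.germ_stalkMap_apply ι _ (genericPoint H) hξ
      (AlgebraicGeometry.Proj.awayToSection _ (X 0) (HomogeneousLocalization.mk c))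
    refine (congrArg θ e.symm).trans ((hθ _).trans ?_)
    refine (evalStalk_germ_awayToSection _ _ h hξ c).trans ?_
    rw [hden, div_one]
  refine ⟨v, ι ⁻¹ᵁ Proj.basicOpen (grading k (r + 2)) (X 0), this, θ, haff.preimage ι, hv',
    fun x => ⟨?_, ?_⟩, fun x => ⟨?_, ?_⟩⟩
  · rintro ⟨n, p, q, hp, hq, hq0, rfl⟩
    exact ⟨_, (hV n ⟨p, hp⟩ ⟨q, hq⟩ (by
      rw [hv]
      exact mt (mem_vertexPoint hq).mp hq0)).symm⟩
  · rintro ⟨a, rfl⟩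
    obtain ⟨b, rfl⟩ := ι.stalkMap_surjective v a
    obtain ⟨n, p, q, hq, rfl⟩ := exists_eq_germ_fracSection (ι v) b
    refine ⟨n, p, q, p.2, q.2, fun h0 => ?_, hV n p q hq⟩
    rw [hv] at hq
    exact hq ((mem_vertexPoint q.2).mpr h0)
  · intro hx
    obtain ⟨n, p, hp, rfl⟩ := mem_chartRing.mp hx
    exact ⟨_, (hU ⟨n, ⟨p, hp⟩, ⟨X 0 ^ n, isHomogeneous_X_pow _ _⟩, n, rfl⟩).symm⟩
  · rintro ⟨a, rfl⟩
    obtain ⟨b, rfl⟩ := ι.app_surjective _ haff a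
    obtain ⟨c, rfl⟩ := (ConcreteCategory.bijective_of_isIso
      (Proj.basicOpenIsoAway (grading k (r + 2)) (X 0) hX0 one_pos).hom).2 b
    obtain ⟨c, rfl⟩ := HomogeneousLocalization.mk_surjective c
    rw [Proj.basicOpenIsoAway_hom, hU]
    exact evalGen_mem_chartRing _

lemma isIntegrallyClosed_stalk {U : H.Opens} [Nonempty U] (hU : IsAffineOpen U)
    {θ : H.functionField ≃+* FnField k r} (hd : 4 ≤ d)
    (hθ : ∀ x, x ∈ chartRing r d μ ↔ ∃ a, x = θ (H.germToFunctionField U a)) {x : H} (hx : x ∈ U) :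
    IsIntegrallyClosed (H.presheaf.stalk x) := by
  let f : Γ(H, U) →+* FnField k r := θ.toRingHom.comp (H.germToFunctionField U).hom
  have hf : Function.Injective f := θ.injective.comp (H.germToFunctionField_injective U)
  have e : f.range = chartRing r d μ := by
    ext x
    exact ⟨fun ⟨a, ha⟩ => (hθ x).mpr ⟨a, ha.symm⟩, fun h => ((hθ x).mp h).imp fun _ => Eq.symm⟩
  have : IsIntegrallyClosed f.range := e ▸ isIntegrallyClosed_chartRing hd
  have : IsIntegrallyClosed Γ(H, U) := IsIntegrallyClosed.of_equiv
    (RingEquiv.ofBijective f.rangeRestrict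
      ⟨fun a b h => hf (congrArg Subtype.val h), f.rangeRestrict_surjective⟩).symm
  have := hU.isLocalization_stalk ⟨x, hx⟩
  let _ : Algebra Γ(H, U) (H.presheaf.stalk x) :=
    TopCat.Presheaf.algebra_section_stalk H.presheaf (⟨x, hx⟩ : U)
  exact isIntegrallyClosed_of_isLocalization (R := Γ(H, U)) _
    (hU.primeIdealOf ⟨x, hx⟩).asIdeal.primeCompl (Ideal.primeCompl_le_nonZeroDivisors _)

lemma not_isIntegrallyClosed_stalk (hd : 4 ≤ d) {v : H} {θ : H.functionField ≃+* FnField k r}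
    (hθ : ∀ x, x ∈ vertexSet r d μ ↔
      ∃ a, x = θ (algebraMap (H.presheaf.stalk v) H.functionField a)) :
    ¬ IsIntegrallyClosed (H.presheaf.stalk v) := by
  intro hv
  let j : H.presheaf.stalk v →+* FnField k r :=
    θ.toRingHom.comp (algebraMap (H.presheaf.stalk v) H.functionField)
  have hj : Set.range j = vertexSet r d μ := by
    ext x
    exact ⟨fun ⟨a, ha⟩ => (hθ x).mpr ⟨a, ha.symm⟩, fun h => ((hθ x).mp h).imp fun _ => Eq.symm⟩
  have h1 := (isIntegralElem_inv_X hd j hj)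
  have h2 : _root_.IsIntegral (H.presheaf.stalk v) (θ.symm RatFunc.X⁻¹) := by
    obtain ⟨p, hp, hp0⟩ := h1
    refine ⟨p, hp, θ.injective ?_⟩
    rw [map_zero, ← hp0, ← RingEquiv.coe_toRingHom, Polynomial.hom_eval₂]
    simp [j]
  obtain ⟨y, hy⟩ := IsIntegrallyClosed.isIntegral_iff.mp h2
  exact inv_X_notMem hd ((hθ _).mpr ⟨y, by rw [hy, θ.apply_symm_apply]⟩)

theorem false_of_isHypersurface (hd : 4 ≤ d) (hchar : (d : k) ≠ 0) (hμ : μ ≠ 0)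
    {ι' : H ⟶ ProjSpace k (r + 2)} (hι : IsHypersurface (coneEq r d 0) H ι)
    (hι' : IsHypersurface (coneEq r d μ) H ι') : False := by
  obtain ⟨v, U, _, θ, hU, hvU, hvθ, hUθ⟩ := exists_affineOpen_and_equiv hd hι
  obtain ⟨v', U', _, θ', hU', hvU', hvθ', hUθ'⟩ := exists_affineOpen_and_equiv hd hι'
  have h1 : v ⤳ v' := (hvU v').mpr fun h =>
    not_isIntegrallyClosed_stalk hd hvθ' (isIntegrallyClosed_stalk hU hd hUθ h)
  have h2 : v' ⤳ v := (hvU' v).mpr fun h =>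
    not_isIntegrallyClosed_stalk hd hvθ (isIntegrallyClosed_stalk hU' hd hUθ' h)
  obtain rfl : v = v' := (h1.antisymm h2).eq
  obtain rfl : U = U' := by
    ext y
    exact not_iff_not.mp ((hvU y).symm.trans (hvU' y))
  refine not_exists_ringEquiv hd hchar hμ (θ.symm.trans θ') (fun x hx => ?_) fun x => ?_
  · obtain ⟨a, rfl⟩ := (hvθ x).mp hx
    exact (hvθ' _).mpr ⟨a, by simp⟩
  · rw [hUθ, hUθ']
    simp only [RingEquiv.trans_apply, θ'.injective.eq_iff, θ.symm_apply_eq]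

end Scheme

lemma isHypersurface_comp {k : Type} [Field k] {n : ℕ} {f : MvPolynomial (Fin (n + 1)) k}
    {H H' : Scheme} {ι : H ⟶ ProjSpace k n} (h : IsHypersurface f H ι) (e : H' ≅ H) :
    IsHypersurface f H' (e.hom ≫ ι) := by
  have := h.isClosedImmersion
  have := h.reduced
  refine ⟨inferInstance, isReduced_of_isOpenImmersion e.hom, ?_⟩
  rw [← h.range_eq]
  exact e.hom.surjective.range_comp ι

end ConeHypersurface

/-- **Proposition 3.9.**  Let `d ≥ 4` not be a multiple of `char k`, let `μ ∈ k*` and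
let `f = x^{d-1} y + z^d`, `g = x^{d-1} y + z^d + μ x^{d-2} z^2` in `k[x, y, z]`
(`x = x_0`, `y = x_1`, `z = x_2`).  Then for each `r ≥ 0` the hypersurfaces
`V(f), V(g) ⊆ ℙ^{r+2}` are not isomorphic (as varieties over `k`). -/
theorem stmt12 (k : Type) [Field k] (d : ℕ) (hd : 4 ≤ d)
    (hchar : ¬ (ringChar k ∣ d)) (μ : k) (hμ : μ ≠ 0) (r : ℕ)
    (H H' : Scheme) (ι : H ⟶ ProjSpace k (r + 2)) (ι' : H' ⟶ ProjSpace k (r + 2))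
    (hH : IsHypersurface (X 0 ^ (d - 1) * X 1 + X 2 ^ d) H ι)
    (hH' : IsHypersurface
      (X 0 ^ (d - 1) * X 1 + X 2 ^ d + C μ * X 0 ^ (d - 2) * X 2 ^ 2) H' ι') :
    ¬ IsoOver (ι ≫ projStruct k (r + 2)) (ι' ≫ projStruct k (r + 2)) := by
  rintro ⟨e, -⟩
  have h : IsHypersurface (ConeHypersurface.coneEq r d 0) H ι := by
    simpa [ConeHypersurface.coneEq] using hH
  have := ConeHypersurface.isIntegral_of_isHypersurface hd h
  exact ConeHypersurface.false_of_isHypersurface hd (fun h0 => hchar ((ringChar.spec k d).mp h0)) hμ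
    h (ConeHypersurface.isHypersurface_comp hH' e)

end
end

section
/- Let k be a field, let d ≥ 3 be an integer, let μ ∈ k^*, and let f = x_0^{d−1} y + z^d and g = x_0^{d−1} y + z^d + μ x_0^{d−2} x_1^2 in k[x_0, x_1, y, z]. Then for each r ≥ 0, the hypersurfaces V(f) and V(g) in P^{r+3} are not isomorphic as varieties. -/
/-!
Common set-up: projective `n`-space over a field `k` as the scheme
`Proj k[x_0, …, x_n]`, complements of hypersurfaces as open subschemes,
hypersurfaces as reduced closed subschemes, and isomorphisms of varieties
over `k` as scheme isomorphisms commuting with the structure morphisms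
to `Spec k`.
-/

open AlgebraicGeometry CategoryTheory MvPolynomial

attribute [local instance] MvPolynomial.gradedAlgebra

noncomputable section

open HomogeneousLocalization

theorem eval₂_mul_of_isHomogeneous {σ R A : Type*} [CommSemiring R] [CommSemiring A]
    {p : MvPolynomial σ R} {m : ℕ} (hp : p.IsHomogeneous m) (f : R →+* A) (u : A) (y : σ → A) :
    eval₂ f (fun i ↦ u * y i) p = u ^ m * eval₂ f y p := by
  rw [eval₂_eq, eval₂_eq, Finset.mul_sum]
  refine Finset.sum_congr rfl fun c hc ↦ ?_
  have hm : ∑ i ∈ c.support, c i = m := by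
    exact (hp.degree_eq_sum_deg_support hc).symm
  simp_rw [mul_pow]
  rw [Finset.prod_mul_distrib, Finset.prod_pow_eq_pow_sum, hm]
  ring

variable {k : Type} [Field k] {n : ℕ}

theorem X_mem_grading (j : Fin (n + 1)) : (X j : MvPolynomial (Fin (n + 1)) k) ∈ grading k n 1 :=
  isHomogeneous_X k j

/-- Evaluation of degree zero fractions in `D₊(x_j)` at a tuple `a` normalized by `a j = 1`. -/
def chartEval {A : Type} [CommRing A] [Algebra k A] (j : Fin (n + 1)) (a : Fin (n + 1) → A)
    (h : a j = 1) : Away (grading k n) (X j) →+* A :=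
  (Localization.awayLift (aeval a : MvPolynomial (Fin (n + 1)) k →ₐ[k] A).toRingHom (X j)
    (by simp [h])).comp
    (algebraMap (Away (grading k n) (X j)) (Localization.Away (X j)))

theorem chartEval_mk {A : Type} [CommRing A] [Algebra k A] (j : Fin (n + 1)) (a : Fin (n + 1) → A)
    (h : a j = 1) (N : ℕ) (p : MvPolynomial (Fin (n + 1)) k) (hp : p ∈ grading k n (N • 1)) :
    chartEval j a h (Away.mk _ (X_mem_grading j) N p hp) = aeval a p := by
  simp only [chartEval, RingHom.comp_apply, HomogeneousLocalization.algebraMap_apply, Away.val_mk]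
  erw [Localization.awayLift_mk (v := 1)]
  · simp
  · simp [h]

/-- The point of projective space with coordinates `a`, in the chart `D₊(x_j)`. -/
def chartPoint {A : Type} [CommRing A] [Algebra k A] (j : Fin (n + 1)) (a : Fin (n + 1) → A)
    (h : a j = 1) : Spec (.of A) ⟶ ProjSpace k n :=
  Spec.map (CommRingCat.ofHom (chartEval j a h)) ≫
    Proj.awayι (grading k n) (X j) (X_mem_grading j) one_pos

theorem awayι_projStruct (j : Fin (n + 1)) :
    Proj.awayι (grading k n) (X j) (X_mem_grading j) one_pos ≫ projStruct k n =
      Spec.map (CommRingCat.ofHom ((fromZeroRingHom (grading k n) _).comp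
        (algebraMap k (grading k n 0)))) := by
  rw [projStruct, Proj.awayι_toSpecZero_assoc, ← Spec.map_comp, ← CommRingCat.ofHom_comp]

theorem chartEval_comp_fromZero {A : Type} [CommRing A] [Algebra k A] (j : Fin (n + 1))
    (a : Fin (n + 1) → A) (h : a j = 1) :
    (chartEval j a h).comp ((fromZeroRingHom (grading k n) _).comp
        (algebraMap k (grading k n 0))) = algebraMap k A := by
  ext c
  have := chartEval_mk (k := k) j a h 0 (C c) (by simp)
  rw [aeval_C] at this
  rw [← this]
  rfl

theorem chartPoint_projStruct {A : Type} [CommRing A] [Algebra k A] (j : Fin (n + 1))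
    (a : Fin (n + 1) → A) (h : a j = 1) :
    chartPoint j a h ≫ projStruct k n = Spec.map (CommRingCat.ofHom (algebraMap k A)) := by
  rw [chartPoint, Category.assoc, awayι_projStruct, ← Spec.map_comp, ← CommRingCat.ofHom_comp,
    chartEval_comp_fromZero]

/-- The coordinate `x_i / x_j` on `D₊(x_j)`. -/
def coordFrac (k : Type) [Field k] {n : ℕ} (j i : Fin (n + 1)) : Away (grading k n) (X j) :=
  Away.mk _ (X_mem_grading j) 1 (X i) (X_mem_grading i)

theorem eval₂_coordFrac (j : Fin (n + 1)) (N : ℕ) (p : MvPolynomial (Fin (n + 1)) k)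
    (hp : p ∈ grading k n (N • 1)) :
    eval₂ ((fromZeroRingHom (grading k n) (.powers (X j))).comp
        (algebraMap k (grading k n 0))) (coordFrac k j) p =
      Away.mk _ (X_mem_grading j) N p hp := by
  apply HomogeneousLocalization.val_injective
  have hf : (algebraMap (Away (grading k n) (X j))
        (Localization.Away (X j : MvPolynomial (Fin (n + 1)) k))).comp
      ((fromZeroRingHom (grading k n) (.powers (X j))).comp (algebraMap k (grading k n 0))) =
      (algebraMap (MvPolynomial (Fin (n + 1)) k) (Localization.Away (X j))).comp C := by
    ext c
    rfl
  have hc : (fun i : Fin (n + 1) ↦ algebraMap (Away (grading k n) (X j)) (Localization.Away (X j))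
      (coordFrac k j i)) = fun i ↦
      Localization.mk 1 (⟨X j, Submonoid.mem_powers _⟩ :
        Submonoid.powers (X j : MvPolynomial (Fin (n + 1)) k)) *
        algebraMap (MvPolynomial (Fin (n + 1)) k) (Localization.Away (X j)) (X i) := by
    ext i
    simp [coordFrac, ← Localization.mk_one_eq_algebraMap, Localization.mk_mul]
  change algebraMap (Away (grading k n) (X j))
    (Localization.Away (X j : MvPolynomial (Fin (n + 1)) k)) _ = _
  rw [hom_eval₂, hf]
  have hp' : p.IsHomogeneous N := by simpa using hp
  refine (congr_arg (fun y ↦ eval₂ _ y p) hc).trans ?_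
  rw [eval₂_mul_of_isHomogeneous hp', ← hom_eval₂, ← Localization.mk_one_eq_algebraMap,
    Localization.mk_pow, Localization.mk_mul, Away.val_mk]
  simp [eval₂_eta]

theorem exists_chartEval_eq {A : Type} [CommRing A] [Algebra k A] (j : Fin (n + 1))
    (φ : Away (grading k n) (X j) →+* A)
    (hφ : φ.comp ((fromZeroRingHom (grading k n) _).comp
        (algebraMap k (grading k n 0))) = algebraMap k A) :
    ∃ a h, φ = chartEval j a h := by
  refine ⟨fun i ↦ φ (coordFrac k j i), ?_, ?_⟩
  · rw [← φ.map_one]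
    refine congr_arg φ (HomogeneousLocalization.val_injective _ ?_)
    simp [coordFrac]
  · ext z
    obtain ⟨N, p, hp, rfl⟩ := Away.mk_surjective (grading k n) (X_mem_grading j) z
    rw [chartEval_mk, ← eval₂_coordFrac, hom_eval₂, hφ]
    rfl

theorem exists_eq_chartPoint {A : Type} [CommRing A] [Algebra k A] (j : Fin (n + 1))
    (q : Spec (.of A) ⟶ ProjSpace k n)
    (hq : q ≫ projStruct k n = Spec.map (CommRingCat.ofHom (algebraMap k A)))
    (hj : ∀ x, q x ∈ Proj.basicOpen (grading k n) (X j)) :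
    ∃ a h, q = chartPoint j a h := by
  have hr : Set.range q ⊆
      Set.range (Proj.awayι (grading k n) (X j) (X_mem_grading j) one_pos) := by
    rintro _ ⟨x, rfl⟩
    have := hj x
    rwa [← Proj.opensRange_awayι _ _ (X_mem_grading j) one_pos] at this
  let l := IsOpenImmersion.lift (Proj.awayι (grading k n) (X j) (X_mem_grading j) one_pos) q hr
  have hl : l ≫ Proj.awayι (grading k n) (X j) (X_mem_grading j) one_pos = q :=
    IsOpenImmersion.lift_fac _ _ _
  obtain ⟨φ, hφ⟩ := Spec.map_surjective l
  obtain ⟨a, h, ha⟩ := exists_chartEval_eq j φ.hom (by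
    rw [← hl, Category.assoc, awayι_projStruct, ← hφ, ← Spec.map_comp] at hq
    exact congr_arg CommRingCat.Hom.hom (Spec.map_injective hq))
  refine ⟨a, h, ?_⟩
  rw [chartPoint, ← hl, ← ha, ← hφ]
  rfl

theorem exists_mem_basicOpen_X (x : ProjSpace k n) :
    ∃ j, x ∈ Proj.basicOpen (grading k n) (X j) := by
  have := Proj.iSup_basicOpen_eq_top (grading k n) (fun j : Fin (n + 1) ↦ X j) (by
    intro p hp
    rw [HomogeneousIdeal.mem_iff, HomogeneousIdeal.mem_irrelevant_iff, GradedRing.proj_apply] at hp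
    have h0 : homogeneousComponent 0 p = 0 := (decomposition.decompose'_apply p 0).symm.trans hp
    have := (mem_pow_idealOfVars_iff' 1 p).mpr fun c hc ↦ by
      rw [homogeneousComponent_zero, C_eq_zero] at h0
      rwa [(Finsupp.degree_eq_zero_iff c).mp (by lia)]
    simpa using this)
  have hx : x ∈ (⊤ : (ProjSpace k n).Opens) := trivial
  rw [← this] at hx
  simpa using hx

theorem chartPoint_injective {A : Type} [CommRing A] [Algebra k A] (j : Fin (n + 1))
    {a b : Fin (n + 1) → A} {ha : a j = 1} {hb : b j = 1}
    (h : chartPoint (k := k) j a ha = chartPoint j b hb) : a = b := by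
  rw [chartPoint, chartPoint, cancel_mono] at h
  have h' := congr_arg CommRingCat.Hom.hom (Spec.map_injective h)
  ext i
  have := DFunLike.congr_fun h' (coordFrac k j i)
  simpa [coordFrac, chartEval_mk] using this

theorem chartPoint_mem_basicOpen {A : Type} [CommRing A] [Algebra k A] (j : Fin (n + 1))
    (a : Fin (n + 1) → A) (h : a j = 1) (x) :
    chartPoint (k := k) j a h x ∈ Proj.basicOpen (grading k n) (X j) := by
  rw [← Proj.opensRange_awayι _ _ (X_mem_grading j) one_pos, chartPoint]
  exact ⟨_, rfl⟩

theorem SpecMap_chartPoint {A B : Type} [CommRing A] [Algebra k A] [CommRing B] [Algebra k B]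
    (φ : A →ₐ[k] B) (j : Fin (n + 1)) (a : Fin (n + 1) → A) (h : a j = 1) :
    Spec.map (CommRingCat.ofHom φ.toRingHom) ≫ chartPoint (k := k) j a h =
      chartPoint j (φ ∘ a) (by simp [h]) := by
  rw [chartPoint, chartPoint, ← Category.assoc, ← Spec.map_comp, ← CommRingCat.ofHom_comp]
  congr 3
  ext z
  obtain ⟨N, p, hp, rfl⟩ := Away.mk_surjective (grading k n) (X_mem_grading j) z
  simp only [RingHom.comp_apply, chartEval_mk]
  simp [Function.comp_def, aeval_def, eval₂_comp_left]

theorem exists_comp_eq_SpecMap_iff {X : Scheme.{0}} {R A : CommRingCat.{0}} (I : Ideal R)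
    (e : X ≅ Spec (.of (R ⧸ I))) (φ : R ⟶ A) :
    (∃ l : Spec A ⟶ X, l ≫ e.hom ≫ Spec.map (CommRingCat.ofHom (Ideal.Quotient.mk I)) =
      Spec.map φ) ↔ I ≤ RingHom.ker φ.hom := by
  constructor
  · rintro ⟨l, hl⟩
    obtain ⟨ψ, hψ⟩ := Spec.map_surjective (l ≫ e.hom)
    rw [← Category.assoc, ← hψ, ← Spec.map_comp] at hl
    intro x hx
    rw [RingHom.mem_ker, ← Spec.map_injective hl]
    simp [Ideal.Quotient.eq_zero_iff_mem.mpr hx]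
  · intro h
    refine ⟨Spec.map (CommRingCat.ofHom (Ideal.Quotient.lift I φ.hom fun x hx ↦ h hx)) ≫ e.inv, ?_⟩
    rw [Category.assoc, e.inv_hom_id_assoc, ← Spec.map_comp]
    congr 1

theorem radical_eq_of_isReduced_of_range_eq {X : Scheme.{0}} [IsReduced X] {R : CommRingCat.{0}}
    (I : Ideal R) (e : X ≅ Spec (.of (R ⧸ I))) (F : R)
    (hr : Set.range (e.hom ≫ Spec.map (CommRingCat.ofHom (Ideal.Quotient.mk I))) =
      (PrimeSpectrum.basicOpen F : Set (PrimeSpectrum R))ᶜ) :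
    I = (Ideal.span {F}).radical := by
  have : IsReduced (Spec (.of (R ⧸ I))) := isReduced_of_isOpenImmersion e.inv
  have hred : _root_.IsReduced (R ⧸ I) := by
    rwa [affine_isReduced_iff] at this
  have hI : I.radical = I := ((Ideal.isRadical_iff_quotient_reduced I).mpr hred).radical
  rw [← hI, ← PrimeSpectrum.vanishingIdeal_zeroLocus_eq_radical,
    ← PrimeSpectrum.vanishingIdeal_zeroLocus_eq_radical, PrimeSpectrum.zeroLocus_span]
  congr 1
  have hs : Function.Surjective e.hom := e.hom.homeomorph.surjective
  have hc : Set.range (e.hom ≫ Spec.map (CommRingCat.ofHom (Ideal.Quotient.mk I))) =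
      Set.range (Spec.map (CommRingCat.ofHom (Ideal.Quotient.mk I))) := by
    refine Eq.trans ?_ (hs.range_comp _)
    congr 1
  rw [hc, PrimeSpectrum.basicOpen_eq_zeroLocus_compl, compl_compl] at hr
  rw [← hr]
  have := range_comap_of_surjective _ (Ideal.Quotient.mk I)
    Ideal.Quotient.mk_surjective
  rw [Ideal.mk_ker] at this
  exact this.symm

open Limits in
theorem IsHypersurface.exists_lift_iff {F : MvPolynomial (Fin (n + 1)) k} {H : Scheme}
    {ι : H ⟶ ProjSpace k n} (hH : IsHypersurface F H ι) {d : ℕ} (hF : F.IsHomogeneous d)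
    (hd : 0 < d) (j : Fin (n + 1)) {A : Type} [CommRing A] (φ : Away (grading k n) (X j) →+* A) :
    (∃ q : Spec (.of A) ⟶ H, q ≫ ι = Spec.map (CommRingCat.ofHom φ) ≫
      Proj.awayι (grading k n) (X j) (X_mem_grading j) one_pos) ↔
    (Ideal.span {Away.isLocalizationElem (X_mem_grading (k := k) j) hF}).radical ≤
      RingHom.ker φ := by
  have := hH.isClosedImmersion
  have := hH.reduced
  let i := Proj.awayι (grading k n) (X j) (X_mem_grading j) one_pos
  obtain ⟨I, e, he⟩ := (IsClosedImmersion.Spec_iff (f := pullback.snd ι i)).mp inferInstance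
  have : IsReduced (pullback ι i) := isReduced_of_isOpenImmersion (pullback.fst ι i)
  have hI := radical_eq_of_isReduced_of_range_eq I e
    (Away.isLocalizationElem (X_mem_grading (k := k) j) hF) (by
      rw [← he, Scheme.Pullback.range_snd]
      have hp := congr_arg (fun U : (Spec (.of (Away (grading k n) (X j)))).Opens ↦
        (U : Set (Spec (.of (Away (grading k n) (X j)))))ᶜ)
        (Proj.awayι_preimage_basicOpen (grading k n) (X_mem_grading j) one_pos hF hd)
      refine Eq.trans ?_ hp
      have hr : Set.range ι = (Proj.basicOpen (grading k n) F : Set (ProjSpace k n))ᶜ := by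
        refine hH.range_eq.trans ?_
        ext x
        simp [zeroLocusSet, Proj.mem_basicOpen]
      rw [hr]
      rfl)
  have h := exists_comp_eq_SpecMap_iff I e (CommRingCat.ofHom φ)
  rw [← hI]
  refine Iff.trans ?_ h
  rw [← he]
  constructor
  · rintro ⟨q, hq⟩
    exact ⟨pullback.lift q _ hq, pullback.lift_snd _ _ _⟩
  · rintro ⟨l, hl⟩
    exact ⟨l ≫ pullback.fst ι i, by rw [Category.assoc, pullback.condition, reassoc_of% hl]⟩

theorem isLocalizationElem_X_eq {F : MvPolynomial (Fin (n + 1)) k} {d : ℕ}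
    (hF : F ∈ grading k n d) (j : Fin (n + 1)) :
    Away.isLocalizationElem (X_mem_grading (k := k) j) hF =
      Away.mk _ (X_mem_grading j) d F (by simpa using hF) := by
  apply HomogeneousLocalization.val_injective
  simp [Away.isLocalizationElem]

theorem IsHypersurface.exists_lift_chartPoint_iff {F : MvPolynomial (Fin (n + 1)) k} {H : Scheme}
    {ι : H ⟶ ProjSpace k n} (hH : IsHypersurface F H ι) {d : ℕ} (hF : F.IsHomogeneous d)
    (hd : 0 < d) (hprime : Prime F) (j : Fin (n + 1)) (hj : ¬ F ∣ X j)
    {A : Type} [CommRing A] [Algebra k A] (a : Fin (n + 1) → A) (h : a j = 1) :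
    (∃ q : Spec (.of A) ⟶ H, q ≫ ι = chartPoint j a h) ↔ aeval a F = 0 := by
  rw [chartPoint, hH.exists_lift_iff hF hd, isLocalizationElem_X_eq hF]
  constructor
  · intro hle
    have := hle (Ideal.le_radical (Ideal.mem_span_singleton_self _))
    rwa [RingHom.mem_ker, chartEval_mk] at this
  · rintro ha y ⟨m, hm⟩
    obtain ⟨N, p, hp, rfl⟩ := Away.mk_surjective (grading k n) (X_mem_grading j) y
    rw [RingHom.mem_ker, chartEval_mk]
    obtain ⟨z, hz⟩ := Ideal.mem_span_singleton.mp hm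
    obtain ⟨M, q, hq, rfl⟩ := Away.mk_surjective (grading k n) (X_mem_grading j) z
    have hz' := congr_arg HomogeneousLocalization.val hz
    rw [val_pow, val_mul, Away.val_mk, Away.val_mk, Away.val_mk, Localization.mk_mul,
      Localization.mk_pow, Localization.mk_eq_mk_iff, Localization.r_iff_exists] at hz'
    obtain ⟨⟨_, s, rfl⟩, hs⟩ := hz'
    have hdvd : F ∣ X j ^ s * (X j ^ d * X j ^ M * p ^ m) := by
      refine ⟨X j ^ s * ((X j ^ N) ^ m * q), ?_⟩
      simp only [Submonoid.coe_mul, SubmonoidClass.mk_pow] at hs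
      linear_combination hs
    have hXs (t : ℕ) : ¬ F ∣ X j ^ t := fun h ↦ hj (hprime.dvd_of_dvd_pow h)
    obtain ⟨r, rfl⟩ : F ∣ p := by
      have := (hprime.dvd_or_dvd hdvd).resolve_left (hXs _)
      rw [← pow_add] at this
      exact hprime.dvd_of_dvd_pow ((hprime.dvd_or_dvd this).resolve_left (hXs _))
    rw [map_mul, ha, zero_mul]

section Truncation

variable {σ R : Type*} [CommRing R]

theorem mem_idealOfVars_iff {p : MvPolynomial σ R} :
    p ∈ idealOfVars σ R ↔ constantCoeff p = 0 := by
  rw [← pow_one (idealOfVars σ R), mem_pow_idealOfVars_iff', constantCoeff_eq]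
  refine ⟨fun h ↦ h 0 (by simp), fun h x hx ↦ ?_⟩
  rwa [(Finsupp.degree_eq_zero_iff x).mp (by lia)]

theorem constantCoeff_aeval {a : σ → MvPolynomial σ R} (ha : ∀ i, constantCoeff (a i) = 0)
    (p : MvPolynomial σ R) : constantCoeff (aeval a p) = constantCoeff p := by
  have : (constantCoeff (σ := σ) (R := R)).comp (aeval a).toRingHom = constantCoeff := by
    ext i <;> simp [ha]
  exact DFunLike.congr_fun this p

theorem aeval_mem_pow_idealOfVars {a : σ → MvPolynomial σ R}
    (ha : ∀ i, constantCoeff (a i) = 0) {e : ℕ} {p : MvPolynomial σ R}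
    (hp : p ∈ idealOfVars σ R ^ e) : aeval a p ∈ idealOfVars σ R ^ e := by
  have hle : (idealOfVars σ R).map (aeval a) ≤ idealOfVars σ R := by
    rw [Ideal.map_le_iff_le_comap]
    intro q hq
    rw [Ideal.mem_comap, mem_idealOfVars_iff, constantCoeff_aeval ha]
    exact mem_idealOfVars_iff.mp hq
  have := Ideal.mem_map_of_mem (aeval a) hp
  rw [Ideal.map_pow] at this
  exact Ideal.pow_right_mono hle e this

theorem aeval_sub_aeval_mem {a A : σ → MvPolynomial σ R} (ha : ∀ i, constantCoeff (a i) = 0)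
    (hA : ∀ i, constantCoeff (A i) = 0) (haA : ∀ i, a i - A i ∈ idealOfVars σ R ^ 2) {e : ℕ}
    {p : MvPolynomial σ R} (hp : p ∈ idealOfVars σ R ^ e) :
    aeval a p - aeval A p ∈ idealOfVars σ R ^ (e + 1) := by
  have h0 (q : MvPolynomial σ R) : aeval a q - aeval A q ∈ idealOfVars σ R := by
    rw [mem_idealOfVars_iff, map_sub, constantCoeff_aeval ha, constantCoeff_aeval hA, sub_self]
  have h1 {q : MvPolynomial σ R} (hq : q ∈ idealOfVars σ R) :
      aeval a q - aeval A q ∈ idealOfVars σ R ^ 2 := by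
    induction hq using Submodule.span_induction with
    | mem x hx =>
      obtain ⟨i, rfl⟩ := hx
      simpa using haA i
    | zero => simp
    | add x y _ _ hx hy =>
      rw [map_add, map_add, add_sub_add_comm]
      exact add_mem hx hy
    | smul r x hx ihx =>
      have : aeval a (r • x) - aeval A (r • x) =
          aeval a r * (aeval a x - aeval A x) + (aeval a r - aeval A r) * aeval A x := by
        simp only [smul_eq_mul, map_mul]
        ring
      rw [this, pow_two]
      refine add_mem (Ideal.mul_mem_left _ _ (pow_two (idealOfVars σ R) ▸ ihx)) ?_
      refine Ideal.mul_mem_mul (h0 r) ?_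
      rw [mem_idealOfVars_iff, constantCoeff_aeval hA]
      exact mem_idealOfVars_iff.mp hx
  induction e generalizing p with
  | zero => simpa using h0 p
  | succ e ih =>
    rw [pow_succ] at hp
    induction hp using Submodule.mul_induction_on' with
    | mem_mul_mem x hx y hy =>
      have : aeval a (x * y) - aeval A (x * y) =
          aeval a x * (aeval a y - aeval A y) + (aeval a x - aeval A x) * aeval A y := by
        simp only [map_mul]
        ring
      rw [this]
      refine add_mem ?_ ?_
      · rw [add_assoc, pow_add]
        exact Ideal.mul_mem_mul (aeval_mem_pow_idealOfVars ha hx) (h1 hy)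
      · rw [pow_succ]
        refine Ideal.mul_mem_mul (ih hx) ?_
        rw [mem_idealOfVars_iff, constantCoeff_aeval hA]
        exact mem_idealOfVars_iff.mp hy
    | add x _ y _ hx hy =>
      rw [map_add, map_add, add_sub_add_comm]
      exact add_mem hx hy

theorem _root_.MvPolynomial.IsHomogeneous.mem_pow_idealOfVars {p : MvPolynomial σ R} {d : ℕ}
    (hp : p.IsHomogeneous d) : p ∈ idealOfVars σ R ^ d := by
  rw [mem_pow_idealOfVars_iff]
  intro x hx
  exact (hp.degree_eq_sum_deg_support hx).le

theorem eq_zero_of_totalDegree_lt {p : MvPolynomial σ R} {d : ℕ}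
    (hp : p ∈ idealOfVars σ R ^ d) (hd : p.totalDegree < d) : p = 0 := by
  by_contra h0
  obtain ⟨x, hx⟩ := support_nonempty.mpr h0
  have h1 := (mem_pow_idealOfVars_iff d p).mp hp x hx
  have h2 := le_totalDegree hx
  exact absurd (h1.trans h2) (by simpa using hd)

theorem isHomogeneous_aeval_toMvPolynomial [Fintype σ] {p : MvPolynomial σ R} {d : ℕ}
    (hp : p.IsHomogeneous d) (M : Matrix σ σ R) :
    (aeval M.toMvPolynomial p).IsHomogeneous d := by
  simpa using hp.aeval M.toMvPolynomial fun i ↦ M.toMvPolynomial_isHomogeneous i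

/-- The matrix of linear parts of a family of polynomials. -/
def linearPart (a : σ → MvPolynomial σ R) : Matrix σ σ R :=
  .of fun i j ↦ coeff (Finsupp.single j 1) (a i)

theorem sub_linearPart_mem [Fintype σ] {a : σ → MvPolynomial σ R}
    (ha : ∀ i, constantCoeff (a i) = 0) (i : σ) :
    a i - (linearPart a).toMvPolynomial i ∈ idealOfVars σ R ^ 2 := by
  classical
  rw [mem_pow_idealOfVars_iff']
  intro x hx
  obtain hx | hx : x.degree = 0 ∨ x.degree = 1 := by lia
  · rw [Finsupp.degree_eq_zero_iff] at hx
    subst hx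
    rw [← constantCoeff_eq, map_sub, ha, Matrix.toMvPolynomial_constantCoeff, sub_zero]
  · obtain ⟨j, rfl⟩ : ∃ j, x = Finsupp.single j 1 := by
      simpa [eq_comm] using (Finsupp.sum_eq_one_iff x).mp hx
    rw [Matrix.toMvPolynomial, coeff_sub, coeff_sum]
    simp [linearPart, coeff_monomial, Finsupp.single_left_inj]

theorem exists_eq_C_mul_aeval_toMvPolynomial [Fintype σ] {d : ℕ}
    {F G : MvPolynomial σ R} (hF : F.IsHomogeneous d) (hG : G.totalDegree ≤ d)
    {a b : σ → MvPolynomial σ R} (ha : ∀ i, constantCoeff (a i) = 0)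
    (hb : ∀ i, constantCoeff (b i) = 0)
    (haG : aeval a G ∈ idealOfVars σ R ^ (d + 1) ⊔ Ideal.span {F})
    (hab : ∀ i, aeval a (b i) - X i ∈ idealOfVars σ R ^ 2) :
    ∃ (M : Matrix σ σ R) (c : R), G = C c * aeval M.toMvPolynomial F := by
  classical
  set A := linearPart a
  set B := linearPart b
  have hA i : constantCoeff (A.toMvPolynomial i) = 0 := by simp
  have hB i : constantCoeff (B.toMvPolynomial i) = 0 := by simp
  have hBA : B * A = 1 := by
    have key i : (B * A).toMvPolynomial i = X i := by
      rw [Matrix.toMvPolynomial_mul, ← sub_eq_zero]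
      refine eq_zero_of_totalDegree_lt (d := 2) ?_ ?_
      · have h1 : aeval a (b i) - aeval A.toMvPolynomial (b i) ∈ idealOfVars σ R ^ 2 :=
          aeval_sub_aeval_mem ha hA (sub_linearPart_mem ha) (e := 1)
            (by simpa using mem_idealOfVars_iff.mpr (hb i))
        have h2 := aeval_mem_pow_idealOfVars hA (sub_linearPart_mem hb i)
        rw [map_sub] at h2
        have := sub_mem (sub_mem (hab i) h1) h2
        convert! this using 1
        simp only [bind₁]
        ring
      · refine lt_of_le_of_lt (IsHomogeneous.totalDegree_le ?_) one_lt_two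
        refine IsHomogeneous.sub ?_ (isHomogeneous_X _ _)
        exact isHomogeneous_aeval_toMvPolynomial (B.toMvPolynomial_isHomogeneous i) A
    ext i j
    have := congr_arg (coeff (Finsupp.single j 1)) (key i)
    simpa [Matrix.toMvPolynomial, coeff_sum, coeff_monomial, Finsupp.single_left_inj, coeff_X,
      Matrix.one_apply] using this
  have hAB : A * B = 1 := mul_eq_one_comm.mp hBA
  have hinv (p : MvPolynomial σ R) : aeval B.toMvPolynomial (aeval A.toMvPolynomial p) = p := by
    have : (aeval B.toMvPolynomial).comp (aeval A.toMvPolynomial) =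
        AlgHom.id R (MvPolynomial σ R) := by
      ext i : 1
      have := A.toMvPolynomial_mul B i
      rw [hAB, Matrix.toMvPolynomial_one] at this
      rw [AlgHom.comp_apply, aeval_X]
      exact this.symm
    exact DFunLike.congr_fun this p
  have hBmem {e : ℕ} {p : MvPolynomial σ R} (hp : aeval A.toMvPolynomial p ∈ idealOfVars σ R ^ e) :
      p ∈ idealOfVars σ R ^ e := by
    have := aeval_mem_pow_idealOfVars hB hp
    rwa [hinv] at this
  obtain ⟨w, hw, v, hv, hwv⟩ := Submodule.mem_sup.mp haG
  obtain ⟨u, rfl⟩ := Ideal.mem_span_singleton.mp hv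
  have hFm := hF.mem_pow_idealOfVars
  have hGe (e : ℕ) (he : e ≤ d) : G ∈ idealOfVars σ R ^ e := by
    induction e with
    | zero => simp
    | succ e ih =>
      have h1 := aeval_sub_aeval_mem ha hA (sub_linearPart_mem ha) (ih (by lia))
      have h2 : aeval a G ∈ idealOfVars σ R ^ (e + 1) := by
        rw [← hwv]
        exact add_mem (Ideal.pow_le_pow_right (by lia) hw)
          (Ideal.mul_mem_right _ _ (Ideal.pow_le_pow_right he hFm))
      exact hBmem (by simpa using sub_mem h2 h1)
  refine ⟨B, constantCoeff u, ?_⟩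
  rw [← sub_eq_zero]
  refine eq_zero_of_totalDegree_lt (d := d + 1) ?_ (Nat.lt_succ_of_le ?_)
  · have h1 := aeval_sub_aeval_mem ha hA (sub_linearPart_mem ha) (hGe d le_rfl)
    have h2 : F * (u - C (constantCoeff u)) ∈ idealOfVars σ R ^ (d + 1) := by
      rw [pow_succ]
      exact Ideal.mul_mem_mul hFm (mem_idealOfVars_iff.mpr (by simp))
    have h3 : aeval A.toMvPolynomial G - C (constantCoeff u) * F ∈ idealOfVars σ R ^ (d + 1) := by
      have := add_mem (sub_mem h2 h1) hw
      rw [← hwv] at this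
      convert! this using 1
      ring
    have := aeval_mem_pow_idealOfVars hB h3
    rw [map_sub, hinv, map_mul] at this
    simpa using this
  · refine (totalDegree_sub _ _).trans (max_le hG (IsHomogeneous.totalDegree_le ?_))
    exact IsHomogeneous.C_mul (isHomogeneous_aeval_toMvPolynomial hF B) _

end Truncation

section Cone

variable {K : Type*} [Field K]

/-- The function `x_0^{d-1} y + z^d + μ x_0^{d-2} x_1^2`. -/
def coneFun (r d : ℕ) (μ : K) (v : Fin (r + 4) → K) : K :=
  v 0 ^ (d - 1) * v 2 + v 3 ^ d + μ * v 0 ^ (d - 2) * v 1 ^ 2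

theorem coneFun_smul {r d : ℕ} (hd : 3 ≤ d) (μ s : K) (v : Fin (r + 4) → K) :
    coneFun r d μ (s • v) = s ^ d * coneFun r d μ v := by
  obtain ⟨e, rfl⟩ := Nat.exists_eq_add_of_le' hd
  simp only [coneFun, Pi.smul_apply, smul_eq_mul, show e + 3 - 1 = e + 2 by lia,
    show e + 3 - 2 = e + 1 by lia]
  ring

theorem translation_eq_zero [Infinite K] {d : ℕ} (hd : 3 ≤ d) {μ : K} (hμ : μ ≠ 0) {a b c e : K}
    (h : ∀ x w y z : K, (x + a) ^ (d - 1) * (y + c) + (z + e) ^ d +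
      μ * (x + a) ^ (d - 2) * (w + b) ^ 2 = x ^ (d - 1) * y + z ^ d + μ * x ^ (d - 2) * w ^ 2) :
    a = 0 ∧ b = 0 ∧ c = 0 ∧ e = 0 := by
  obtain ⟨n, rfl⟩ := Nat.exists_eq_add_of_le' hd
  simp only [show n + 3 - 1 = n + 2 by lia, show n + 3 - 2 = n + 1 by lia] at h
  obtain rfl : a = 0 := by
    have h0 := h 0 0 0 0
    have h1 := h 0 0 1 0
    have : a ^ (n + 2) = 0 := by
      simp only [ne_eq, Nat.add_eq_zero_iff, not_false_eq_true, zero_pow, OfNat.ofNat_ne_zero,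
        and_false, zero_mul, zero_add, one_ne_zero, mul_zero] at h0 h1
      linear_combination h1 - h0
    exact eq_zero_of_pow_eq_zero this
  obtain rfl : e = 0 := by
    have h0 := h 0 0 0 0
    simpa using h0
  have key (x : K) (hx : x ≠ 0) : x * c + μ * b ^ 2 = 0 := by
    have h0 := h x 0 0 0
    refine (mul_eq_zero.mp (?_ : x ^ (n + 1) * _ = 0)).resolve_left (pow_ne_zero _ hx)
    simp only [add_zero, zero_add, mul_zero, ne_eq, OfNat.ofNat_ne_zero, not_false_eq_true,
      zero_pow] at h0
    linear_combination h0
  classical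
  obtain ⟨x, hx⟩ := Infinite.exists_notMem_finset ({0, 1} : Finset K)
  simp only [Finset.mem_insert, Finset.mem_singleton, not_or] at hx
  obtain rfl : c = 0 := by
    have h1 := key 1 one_ne_zero
    have h2 := key x hx.1
    have : (x - 1) * c = 0 := by linear_combination h2 - h1
    exact (mul_eq_zero.mp this).resolve_left (sub_ne_zero.mpr hx.2)
  have h1 := key 1 one_ne_zero
  simp_all

theorem coneFun_translation_eq_zero [Infinite K] {r d : ℕ} (hd : 3 ≤ d) {μ : K} (hμ : μ ≠ 0)
    {U : Fin (r + 4) → K} (h : ∀ V, coneFun r d μ (V + U) = coneFun r d μ V) :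
    U 0 = 0 ∧ U 1 = 0 ∧ U 2 = 0 ∧ U 3 = 0 := by
  refine translation_eq_zero hd hμ fun x w y z ↦ ?_
  have := h (Fin.cons x (Fin.cons w (Fin.cons y (Fin.cons z 0))))
  exact this

theorem coneFun_dehomogenized_ne [Infinite K] {r d : ℕ} (hd : 3 ≤ d) {μ : K} (hμ : μ ≠ 0)
    (j : Fin (r + 4)) (Q : Fin (r + 3) → K) (M : Matrix (Fin (r + 3)) (Fin (r + 3)) K) (c : K)
    (h : ∀ t, coneFun r d μ (j.insertNth (α := fun _ ↦ K) 1 (Q + t)) =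
      c * ((M.mulVec t) 0 ^ (d - 1) * (M.mulVec t) 1 + (M.mulVec t) 2 ^ d)) : False := by
  set P : Fin (r + 4) → K := j.insertNth (α := fun _ ↦ K) 1 Q with hP
  let ins (t : Fin (r + 3) → K) : Fin (r + 4) → K := j.insertNth (α := fun _ ↦ K) 0 t
  have hadd (t : Fin (r + 3) → K) :
      j.insertNth (α := fun _ ↦ K) 1 (Q + t) = P + ins t := by
    rw [hP, ← Fin.insertNth_add, add_zero]
  have hscale (s : K) (hs : s ≠ 0) (t : Fin (r + 3) → K) :
      coneFun r d μ (s • P + ins t) = coneFun r d μ (P + ins t) := by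
    have h1 : s • P + ins t = s • (P + ins (s⁻¹ • t)) := by
      rw [smul_add]
      congr 1
      ext i
      refine Fin.succAboveCases j ?_ (fun i ↦ ?_) i <;> simp [ins, hs]
    have h2 : d - 1 + 1 = d := by lia
    rw [h1, coneFun_smul hd, ← hadd, ← hadd, h, h]
    simp only [Matrix.mulVec_smul, Pi.smul_apply, smul_eq_mul, mul_pow]
    rw [← mul_left_inj' (pow_ne_zero d hs), inv_pow, inv_pow]
    have h3 : s ^ d = s ^ (d - 1) * s := by rw [← pow_succ, h2]
    rw [h3]
    field_simp
  have hzero (t : Fin (r + 3) → K) : coneFun r d μ (ins t) = coneFun r d μ (P + ins t) := by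
    let v (i : Fin (r + 4)) : Polynomial K := .C (P i) * .X + .C (ins t i)
    let p : Polynomial K := v 0 ^ (d - 1) * v 2 + v 3 ^ d + .C μ * v 0 ^ (d - 2) * v 1 ^ 2
    have hp (s : K) : p.eval s = coneFun r d μ (s • P + ins t) := by
      simp only [p, v, coneFun, Polynomial.eval_add, Polynomial.eval_mul, Polynomial.eval_pow,
        Polynomial.eval_C, Polynomial.eval_X, Pi.add_apply, Pi.smul_apply, smul_eq_mul]
      ring
    have : p = .C (coneFun r d μ (P + ins t)) := by
      refine Polynomial.eq_of_infinite_eval_eq _ _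
        ((Set.finite_singleton (0 : K)).infinite_compl.mono fun s hs ↦ ?_)
      rw [Set.mem_ofPred_eq, hp, Polynomial.eval_C]
      exact hscale s hs t
    have h0 := hp 0
    rw [this, Polynomial.eval_C] at h0
    rw [h0, zero_smul, zero_add]
  have hall (s : K) (t : Fin (r + 3) → K) : coneFun r d μ (s • P + ins t) =
      coneFun r d μ (ins t) := by
    by_cases hs : s = 0
    · rw [hs, zero_smul, zero_add]
    · rw [hscale s hs, hzero]
  have hdecomp (V : Fin (r + 4) → K) : ∃ t, V = V j • P + ins t := by
    refine ⟨fun i ↦ V (j.succAbove i) - V j * Q i, ?_⟩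
    ext i
    refine Fin.succAboveCases j ?_ (fun i ↦ ?_) i <;> simp [ins, hP]
  obtain ⟨hP0, hP1, hP2, hP3⟩ := coneFun_translation_eq_zero (r := r) (U := P) hd hμ fun V ↦ by
    obtain ⟨t, ht⟩ := hdecomp V
    rw [ht, hall, add_right_comm, show V j • P + P = (V j + 1) • P by rw [add_smul, one_smul],
      hall]
  have hPj : P j = 1 := by simp [hP]
  have hne (i : Fin 4) : Fin.castLE (by lia : 4 ≤ r + 4) i ≠ j := by
    rintro rfl
    fin_cases i
    · exact zero_ne_one (hP0.symm.trans hPj)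
    · exact zero_ne_one (hP1.symm.trans hPj)
    · exact zero_ne_one (hP2.symm.trans hPj)
    · exact zero_ne_one (hP3.symm.trans hPj)
  let ext := Function.ExtendByZero.linearMap K (Fin.castLE (by lia : 4 ≤ r + 4))
  let L : (Fin 4 → K) →ₗ[K] (Fin 3 → K) :=
    LinearMap.funLeft K K (Fin.castLE (by lia : 3 ≤ r + 3)) ∘ₗ M.mulVecLin ∘ₗ
      LinearMap.funLeft K K j.succAbove ∘ₗ ext
  obtain ⟨v, hv, hv0⟩ := (Submodule.ne_bot_iff _).mp
    (LinearMap.ker_ne_bot_of_finrank_lt (f := L) (by simp))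
  have hext (i : Fin 4) : ext v (Fin.castLE (by lia) i) = v i :=
    (Fin.castLE_injective _).extend_apply _ _ _
  have hextj : ext v j = 0 :=
    Function.extend_apply' _ _ _ fun ⟨i, hi⟩ ↦ hne i hi
  have hL (i : Fin 3) : (M.mulVec (ext v ∘ j.succAbove)) (Fin.castLE (by lia) i) = 0 :=
    congr_fun (LinearMap.mem_ker.mp hv) i
  obtain ⟨h0, h1, h2, h3⟩ := coneFun_translation_eq_zero (r := r) (U := ext v) hd hμ fun V ↦ by
    have hup (V : Fin (r + 4) → K) :
        coneFun r d μ (Function.update V j 1) = coneFun r d μ V := by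
      have h0 : (0 : Fin (r + 4)) ≠ j := hne 0
      have h1 : (1 : Fin (r + 4)) ≠ j := hne 1
      have h2 : (2 : Fin (r + 4)) ≠ j := hne 2
      have h3 : (3 : Fin (r + 4)) ≠ j := hne 3
      simp only [coneFun]
      rw [Function.update_of_ne h0, Function.update_of_ne h1, Function.update_of_ne h2,
        Function.update_of_ne h3]
    let t : Fin (r + 3) → K := fun i ↦ V (j.succAbove i) - Q i
    have e1 : Function.update V j 1 = j.insertNth (α := fun _ ↦ K) 1 (Q + t) := by
      ext i
      refine Fin.succAboveCases j ?_ (fun i ↦ ?_) i <;> simp [t]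
    have e2 : Function.update (V + ext v) j 1 =
        j.insertNth (α := fun _ ↦ K) 1 (Q + (t + ext v ∘ j.succAbove)) := by
      ext i
      refine Fin.succAboveCases j ?_ (fun i ↦ ?_) i <;> simp [t]
      ring
    rw [← hup, ← hup V, e1, e2, h, h, Matrix.mulVec_add]
    have l0 := hL 0
    have l1 := hL 1
    have l2 := hL 2
    change M.mulVec (ext v ∘ j.succAbove) 0 = 0 at l0
    change M.mulVec (ext v ∘ j.succAbove) 1 = 0 at l1
    change M.mulVec (ext v ∘ j.succAbove) 2 = 0 at l2
    simp [l0, l1, l2]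
  refine hv0 (funext fun i ↦ ?_)
  rw [← hext]
  fin_cases i
  exacts [h0, h1, h2, h3]

end Cone

section ConePoly

variable {k : Type} [Field k]

/-- The form `x_0^{d-1} y + z^d + μ x_0^{d-2} x_1^2`. -/
def conePoly (r d : ℕ) (μ : k) : MvPolynomial (Fin (r + 3 + 1)) k :=
  X 0 ^ (d - 1) * X 2 + X 3 ^ d + C μ * X 0 ^ (d - 2) * X 1 ^ 2

/-- The form `x_0^{d-1} y + z^d` in the affine coordinates of the chart `x_1 = 1`. -/
def affineCone (k : Type) [Field k] (r d : ℕ) : MvPolynomial (Fin (r + 3)) k :=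
  X 0 ^ (d - 1) * X 1 + X 2 ^ d

theorem conePoly_zero (r d : ℕ) :
    conePoly r d (0 : k) = X 0 ^ (d - 1) * X 2 + X 3 ^ d := by
  simp [conePoly]

theorem aeval_conePoly {A : Type*} [CommRing A] [Algebra k A] (r d : ℕ) (μ : k)
    (v : Fin (r + 3 + 1) → A) :
    aeval v (conePoly r d μ) =
      v 0 ^ (d - 1) * v 2 + v 3 ^ d + algebraMap k A μ * v 0 ^ (d - 2) * v 1 ^ 2 := by
  simp [conePoly]

theorem conePoly_isHomogeneous (r : ℕ) {d : ℕ} (hd : 3 ≤ d) (μ : k) :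
    (conePoly r d μ).IsHomogeneous d := by
  refine ((IsHomogeneous.add ?_ (isHomogeneous_X_pow _ _)).add ?_)
  · have := (isHomogeneous_X_pow (R := k) (0 : Fin (r + 3 + 1)) (d - 1)).mul
      (isHomogeneous_X k (2 : Fin (r + 3 + 1)))
    rwa [Nat.sub_add_cancel (by lia)] at this
  · have := ((isHomogeneous_X_pow (R := k) (0 : Fin (r + 3 + 1)) (d - 2)).C_mul μ).mul
      (isHomogeneous_X_pow (R := k) (1 : Fin (r + 3 + 1)) 2)
    rwa [Nat.sub_add_cancel (by lia)] at this

theorem conePoly_prime (r : ℕ) {d : ℕ} (hd : 3 ≤ d) (μ : k) : Prime (conePoly r d μ) := by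
  have h20 : (2 : Fin (r + 3 + 1)) ≠ 0 := fun h ↦ by
    simpa using show (2 : ℕ) = 0 from congr_arg Fin.val h
  have h21 : (2 : Fin (r + 3 + 1)) ≠ 1 := fun h ↦ by
    simpa using show (2 : ℕ) = 1 from congr_arg Fin.val h
  have h23 : (2 : Fin (r + 3 + 1)) ≠ 3 := fun h ↦ by
    simpa using show (2 : ℕ) = 3 from congr_arg Fin.val h
  have h30 : (3 : Fin (r + 3 + 1)) ≠ 0 := fun h ↦ by
    simpa using show (3 : ℕ) = 0 from congr_arg Fin.val h
  have hX (i : Fin (r + 3 + 1)) (hi : 2 ≠ i) (m : ℕ) :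
      2 ∉ (X i ^ m : MvPolynomial (Fin (r + 3 + 1)) k).vars := fun h ↦ by
    have := vars_pow _ _ h
    rw [vars_X, Finset.mem_singleton] at this
    exact hi this
  rw [conePoly, add_assoc (X 0 ^ (d - 1) * X 2)]
  refine (irreducible_mul_X_add _ _ _ (pow_ne_zero _ (X_ne_zero _)) (hX 0 h20 _) ?_ ?_).prime
  · intro h
    rcases Finset.mem_union.mp (vars_add_subset _ _ h) with h | h
    · exact hX 3 h23 _ h
    · rcases Finset.mem_union.mp (vars_mul _ _ h) with h | h
      · rcases Finset.mem_union.mp (vars_mul _ _ h) with h | h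
        · simp at h
        · exact hX 0 h20 _ h
      · exact hX 1 h21 _ h
  · refine IsRelPrime.pow_left ((X_prime.irreducible.isRelPrime_iff_not_dvd).mpr ?_)
    rintro ⟨q, hq⟩
    have := congr_arg (eval (Pi.single 3 1)) hq
    simp [h30.symm, show d - 2 ≠ 0 by lia] at this

theorem not_conePoly_dvd_X (r : ℕ) {d : ℕ} (hd : 3 ≤ d) (μ : k) (j : Fin (r + 3 + 1)) :
    ¬ conePoly r d μ ∣ X j := by
  rintro ⟨q, hq⟩
  have hc := (conePoly_prime r hd μ).ne_zero
  have hq0 : q ≠ 0 := by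
    rintro rfl
    exact X_ne_zero j (by rw [hq, mul_zero])
  have := congr_arg totalDegree hq
  rw [totalDegree_X, totalDegree_mul_of_isDomain hc hq0,
    (conePoly_isHomogeneous r hd μ).totalDegree hc] at this
  lia

theorem aeval_insertNth_conePoly_zero (r d : ℕ) :
    aeval ((1 : Fin (r + 3 + 1)).insertNth (α := fun _ ↦ MvPolynomial (Fin (r + 3)) k) 1 X)
      (conePoly r d (0 : k)) = affineCone k r d := by
  rw [aeval_conePoly, affineCone]
  have h0 := Fin.insertNth_apply_succAbove (α := fun _ ↦ MvPolynomial (Fin (r + 3)) k)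
    (1 : Fin (r + 3 + 1)) 1 X 0
  have h1 := Fin.insertNth_apply_succAbove (α := fun _ ↦ MvPolynomial (Fin (r + 3)) k)
    (1 : Fin (r + 3 + 1)) 1 X 1
  have h2 := Fin.insertNth_apply_succAbove (α := fun _ ↦ MvPolynomial (Fin (r + 3)) k)
    (1 : Fin (r + 3 + 1)) 1 X 2
  rw [show (1 : Fin (r + 3 + 1)).succAbove 0 = 0 from rfl] at h0
  rw [show (1 : Fin (r + 3 + 1)).succAbove 1 = 2 from rfl] at h1
  rw [show (1 : Fin (r + 3 + 1)).succAbove 2 = 3 from rfl] at h2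
  rw [h0, h1, h2]
  simp

theorem affineCone_isHomogeneous (r : ℕ) {d : ℕ} (hd : 3 ≤ d) :
    (affineCone k r d).IsHomogeneous d := by
  refine IsHomogeneous.add ?_ (isHomogeneous_X_pow _ _)
  have := (isHomogeneous_X_pow (R := k) (0 : Fin (r + 3)) (d - 1)).mul
    (isHomogeneous_X k (1 : Fin (r + 3)))
  rwa [Nat.sub_add_cancel (by lia)] at this

theorem aeval_insertNth_conePoly_ne {r d : ℕ} (hd : 3 ≤ d) {μ : k} (hμ : μ ≠ 0)
    (j : Fin (r + 3 + 1)) (Q : Fin (r + 3) → k) (M : Matrix (Fin (r + 3)) (Fin (r + 3)) k) (c : k) :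
    aeval (j.insertNth (α := fun _ ↦ MvPolynomial (Fin (r + 3)) k) 1 fun i ↦ C (Q i) + X i)
      (conePoly r d μ) ≠ C c * aeval M.toMvPolynomial (affineCone k r d) := by
  intro h
  let K := AlgebraicClosure k
  let φ := algebraMap k K
  refine coneFun_dehomogenized_ne (r := r) hd ((map_ne_zero φ).mpr hμ) j (φ ∘ Q) (M.map φ) (φ c)
    fun t ↦ ?_
  have ht := congr_arg (aeval t) h
  have hM (i : Fin (r + 3)) : aeval t (M.toMvPolynomial i) = ((M.map φ).mulVec t) i := by
    rw [← Matrix.toMvPolynomial_eval_eq_apply, Matrix.toMvPolynomial_map, MvPolynomial.eval_map]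
    rfl
  have hv : (fun i ↦ aeval t (j.insertNth (α := fun _ ↦ MvPolynomial (Fin (r + 3)) k) 1
      (fun i ↦ C (Q i) + X i) i)) = j.insertNth (α := fun _ ↦ K) 1 (φ ∘ Q + t) := by
    ext i
    refine Fin.succAboveCases j ?_ (fun i ↦ ?_) i <;> simp [φ]
  rw [comp_aeval_apply, hv, aeval_conePoly] at ht
  refine ht.trans ?_
  simp [hM, φ, affineCone]

theorem totalDegree_aeval_insertNth_conePoly_le (r : ℕ) {d : ℕ} (hd : 3 ≤ d) (μ : k)
    (j : Fin (r + 3 + 1)) (Q : Fin (r + 3) → k) :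
    (aeval (j.insertNth (α := fun _ ↦ MvPolynomial (Fin (r + 3)) k) 1 fun i ↦ C (Q i) + X i)
      (conePoly r d μ)).totalDegree ≤ d := by
  set v : Fin (r + 3 + 1) → MvPolynomial (Fin (r + 3)) k :=
    j.insertNth (α := fun _ ↦ MvPolynomial (Fin (r + 3)) k) 1 fun i ↦ C (Q i) + X i
  have hv (i) : (v i).totalDegree ≤ 1 := by
    refine Fin.succAboveCases j ?_ (fun i ↦ ?_) i
    · simp [v]
    · simp only [v, Fin.insertNth_apply_succAbove]
      refine (totalDegree_add _ _).trans ?_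
      simp
  have hpow (i) (m : ℕ) : (v i ^ m).totalDegree ≤ m :=
    (totalDegree_pow _ _).trans (by simpa using Nat.mul_le_mul_left m (hv i))
  rw [aeval_conePoly]
  refine (totalDegree_add _ _).trans (max_le ((totalDegree_add _ _).trans (max_le ?_ (hpow 3 d))) ?_)
  · refine (totalDegree_mul _ _).trans ?_
    have := add_le_add (hpow 0 (d - 1)) (hv 2)
    lia
  · refine (totalDegree_mul _ _).trans ?_
    have h1 := totalDegree_mul (algebraMap k (MvPolynomial (Fin (r + 3)) k) μ) (v 0 ^ (d - 2))
    rw [algebraMap_eq, totalDegree_C, zero_add] at h1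
    have := add_le_add (h1.trans (hpow 0 (d - 2))) (hpow 1 2)
    rw [algebraMap_eq]
    lia

end ConePoly

section LocalAlgebra

variable {k : Type} [Field k]

theorem asIdeal_eq_ker_of_pow_ker_eq_bot {A : Type} [CommRing A] [Algebra k A] (ρ : A →ₐ[k] k)
    {m : ℕ} (hρ : RingHom.ker ρ ^ m = ⊥) (p : PrimeSpectrum A) :
    p.asIdeal = RingHom.ker ρ := by
  have hmax : (RingHom.ker ρ).IsMaximal :=
    RingHom.ker_isMaximal_of_surjective ρ fun c ↦ ⟨algebraMap k A c, by simp⟩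
  refine (hmax.eq_of_le p.isPrime.ne_top (p.isPrime.le_of_pow_le (n := m) ?_)).symm
  rw [hρ]
  exact bot_le

theorem exists_eq_chartPoint_of_pow_ker_eq_bot {n : ℕ} {A : Type} [CommRing A] [Algebra k A]
    (ρ : A →ₐ[k] k) {m : ℕ} (hρ : RingHom.ker ρ ^ m = ⊥) (q : Spec (.of A) ⟶ ProjSpace k n)
    (hq : q ≫ projStruct k n = Spec.map (CommRingCat.ofHom (algebraMap k A))) :
    ∃ j a h, q = chartPoint j a h := by
  let x : Spec (.of A) := PrimeSpectrum.comap ρ.toRingHom ⊥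
  obtain ⟨j, hj⟩ := exists_mem_basicOpen_X (q x)
  refine ⟨j, exists_eq_chartPoint j q hq fun y ↦ ?_⟩
  obtain rfl : y = x := PrimeSpectrum.ext <|
    (asIdeal_eq_ker_of_pow_ker_eq_bot ρ hρ y).trans (asIdeal_eq_ker_of_pow_ker_eq_bot ρ hρ x).symm
  exact hj

theorem exists_comp_eq_of_SpecMap_comp_eq {n : ℕ} {A B : Type} [CommRing A] [Algebra k A]
    [CommRing B] [Algebra k B] (ρA : A →ₐ[k] k) (ρB : B →ₐ[k] k) {m : ℕ}
    (hρB : RingHom.ker ρB ^ m = ⊥) (α : B →ₐ[k] A) (q : Spec (.of B) ⟶ ProjSpace k n)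
    (hq : q ≫ projStruct k n = Spec.map (CommRingCat.ofHom (algebraMap k B))) {j : Fin (n + 1)}
    {a : Fin (n + 1) → A} {h : a j = 1}
    (hα : Spec.map (CommRingCat.ofHom α.toRingHom) ≫ q = chartPoint j a h) :
    ∃ b : Fin (n + 1) → B, b j = 1 ∧ α ∘ b = a := by
  let y : Spec (.of A) := PrimeSpectrum.comap ρA.toRingHom ⊥
  obtain ⟨b, hb, rfl⟩ := exists_eq_chartPoint j q hq fun x ↦ by
    have hx : x = Spec.map (CommRingCat.ofHom α.toRingHom) y := PrimeSpectrum.ext <|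
      (asIdeal_eq_ker_of_pow_ker_eq_bot ρB hρB x).trans
        (asIdeal_eq_ker_of_pow_ker_eq_bot ρB hρB _).symm
    rw [hx, ← Scheme.Hom.comp_apply, hα]
    exact chartPoint_mem_basicOpen j a h y
  rw [SpecMap_chartPoint] at hα
  exact ⟨b, hb, chartPoint_injective j hα⟩

variable {σ : Type}

/-- The ideal defining the order `d` infinitesimal neighbourhood of the origin in `V(G)`. -/
def truncIdeal (d : ℕ) (G : MvPolynomial σ k) : Ideal (MvPolynomial σ k) :=
  idealOfVars σ k ^ (d + 1) ⊔ Ideal.span {G}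

theorem aeval_zero_eq_constantCoeff (p : MvPolynomial σ k) :
    aeval (0 : σ → k) p = constantCoeff p := by
  simp [aeval_zero]

theorem self_mem_truncIdeal (d : ℕ) (G : MvPolynomial σ k) : G ∈ truncIdeal d G :=
  Ideal.mem_sup_right (Ideal.mem_span_singleton_self G)

theorem truncIdeal_le_ker {d : ℕ} {G : MvPolynomial σ k} {A : Type} [CommRing A]
    [Algebra k A] {ρ : A →ₐ[k] k} (hρ : RingHom.ker ρ ^ (d + 1) = ⊥) {a : σ → A}
    (ha : ∀ i, ρ (a i) = 0) (haG : aeval a G = 0) : truncIdeal d G ≤ RingHom.ker (aeval a) := by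
  rw [truncIdeal, sup_le_iff, Ideal.span_singleton_le_iff_mem]
  refine ⟨?_, haG⟩
  have hle : (idealOfVars σ k).map (aeval a) ≤ RingHom.ker ρ := by
    rw [Ideal.map_span, Ideal.span_le]
    rintro _ ⟨_, ⟨i, rfl⟩, rfl⟩
    simpa using ha i
  rw [← Ideal.map_eq_bot_iff_le_ker, Ideal.map_pow, eq_bot_iff, ← hρ]
  exact Ideal.pow_right_mono hle _

/-- The residue map of the local algebra `k[x]/(truncIdeal d G)` at the origin. -/
def truncResidue (d : ℕ) {G : MvPolynomial σ k} (hG : constantCoeff G = 0) :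
    (MvPolynomial σ k ⧸ truncIdeal d G) →ₐ[k] k :=
  Ideal.Quotient.liftₐ _ (aeval 0) fun p hp ↦ by
    refine (?_ : truncIdeal d G ≤ RingHom.ker (aeval (R := k) (0 : σ → k))) hp
    refine truncIdeal_le_ker (ρ := AlgHom.id k k) ?_ (by simp) (by
      rw [aeval_zero_eq_constantCoeff, hG])
    rw [(RingHom.injective_iff_ker_eq_bot _).mp fun _ _ h ↦ h]
    exact Ideal.bot_pow (by lia)

theorem truncResidue_mk (d : ℕ) {G : MvPolynomial σ k} (hG : constantCoeff G = 0)
    (p : MvPolynomial σ k) : truncResidue d hG (Ideal.Quotient.mk _ p) = constantCoeff p :=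
  aeval_zero_eq_constantCoeff p

theorem pow_ker_truncResidue (d : ℕ) {G : MvPolynomial σ k} (hG : constantCoeff G = 0) :
    RingHom.ker (truncResidue d hG) ^ (d + 1) = ⊥ := by
  have hle : RingHom.ker (truncResidue d hG) ≤
      (idealOfVars σ k).map (Ideal.Quotient.mk (truncIdeal d G)) := by
    intro x hx
    obtain ⟨p, rfl⟩ := Ideal.Quotient.mk_surjective x
    rw [RingHom.mem_ker, truncResidue_mk] at hx
    exact Ideal.mem_map_of_mem _ (mem_idealOfVars_iff.mpr hx)
  rw [eq_bot_iff]
  refine (Ideal.pow_right_mono hle _).trans ?_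
  rw [← Ideal.map_pow, le_bot_iff, Ideal.map_eq_bot_iff_le_ker, Ideal.mk_ker]
  exact le_sup_left

end LocalAlgebra

/-- **Proposition 3.10.**  Let `d ≥ 3`, `μ ∈ k*` and let
`f = x_0^{d-1} y + z^d`, `g = x_0^{d-1} y + z^d + μ x_0^{d-2} x_1^2` in
`k[x_0, x_1, y, z]` (`x_0 = x_0`, `x_1 = x_1`, `y = x_2`, `z = x_3`).  Then for each
`r ≥ 0` the hypersurfaces `V(f), V(g) ⊆ ℙ^{r+3}` are not isomorphic (as varieties
over `k`). -/
theorem stmt13 (k : Type) [Field k] (d : ℕ) (hd : 3 ≤ d) (μ : k) (hμ : μ ≠ 0) (r : ℕ)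
    (H H' : Scheme) (ι : H ⟶ ProjSpace k (r + 3)) (ι' : H' ⟶ ProjSpace k (r + 3))
    (hH : IsHypersurface (X 0 ^ (d - 1) * X 2 + X 3 ^ d) H ι)
    (hH' : IsHypersurface
      (X 0 ^ (d - 1) * X 2 + X 3 ^ d + C μ * X 0 ^ (d - 2) * X 1 ^ 2) H' ι') :
    ¬ IsoOver (ι ≫ projStruct k (r + 3)) (ι' ≫ projStruct k (r + 3)) := by
  rintro ⟨e, he⟩
  have := hH'.isClosedImmersion
  rw [← conePoly_zero] at hH
  have liftF := hH.exists_lift_chartPoint_iff (conePoly_isHomogeneous r hd 0) (by lia)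
    (conePoly_prime r hd 0)
  have liftG := IsHypersurface.exists_lift_chartPoint_iff (F := conePoly r d μ) hH'
    (conePoly_isHomogeneous r hd μ) (by lia) (conePoly_prime r hd μ)
  let R := MvPolynomial (Fin (r + 3)) k
  let F : R := affineCone k r d
  have hFd : F.IsHomogeneous d := affineCone_isHomogeneous r hd
  have hF0 : constantCoeff F = 0 := by
    simp [F, affineCone, show d ≠ 0 by lia]
  let A := R ⧸ truncIdeal d F
  let ρ : A →ₐ[k] k := truncResidue d hF0
  have hρ : RingHom.ker ρ ^ (d + 1) = ⊥ := pow_ker_truncResidue d hF0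
  let wF : Fin (r + 3 + 1) → R := (1 : Fin (r + 3 + 1)).insertNth (α := fun _ ↦ R) 1 X
  let aF : Fin (r + 3 + 1) → A := fun i ↦ Ideal.Quotient.mkₐ k (truncIdeal d F) (wF i)
  have haF : aF 1 = 1 := by simp [aF, wF]
  have haF0 : aeval aF (conePoly r d (0 : k)) = 0 := by
    rw [← comp_aeval_apply, aeval_insertNth_conePoly_zero]
    exact Ideal.Quotient.eq_zero_iff_mem.mpr (self_mem_truncIdeal d F)
  obtain ⟨q, hq⟩ := (liftF 1 (not_conePoly_dvd_X r hd 0 1) aF haF).mpr haF0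
  obtain ⟨j, a, haj, hqa⟩ := exists_eq_chartPoint_of_pow_ker_eq_bot ρ hρ (q ≫ e.hom ≫ ι') (by
    rw [Category.assoc, Category.assoc, he, reassoc_of% hq, chartPoint_projStruct])
  have hag : aeval a (conePoly r d μ) = 0 :=
    (liftG j (not_conePoly_dvd_X r hd μ j) a haj).mp ⟨q ≫ e.hom, by rw [Category.assoc, hqa]⟩
  let Q (i : Fin (r + 3)) : k := ρ (a (j.succAbove i))
  let wG : Fin (r + 3 + 1) → R := j.insertNth (α := fun _ ↦ R) 1 fun i ↦ C (Q i) + X i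
  let G : R := aeval wG (conePoly r d μ)
  let δ (i : Fin (r + 3)) : A := a (j.succAbove i) - algebraMap k A (Q i)
  have hδ (i) : ρ (δ i) = 0 := by simp [δ, Q]
  have hδw (i) : aeval δ (wG i) = a i := by
    refine Fin.succAboveCases j ?_ (fun i ↦ ?_) i <;> simp [wG, δ, haj]
  have hδG : aeval δ G = 0 := by
    rw [comp_aeval_apply]
    simpa only [hδw] using hag
  have hρδ (p : R) : ρ (aeval δ p) = constantCoeff p := by
    rw [comp_aeval_apply, ← aeval_zero_eq_constantCoeff]
    simp only [hδ]
    rfl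
  have hG0 : constantCoeff G = 0 := by rw [← hρδ, hδG, map_zero]
  let B := R ⧸ truncIdeal d G
  let α : B →ₐ[k] A := Ideal.Quotient.liftₐ _ (aeval δ) fun p hp ↦
    truncIdeal_le_ker hρ hδ hδG hp
  have hα (p : R) : α (Ideal.Quotient.mk _ p) = aeval δ p := rfl
  let aG : Fin (r + 3 + 1) → B := fun i ↦ Ideal.Quotient.mkₐ k (truncIdeal d G) (wG i)
  have haG : aG j = 1 := by simp [aG, wG]
  have haG0 : aeval aG (conePoly r d μ) = 0 := by
    rw [← comp_aeval_apply]
    exact Ideal.Quotient.eq_zero_iff_mem.mpr (self_mem_truncIdeal d G)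
  have hαaG : α ∘ aG = a := funext hδw
  obtain ⟨q', hq'⟩ := (liftG j (not_conePoly_dvd_X r hd μ j) aG haG).mpr haG0
  have hαq : Spec.map (CommRingCat.ofHom α.toRingHom) ≫ q' = q ≫ e.hom := by
    rw [← cancel_mono ι', Category.assoc, hq', SpecMap_chartPoint, Category.assoc, hqa]
    congr 1
  have hover : (q' ≫ e.inv ≫ ι) ≫ projStruct k (r + 3) =
      Spec.map (CommRingCat.ofHom (algebraMap k B)) := by
    rw [Category.assoc, Category.assoc, ← he, e.inv_hom_id_assoc, reassoc_of% hq',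
      chartPoint_projStruct]
  have hαι : Spec.map (CommRingCat.ofHom α.toRingHom) ≫ q' ≫ e.inv ≫ ι = chartPoint 1 aF haF := by
    rw [reassoc_of% hαq, e.hom_inv_id_assoc, hq]
  obtain ⟨b, hb1, hαb⟩ := exists_comp_eq_of_SpecMap_comp_eq ρ (truncResidue d hG0)
    (pow_ker_truncResidue d hG0) α _ hover hαι
  choose a' ha' using fun i ↦ Ideal.Quotient.mk_surjective (I := truncIdeal d F) (δ i)
  choose b' hb' using fun i : Fin (r + 3) ↦ Ideal.Quotient.mk_surjective (I := truncIdeal d G)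
    (b ((1 : Fin (r + 3 + 1)).succAbove i))
  have hmk (p : R) : Ideal.Quotient.mk (truncIdeal d F) (aeval a' p) = aeval δ p := by
    refine (comp_aeval_apply a' (Ideal.Quotient.mkₐ k (truncIdeal d F)) p).trans ?_
    congr 2
    exact funext ha'
  have hδb (i) : aeval δ (b' i) = Ideal.Quotient.mk (truncIdeal d F) (X i) := by
    rw [← hα, hb']
    refine (congr_fun hαb _).trans ?_
    simp [aF, wF]
  have hle : truncIdeal d F ≤ idealOfVars _ k ^ 2 := by
    refine sup_le (Ideal.pow_le_pow_right (by lia)) ?_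
    rw [Ideal.span_singleton_le_iff_mem]
    exact Ideal.pow_le_pow_right (by lia) hFd.mem_pow_idealOfVars
  obtain ⟨M, c, hMc⟩ := exists_eq_C_mul_aeval_toMvPolynomial hFd
    (totalDegree_aeval_insertNth_conePoly_le r hd μ j Q) (a := a') (b := b')
    (fun i ↦ by rw [← truncResidue_mk d hF0, ha']; exact hδ i)
    (fun i ↦ by rw [← hρδ, hδb]; exact (truncResidue_mk d hF0 _).trans (by simp))
    (Ideal.Quotient.eq_zero_iff_mem.mp ((hmk G).trans hδG))
    (fun i ↦ hle (Ideal.Quotient.eq.mp ((hmk _).trans (hδb i))))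
  exact aeval_insertNth_conePoly_ne hd hμ j Q M c hMc

end
end

section
/- Let Z ⊆ A and Z ⊆ B be finitely generated ring extensions of the ring of integers Z such that A and B are integral domains. If there exists a field K and a K-algebra isomorphism between K ⊗_Z A and K ⊗_Z B, then there exists a prime power q such that F_q ⊗_Z A and F_q ⊗_Z B are isomorphic as F_q-algebras. -/
open scoped TensorProduct

theorem Int.isJacobsonRing : IsJacobsonRing ℤ := by
  refine isJacobsonRing_iff_prime_eq.mpr fun P hP ↦ ?_
  by_cases hbot : P = ⊥
  · subst hbot
    refine le_antisymm (fun x hx ↦ ?_) Ideal.le_jacobson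
    rcases Int.isUnit_iff.mp (Ideal.mem_jacobson_bot.mp hx x) with h | h
    · simpa using h
    · nlinarith [mul_self_nonneg x]
  · have := hP.isMaximal hbot
    exact Ideal.jacobson_eq_self_of_isMaximal

/-- A field that is finitely generated as a ring is finite. -/
theorem Field.finite_of_finiteType_int (F : Type*) [Field F] [Algebra.FiniteType ℤ F] :
    Finite F := by
  have := Int.isJacobsonRing
  have hfin : Module.Finite ℤ F := finite_of_finite_type_of_isJacobsonRing ℤ F
  have hker : ¬ Function.Injective (algebraMap ℤ F) := fun h ↦
    Int.not_isField (isField_of_isIntegral_of_isField h (Field.toIsField F))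
  obtain ⟨n, hn, hn0⟩ : ∃ n : ℤ, algebraMap ℤ F n = 0 ∧ n ≠ 0 := by
    rw [injective_iff_map_eq_zero] at hker
    push Not at hker
    exact hker
  refine Module.finite_of_fg_torsion F fun {x} ↦ ⟨⟨n, mem_nonZeroDivisors_of_ne_zero hn0⟩, ?_⟩
  change n • x = 0
  rw [Algebra.smul_def, hn, zero_mul]

theorem Ideal.finite_quotient_of_finiteType_int {R : Type*} [CommRing R] [inst : Algebra ℤ R]
    [Algebra.FiniteType ℤ R] (m : Ideal R) [m.IsMaximal] : Finite (R ⧸ m) := by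
  obtain rfl : inst = Ring.toIntAlgebra R := Subsingleton.elim _ _
  let _ : Field (R ⧸ m) := Ideal.Quotient.field m
  have : @Algebra.FiniteType ℤ (R ⧸ m) _ _ (Ring.toIntAlgebra _) :=
    .of_surjective (Ideal.Quotient.mk m).toIntAlgHom Ideal.Quotient.mk_surjective
  exact Field.finite_of_finiteType_int (R ⧸ m)

namespace Subalgebra

variable {k K A B : Type*} [CommRing k] [CommRing K] [Algebra k K]
  [CommRing A] [Algebra k A] [CommRing B] [Algebra k B]

variable (A) in
/-- The canonical map `R ⊗[k] A → K ⊗[k] A` for a subalgebra `R` of `K`. -/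
noncomputable def tensorInclusion (R : Subalgebra k K) : R ⊗[k] A →ₐ[R] K ⊗[k] A :=
  Algebra.TensorProduct.map (Algebra.ofId R K) (AlgHom.id k A)

theorem tensorInclusion_injective [Module.Flat k A] (R : Subalgebra k K) :
    Function.Injective (R.tensorInclusion A) :=
  Module.Flat.rTensor_preserves_injective_linearMap (M := A) R.val.toLinearMap
    Subtype.val_injective

theorem mem_range_tensorInclusion_mono {R S : Subalgebra k K} (h : R ≤ S) {x : K ⊗[k] A}
    (hx : x ∈ (R.tensorInclusion A).range) : x ∈ (S.tensorInclusion A).range := by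
  obtain ⟨t, rfl⟩ := hx
  refine ⟨Algebra.TensorProduct.map (inclusion h) (AlgHom.id k A) t, ?_⟩
  induction t with
  | zero => simp
  | tmul r a => rfl
  | add t u ht hu => simp only [map_add, ht, hu]

theorem exists_fg_mem_range_tensorInclusion (x : K ⊗[k] A) :
    ∃ R : Subalgebra k K, R.FG ∧ x ∈ (R.tensorInclusion A).range := by
  induction x with
  | zero => exact ⟨⊥, fg_bot, zero_mem _⟩
  | tmul c a =>
    exact ⟨Algebra.adjoin k {c}, ⟨{c}, by simp⟩,
      ⟨⟨c, Algebra.self_mem_adjoin_singleton k c⟩ ⊗ₜ a, rfl⟩⟩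
  | add x y hx hy =>
    obtain ⟨R, hR, hx⟩ := hx
    obtain ⟨S, hS, hy⟩ := hy
    exact ⟨R ⊔ S, hR.sup hS, add_mem (mem_range_tensorInclusion_mono le_sup_left hx)
      (mem_range_tensorInclusion_mono le_sup_right hy)⟩

theorem exists_fg_forall_mem_range_tensorInclusion (s : Finset (K ⊗[k] A)) :
    ∃ R : Subalgebra k K, R.FG ∧ ∀ x ∈ s, x ∈ (R.tensorInclusion A).range := by
  classical
  choose R hR hmem using exists_fg_mem_range_tensorInclusion (k := k) (K := K) (A := A)
  refine ⟨s.sup R, ?_, fun x hx ↦ mem_range_tensorInclusion_mono (Finset.le_sup hx) (hmem x)⟩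
  exact Finset.sup_induction (p := Subalgebra.FG) fg_bot (fun _ h _ h' ↦ h.sup h')
    fun x _ ↦ hR x

/-- A homomorphism out of the base change of a finite type algebra is defined over a finitely
generated ring of coefficients. -/
theorem exists_fg_forall_map_mem_range_tensorInclusion [Algebra.FiniteType k A]
    (f : K ⊗[k] A →ₐ[K] K ⊗[k] B) :
    ∃ R : Subalgebra k K, R.FG ∧ ∀ S, R ≤ S → ∀ x ∈ (S.tensorInclusion A).range,
      f x ∈ (S.tensorInclusion B).range := by
  classical
  obtain ⟨s, hs⟩ := Algebra.FiniteType.out (R := k) (A := A)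
  obtain ⟨R, hR, hmem⟩ :=
    exists_fg_forall_mem_range_tensorInclusion (s.image fun a ↦ f (1 ⊗ₜ[k] a))
  refine ⟨R, hR, fun S hRS ↦ ?_⟩
  have hone (a : A) : f (1 ⊗ₜ a) ∈ (S.tensorInclusion B).range := by
    have hle : Algebra.adjoin k (s : Set A) ≤ ((S.tensorInclusion B).range.restrictScalars k).comap
        ((f.restrictScalars k).comp Algebra.TensorProduct.includeRight) :=
      Algebra.adjoin_le fun b hb ↦ mem_range_tensorInclusion_mono hRS
        (hmem _ (Finset.mem_image_of_mem _ hb))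
    exact hle (hs ▸ Algebra.mem_top)
  rintro _ ⟨t, rfl⟩
  induction t with
  | zero => simp
  | tmul r a =>
    have : f ((r : K) ⊗ₜ a) = r • f (1 ⊗ₜ a) := by
      change _ = (r : K) • f (1 ⊗ₜ a)
      rw [← map_smul, TensorProduct.smul_tmul', smul_eq_mul, mul_one]
    change f ((r : K) ⊗ₜ a) ∈ _
    rw [this]
    exact Subalgebra.smul_mem _ (hone a) r
  | add t u ht hu => simpa using add_mem ht hu

/-- An isomorphism between base changes of flat algebras of finite type descends to a finitely
generated ring of coefficients. -/
theorem exists_fg_nonempty_algEquiv_tensor [Module.Flat k A] [Module.Flat k B]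
    [Algebra.FiniteType k A] [Algebra.FiniteType k B] (e : K ⊗[k] A ≃ₐ[K] K ⊗[k] B) :
    ∃ R : Subalgebra k K, R.FG ∧ Nonempty (R ⊗[k] A ≃ₐ[R] R ⊗[k] B) := by
  obtain ⟨R, hR, hf⟩ := exists_fg_forall_map_mem_range_tensorInclusion e.toAlgHom
  obtain ⟨S, hS, hg⟩ := exists_fg_forall_map_mem_range_tensorInclusion e.symm.toAlgHom
  refine ⟨R ⊔ S, hR.sup hS, ⟨?_⟩⟩
  have hmap : (((R ⊔ S).tensorInclusion A).range).map (e.restrictScalars ↥(R ⊔ S)).toAlgHom =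
      ((R ⊔ S).tensorInclusion B).range := by
    apply le_antisymm
    · rintro _ ⟨x, hx, rfl⟩
      exact hf _ le_sup_left x hx
    · intro y hy
      exact ⟨e.symm y, hg _ le_sup_right y hy, e.apply_symm_apply y⟩
  exact (AlgEquiv.ofInjective _ (tensorInclusion_injective _)).trans
    ((((e.restrictScalars ↥(R ⊔ S)).subalgebraMap _).trans (equivOfEq _ _ hmap)).trans
      (AlgEquiv.ofInjective _ (tensorInclusion_injective _)).symm)

end Subalgebra

/-- **Lemma 4.8.**  Let `ℤ ⊆ A`, `ℤ ⊆ B` be finitely generated ring extensions such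
that `A`, `B` are integral domains.  If there is a field `K` and a `K`-algebra
isomorphism `K ⊗_ℤ A ≅ K ⊗_ℤ B`, then there is a finite field `F` (i.e. a field `F_q`
with `q` elements for some prime power `q`) such that `F ⊗_ℤ A` and `F ⊗_ℤ B` are
isomorphic as `F`-algebras. -/
theorem stmt14 (A B : Type) [CommRing A] [CommRing B] [IsDomain A] [IsDomain B]
    (hA : Function.Injective (algebraMap ℤ A))
    (hB : Function.Injective (algebraMap ℤ B))
    (hfgA : Algebra.FiniteType ℤ A) (hfgB : Algebra.FiniteType ℤ B)
    (K : Type) [Field K]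
    (hiso : Nonempty ((K ⊗[ℤ] A) ≃ₐ[K] (K ⊗[ℤ] B))) :
    ∃ (F : Type) (_ : Field F) (_ : Finite F),
      Nonempty ((F ⊗[ℤ] A) ≃ₐ[F] (F ⊗[ℤ] B)) := by
  obtain ⟨e⟩ := hiso
  have : Module.IsTorsionFree ℤ A := Module.isTorsionFree_iff_algebraMap_injective.mpr hA
  have : Module.IsTorsionFree ℤ B := Module.isTorsionFree_iff_algebraMap_injective.mpr hB
  obtain ⟨R, hR, ⟨eR⟩⟩ := Subalgebra.exists_fg_nonempty_algEquiv_tensor e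
  obtain ⟨m, hm⟩ := Ideal.exists_maximal R
  let _ : Field (R ⧸ m) := Ideal.Quotient.field m
  have : Algebra.FiniteType ℤ R := ⟨R.fg_top.mpr hR⟩
  refine ⟨R ⧸ m, inferInstance, Ideal.finite_quotient_of_finiteType_int m, ⟨?_⟩⟩
  exact ((Algebra.TensorProduct.cancelBaseChange ℤ R (R ⧸ m) (R ⧸ m) A).symm.trans
    (Algebra.TensorProduct.congr AlgEquiv.refl eR)).trans
    (Algebra.TensorProduct.cancelBaseChange ℤ R (R ⧸ m) (R ⧸ m) B)
end

section
/- Let k be an algebraically closed field and let f ∈ k[x_0, …, x_n] be an irreducible homogeneous polynomial of degree 2. Then there is a linear change of coordinates of P^n transforming f (up to a nonzero scalar) into Σ_{i=0}^{m−1} x_{2i} x_{2i+1} for some m with 1 < 2m − 1 ≤ n, or into (Σ_{i=0}^{m−1} x_{2i} x_{2i+1}) + x_{2m}^2 for some m with 0 < 2m ≤ n. -/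
open MvPolynomial

noncomputable section

/-- The quadratic form `x_0 x_1 + x_2 x_3 + ⋯ + x_{2m-2} x_{2m-1}` as a polynomial in
`k[x_0, …, x_n]` (for `2m ≤ n + 1`). -/
def hypPoly (k : Type) [Field k] (m n : ℕ) (hm : 2 * m ≤ n + 1) :
    MvPolynomial (Fin (n + 1)) k :=
  ∑ i : Fin m,
    X ⟨2 * i.1, by have := i.2; omega⟩ * X ⟨2 * i.1 + 1, by have := i.2; omega⟩

/-- A nonzero quadratic polynomial over an algebraically closed field has a root. -/
theorem exists_sq_add_mul_add_eq_zero {k : Type*} [Field k] [IsAlgClosed k] (b c : k) :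
    ∃ t : k, t ^ 2 + b * t + c = 0 := by
  obtain ⟨t, ht⟩ := IsAlgClosed.exists_root
    (Polynomial.C 1 * Polynomial.X ^ 2 + Polynomial.C b * Polynomial.X + Polynomial.C c)
    (by rw [Polynomial.degree_quadratic one_ne_zero]; decide)
  exact ⟨t, by simpa [Polynomial.IsRoot] using ht⟩

/-- If a quadratic form `Q` pairs some isotropic vector nontrivially, then it splits off a
hyperbolic plane. -/
theorem QuadraticForm.exists_hyperbolic_splitting {k V : Type*} [Field k] [AddCommGroup V]
    [Module k V] (Q : QuadraticForm k V) {e u : V} (he : Q e = 0)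
    (heu : QuadraticMap.polar Q e u ≠ 0) :
    ∃ (W : Submodule k V) (T : (k × k × W) ≃ₗ[k] V),
      ∀ a b w, Q (T (a, b, w)) = a * b + Q w := by
  obtain ⟨u', hu'⟩ : ∃ u', QuadraticMap.polar Q e u' = 1 :=
    ⟨(QuadraticMap.polar Q e u)⁻¹ • u, by
      rw [QuadraticMap.polar_smul_right, smul_eq_mul, inv_mul_cancel₀ heu]⟩
  obtain ⟨f, hf, hef⟩ : ∃ f, Q f = 0 ∧ QuadraticMap.polar Q e f = 1 := by
    refine ⟨u' + (-Q u') • e, ?_, ?_⟩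
    · rw [QuadraticMap.map_add Q, QuadraticMap.map_smul, he, QuadraticMap.polar_smul_right,
        QuadraticMap.polar_comm, hu']
      simp
    · rw [QuadraticMap.polar_add_right, QuadraticMap.polar_smul_right, hu',
        QuadraticMap.polar_self, he]
      simp
  have hfe : QuadraticMap.polar Q f e = 1 := by rw [QuadraticMap.polar_comm, hef]
  have hee : QuadraticMap.polar Q e e = 0 := by rw [QuadraticMap.polar_self, he, smul_zero]
  have hff : QuadraticMap.polar Q f f = 0 := by rw [QuadraticMap.polar_self, hf, smul_zero]
  let W : Submodule k V :=
    LinearMap.ker (Q.polarBilin e) ⊓ LinearMap.ker (Q.polarBilin f)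
  have hW (w : V) : w ∈ W ↔ QuadraticMap.polar Q e w = 0 ∧ QuadraticMap.polar Q f w = 0 := by
    simp [W]
  let L : (k × k × W) →ₗ[k] V :=
    (LinearMap.toSpanSingleton k V e).coprod
      ((LinearMap.toSpanSingleton k V f).coprod W.subtype)
  have hL (a b : k) (w : W) : L (a, b, w) = a • e + (b • f + w) := by simp [L]
  have hLe (a b : k) (w : W) : QuadraticMap.polar Q e (L (a, b, w)) = b := by
    simp [hL, QuadraticMap.polar_add_right, QuadraticMap.polar_smul_right, hee, hef,
      ((hW w).1 w.2).1]
  have hLf (a b : k) (w : W) : QuadraticMap.polar Q f (L (a, b, w)) = a := by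
    simp [hL, QuadraticMap.polar_add_right, QuadraticMap.polar_smul_right, hff, hfe,
      ((hW w).1 w.2).2]
  have hbij : Function.Bijective L := by
    constructor
    · rw [← LinearMap.ker_eq_bot, LinearMap.ker_eq_bot']
      rintro ⟨a, b, w⟩ h
      have ha := hLf a b w
      have hb := hLe a b w
      rw [h, QuadraticMap.polar_zero_right] at ha hb
      subst ha hb
      simpa [hL] using h
    · intro v
      refine ⟨(QuadraticMap.polar Q f v, QuadraticMap.polar Q e v,
        ⟨v - QuadraticMap.polar Q f v • e - QuadraticMap.polar Q e v • f, ?_⟩), ?_⟩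
      · rw [hW]
        simp [QuadraticMap.polar_sub_right, QuadraticMap.polar_smul_right, hee, hef, hff, hfe]
      · rw [hL]
        module
  refine ⟨W, LinearEquiv.ofBijective L hbij, fun a b w => ?_⟩
  rw [LinearEquiv.ofBijective_apply, hL, QuadraticMap.map_add Q, QuadraticMap.map_add Q]
  simp [QuadraticMap.map_smul, he, hf, QuadraticMap.polar_smul_left,
    QuadraticMap.polar_smul_right, QuadraticMap.polar_add_right, hef, ((hW w).1 w.2).1,
    ((hW w).1 w.2).2]
  ring

/-- A nonzero quadratic form whose isotropic vectors all lie in the radical of its polar form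
is the square of a linear form. -/
theorem QuadraticForm.exists_square_splitting {k V : Type*} [Field k] [IsAlgClosed k]
    [AddCommGroup V] [Module k V] (Q : QuadraticForm k V)
    (hQ : ∀ e u, Q e = 0 → QuadraticMap.polar Q e u = 0) {v : V} (hv : Q v ≠ 0) :
    ∃ (W : Submodule k V) (T : (k × W) ≃ₗ[k] V), ∀ a w, Q (T (a, w)) = a ^ 2 := by
  obtain ⟨v₀, hv₀⟩ : ∃ v₀, Q v₀ = 1 := by
    obtain ⟨t, ht⟩ := IsAlgClosed.exists_pow_nat_eq (Q v)⁻¹ two_pos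
    exact ⟨t • v, by rw [QuadraticMap.map_smul, smul_eq_mul, ← sq, ht, inv_mul_cancel₀ hv]⟩
  let W : Submodule k V :=
    { carrier := {w | Q w = 0}
      add_mem' := fun {x y} hx hy => by
        simp only [Set.mem_ofPred_eq] at hx hy ⊢
        rw [QuadraticMap.map_add Q, hx, hy, hQ x y hx]
        simp
      zero_mem' := by simp
      smul_mem' := fun c x hx => by
        simp only [Set.mem_ofPred_eq] at hx ⊢
        rw [QuadraticMap.map_smul, hx, smul_zero] }
  have hW (w : W) : Q w = 0 := w.2
  let L : (k × W) →ₗ[k] V := (LinearMap.toSpanSingleton k V v₀).coprod W.subtype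
  have hL (a : k) (w : W) : L (a, w) = a • v₀ + w := by simp [L]
  have hQL (a : k) (w : W) : Q (L (a, w)) = a ^ 2 := by
    rw [hL, QuadraticMap.map_add Q, QuadraticMap.map_smul, hv₀, hW, QuadraticMap.polar_comm,
      hQ _ _ (hW w)]
    simp [sq]
  have hbij : Function.Bijective L := by
    constructor
    · rw [← LinearMap.ker_eq_bot, LinearMap.ker_eq_bot']
      rintro ⟨a, w⟩ h
      have ha := hQL a w
      rw [h, QuadraticMap.map_zero, eq_comm, sq_eq_zero_iff] at ha
      subst ha
      simpa [hL] using h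
    · intro w
      obtain ⟨t, ht⟩ := exists_sq_add_mul_add_eq_zero (-QuadraticMap.polar Q w v₀) (Q w)
      refine ⟨(t, ⟨w - t • v₀, ?_⟩), by rw [hL]; module⟩
      change Q (w - t • v₀) = 0
      rw [sub_eq_add_neg, ← neg_smul, QuadraticMap.map_add Q, QuadraticMap.map_smul,
        QuadraticMap.polar_smul_right, hv₀, smul_eq_mul, smul_eq_mul]
      linear_combination ht
  exact ⟨W, LinearEquiv.ofBijective L hbij, hQL⟩

/-- Every quadratic form on an `N`-dimensional space over an algebraically closed field is, in
suitable coordinates, a sum of `m` hyperbolic planes, possibly plus one square. -/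
theorem QuadraticForm.exists_coordinates {k : Type*} [Field k] [IsAlgClosed k] {V : Type*}
    [AddCommGroup V] [Module k V] [FiniteDimensional k V] (N : ℕ)
    (hN : Module.finrank k V = N) (Q : QuadraticForm k V) :
    ∃ (φ : V ≃ₗ[k] (Fin N → k)) (m : ℕ) (hm : 2 * m ≤ N),
      (∀ v, Q v = ∑ i : Fin m, φ v ⟨2 * i.1, by have := i.2; omega⟩ *
        φ v ⟨2 * i.1 + 1, by have := i.2; omega⟩) ∨
      ∃ h : 2 * m < N, ∀ v, Q v = ∑ i : Fin m, φ v ⟨2 * i.1, by have := i.2; omega⟩ *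
        φ v ⟨2 * i.1 + 1, by have := i.2; omega⟩ + φ v ⟨2 * m, h⟩ ^ 2 := by
  induction N using Nat.strong_induction_on generalizing V with
  | _ N ih =>
  by_cases hQ : ∃ e u, Q e = 0 ∧ QuadraticMap.polar Q e u ≠ 0
  · obtain ⟨e, u, he, heu⟩ := hQ
    obtain ⟨W, T, hT⟩ := Q.exists_hyperbolic_splitting he heu
    have hfin : N = Module.finrank k W + 2 := by
      rw [← hN, ← T.finrank_eq, Module.finrank_prod, Module.finrank_prod, Module.finrank_self]
      omega
    generalize hd : Module.finrank k W = d at hfin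
    subst hfin
    obtain ⟨ψ, m, hm, h⟩ := ih d (by omega) hd (Q.comp W.subtype)
    let φ : V ≃ₗ[k] (Fin (d + 2) → k) := T.symm ≪≫ₗ
      ((LinearEquiv.refl k k).prodCongr (((LinearEquiv.refl k k).prodCongr ψ) ≪≫ₗ
        Fin.consLinearEquiv k (fun _ => k))) ≪≫ₗ Fin.consLinearEquiv k (fun _ => k)
    have hφ (a b : k) (w : W) :
        φ (T (a, b, w)) = Fin.cons a (Fin.cons b (ψ w) : Fin (d + 1) → k) := by
      simp only [φ, LinearEquiv.trans_apply, LinearEquiv.symm_apply_apply]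
      rfl
    have h0 (a b : k) (w : W) (hlt) : φ (T (a, b, w)) ⟨0, hlt⟩ = a := by rw [hφ]; rfl
    have h1 (a b : k) (w : W) (hlt) : φ (T (a, b, w)) ⟨0 + 1, hlt⟩ = b := by rw [hφ]; rfl
    have h2 (a b : k) (w : W) (i : ℕ) (hlt) :
        φ (T (a, b, w)) ⟨i + 2, hlt⟩ = ψ w ⟨i, by omega⟩ := by rw [hφ]; rfl
    have hsum (a b : k) (w : W) : ∑ i : Fin (m + 1),
        φ (T (a, b, w)) ⟨2 * i.1, by have := i.2; omega⟩ *
          φ (T (a, b, w)) ⟨2 * i.1 + 1, by have := i.2; omega⟩ =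
        a * b + ∑ i : Fin m, ψ w ⟨2 * i.1, by have := i.2; omega⟩ *
          ψ w ⟨2 * i.1 + 1, by have := i.2; omega⟩ := by
      rw [Fin.sum_univ_succ]
      congr 1
      · exact congrArg₂ _ (h0 ..) (h1 ..)
      · exact Finset.sum_congr rfl fun i _ => congrArg₂ _ (h2 ..) (h2 a b w (2 * i.1 + 1) _)
    refine ⟨φ, m + 1, by omega, h.imp (fun h v => ?_) ?_⟩
    · obtain ⟨⟨a, b, w⟩, rfl⟩ := T.surjective v
      rw [hsum, hT, ← h w]
      rfl
    · rintro ⟨hlt, h⟩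
      refine ⟨by omega, fun v => ?_⟩
      obtain ⟨⟨a, b, w⟩, rfl⟩ := T.surjective v
      have hlast : φ (T (a, b, w)) ⟨2 * (m + 1), by omega⟩ = ψ w ⟨2 * m, hlt⟩ := h2 ..
      rw [hsum, hT, hlast, add_assoc, ← h w]
      rfl
  · push Not at hQ
    by_cases hv : ∃ v, Q v ≠ 0
    · obtain ⟨v, hv⟩ := hv
      obtain ⟨W, T, hT⟩ := Q.exists_square_splitting hQ hv
      have hfin : N = Module.finrank k W + 1 := by
        rw [← hN, ← T.finrank_eq, Module.finrank_prod, Module.finrank_self]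
        omega
      generalize hd : Module.finrank k W = d at hfin
      subst hfin
      let φ : V ≃ₗ[k] (Fin (d + 1) → k) := T.symm ≪≫ₗ
        ((LinearEquiv.refl k k).prodCongr (LinearEquiv.ofFinrankEq W (Fin d → k) (by simp [hd])))
          ≪≫ₗ Fin.consLinearEquiv k (fun _ => k)
      refine ⟨φ, 0, by omega, Or.inr ⟨by omega, fun v => ?_⟩⟩
      obtain ⟨⟨a, w⟩, rfl⟩ := T.surjective v
      have h0 : φ (T (a, w)) ⟨2 * 0, by omega⟩ = a := by
        change φ (T (a, w)) 0 = a
        simp [φ]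
      rw [h0, hT]
      simp
    · push Not at hv
      exact ⟨LinearEquiv.ofFinrankEq V (Fin N → k) (by simp [hN]), 0, by omega,
        Or.inl fun v => by simp [hv]⟩

/-- The evaluation of a quadratic homogeneous polynomial is a quadratic form. -/
theorem MvPolynomial.IsHomogeneous.exists_quadraticForm {k σ : Type*} [Field k] [Fintype σ]
    {f : MvPolynomial σ k} (hf : f.IsHomogeneous 2) :
    ∃ Q : QuadraticForm k (σ → k), ∀ v, Q v = eval v f := by
  have hmon (d : σ →₀ ℕ) (hd : d.degree = 2) (c : k) :
      ∃ Q : QuadraticForm k (σ → k), ∀ v, Q v = eval v (monomial d c) := by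
    obtain ⟨i, d', rfl⟩ : ∃ i d', d = Finsupp.single i 1 + d' := by
      have : d ≠ 0 := by rintro rfl; simp at hd
      obtain ⟨i, hi⟩ := Finsupp.ne_iff.1 this
      exact ⟨i, d - Finsupp.single i 1, (add_tsub_cancel_of_le (by
        rw [Finsupp.single_le_iff]; exact Nat.one_le_iff_ne_zero.2 hi)).symm⟩
    obtain ⟨j, rfl⟩ : ∃ j, d' = Finsupp.single j 1 := by
      rw [map_add, Finsupp.degree_single] at hd
      have : d' ∈ {d : σ →₀ ℕ | d.degree = 1} := by
        change d'.degree = 1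
        omega
      rw [← Finsupp.range_single_one] at this
      exact this.imp fun _ => Eq.symm
    refine ⟨c • QuadraticMap.linMulLin (LinearMap.proj i) (LinearMap.proj j), fun v => ?_⟩
    classical
    rw [eval_monomial, Finsupp.prod_add_index' (by simp) (by simp [pow_add])]
    simp
  choose! q hq using hmon
  refine ⟨∑ d ∈ f.support, q d (f.coeff d), fun v => ?_⟩
  conv_rhs => rw [f.as_sum]
  rw [map_sum, sum_apply]
  exact Finset.sum_congr rfl fun d hd => hq d
    (by rw [Finsupp.degree_eq_weight_one]; exact hf (mem_support_iff.1 hd)) _ v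

/-- An irreducible polynomial is not, as a function, the product of two linear forms. -/
theorem MvPolynomial.not_irreducible_of_eval_eq_mul {k σ : Type*} [Field k] [Infinite k]
    [Fintype σ] {f : MvPolynomial σ k} (ℓ ℓ' : (σ → k) →ₗ[k] k)
    (h : ∀ v, eval v f = ℓ v * ℓ' v) : ¬ Irreducible f := by
  classical
  intro hf
  have hlin (ℓ : (σ → k) →ₗ[k] k) : ∃ p : MvPolynomial σ k, ∀ v, eval v p = ℓ v := by
    refine ⟨∑ j, C (ℓ (Pi.single j 1)) * X j, fun v => ?_⟩
    conv_rhs => rw [← LinearMap.sum_single_apply _ v, map_sum]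
    simp only [map_sum, map_mul, eval_C, eval_X]
    refine Finset.sum_congr rfl fun j _ => ?_
    rw [mul_comm, ← smul_eq_mul, ← map_smul, ← Pi.single_smul, smul_eq_mul, mul_one]
  have hunit (ℓ : (σ → k) →ₗ[k] k) (p : MvPolynomial σ k) (hp : ∀ v, eval v p = ℓ v) :
      ¬ IsUnit p := fun hu => by
    have := hu.map (eval (0 : σ → k))
    rw [hp, map_zero] at this
    exact not_isUnit_zero this
  obtain ⟨p, hp⟩ := hlin ℓ
  obtain ⟨p', hp'⟩ := hlin ℓ'
  have hfp : f = p * p' := MvPolynomial.funext fun v => by rw [h, map_mul, hp, hp']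
  exact (hf.isUnit_or_isUnit hfp).elim (hunit ℓ p hp) (hunit ℓ' p' hp')

/-- **Proposition 4.12.**  Over an algebraically closed field `k`, every irreducible
quadric hypersurface of `ℙⁿ` is given, under a suitable linear change of coordinates
(an invertible linear substitution of the variables) and up to a nonzero scalar, by
`x_0 x_1 + ⋯ + x_{2m-2} x_{2m-1}` with `1 < 2m - 1 ≤ n`, or by
`x_0 x_1 + ⋯ + x_{2m-2} x_{2m-1} + x_{2m}^2` with `0 < 2m ≤ n`. -/
theorem stmt17 (k : Type) [Field k] [IsAlgClosed k] (n : ℕ)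
    (f : MvPolynomial (Fin (n + 1)) k)
    (hf : Irreducible f) (hfd : f.IsHomogeneous 2) :
    ∃ (M : Matrix (Fin (n + 1)) (Fin (n + 1)) k) (c : k), IsUnit M.det ∧ c ≠ 0 ∧
      ((∃ (m : ℕ) (hm : 2 * m ≤ n + 1), 1 < 2 * m - 1 ∧ 2 * m - 1 ≤ n ∧
          aeval (fun i => ∑ j, C (M i j) * X j) f = C c * hypPoly k m n hm) ∨
       (∃ (m : ℕ) (hm : 2 * m ≤ n), 0 < 2 * m ∧
          aeval (fun i => ∑ j, C (M i j) * X j) f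
            = C c * (hypPoly k m n (by omega) + X ⟨2 * m, by omega⟩ ^ 2))) := by
  obtain ⟨Q, hQ⟩ := hfd.exists_quadraticForm
  obtain ⟨φ, m, hm, h⟩ := Q.exists_coordinates (n + 1) (by simp)
  have hirr (ℓ ℓ' : (Fin (n + 1) → k) →ₗ[k] k) : ¬ ∀ v, Q v = ℓ v * ℓ' v := fun h =>
    not_irreducible_of_eval_eq_mul ℓ ℓ' (fun v => by rw [← hQ, h]) hf
  have hsubst (x : Fin (n + 1) → k) :
      eval x (aeval (fun i => ∑ j, C (LinearMap.toMatrix' φ.symm.toLinearMap i j) * X j) f) =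
        Q (φ.symm x) := by
    have hcoord : (fun i => eval x
        (∑ j, C (LinearMap.toMatrix' φ.symm.toLinearMap i j) * X j)) = φ.symm x := by
      have := congrFun (LinearMap.toMatrix'_mulVec φ.symm.toLinearMap x)
      ext i
      simpa [Matrix.mulVec, dotProduct] using this i
    rw [hQ, aeval_def, eval_eval₂, hcoord, algebraMap_eq,
      show (eval x).comp C = RingHom.id k from RingHom.ext fun r => eval_C r]
    rfl
  refine ⟨LinearMap.toMatrix' φ.symm.toLinearMap, 1, ?_, one_ne_zero, ?_⟩
  · rw [LinearMap.det_toMatrix']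
    exact φ.symm.isUnit_det'
  rcases h with h | ⟨hlt, h⟩
  · have hm2 : 2 ≤ m := by
      by_contra! hlt
      interval_cases m
      · exact hirr 0 0 fun v => by simp [h]
      · exact hirr (LinearMap.proj ⟨0, by omega⟩ ∘ₗ φ.toLinearMap)
          (LinearMap.proj ⟨1, by omega⟩ ∘ₗ φ.toLinearMap) fun v => by simp [h]
    refine Or.inl ⟨m, hm, by omega, by omega, MvPolynomial.funext fun x => ?_⟩
    rw [hsubst, h]
    simp [hypPoly]
  · have hm1 : 0 < m := by
      by_contra! hle
      obtain rfl : m = 0 := by omega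
      exact hirr (LinearMap.proj ⟨0, by omega⟩ ∘ₗ φ.toLinearMap)
        (LinearMap.proj ⟨0, by omega⟩ ∘ₗ φ.toLinearMap) fun v => by simp [h, sq]
    refine Or.inr ⟨m, by omega, by omega, MvPolynomial.funext fun x => ?_⟩
    rw [hsubst, h]
    simp [hypPoly]

end
end
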